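/- Assume ω ∈ ℝ^n satisfies (H1) and f : T^n → ℝ is smooth. For μ small let G_μ(A) be the homoclinic function (action along the 1-bump pseudo-heteroclinic q^μ_{A,0}) and let G̃_μ(A) = ∫_ℝ ℒ_μ(Q^μ_{A,0}(t), Q̇^μ_{A,0}(t), t) dt be the reduced homoclinic function (action along the modified pseudo-heteroclinic Q^μ_{A,0}). Then for μ small enough there exists a smooth diffeomorphism ψ_μ : T^n → T^n of the form ψ_μ(A) = A + g_μ(A)·ω, with g_μ : T^n → ℝ satisfying (g_μ(A), ∂_A g_μ(A)) → 0 uniformly as μ → 0, such that G_μ = G̃_μ ∘ ψ_μ. -/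

import Mathlib

open Real Filter MeasureTheory

/-- The unperturbed pendulum separatrix `q₀(t) = 4 arctan(eᵗ)`. -/
noncomputable def q0 (t : ℝ) : ℝ := 4 * Real.arctan (Real.exp t)

/-- `ψ₀(t) = cosh²(t)/(1 + cosh t)³`. -/
noncomputable def psi0 (t : ℝ) : ℝ := Real.cosh t ^ 2 / (1 + Real.cosh t) ^ 3

/-- `q` is a 1-bump pseudo-heteroclinic solution of
`-q̈ + sin q = μ sin q · f(ωt + A)`, glued at `q(θ) = π`. -/
def IsPseudoHet (n : ℕ) (ω : Fin n → ℝ) (f : (Fin n → ℝ) → ℝ) (μ : ℝ)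
    (A : Fin n → ℝ) (θ : ℝ) (C : ℝ) (q : ℝ → ℝ) : Prop :=
  Continuous q ∧
  (∀ t : ℝ, |q t - q0 (t - θ)| ≤ C * |μ|) ∧
  (∀ t : ℝ, t ≠ θ →
    HasDerivAt q (deriv q t) t ∧
    HasDerivAt (deriv q)
      (Real.sin (q t) - μ * Real.sin (q t) * f (fun i => ω i * t + A i)) t) ∧
  q θ = Real.pi ∧
  Tendsto q atBot (nhds 0) ∧
  Tendsto q atTop (nhds (2 * Real.pi))

/-- `(Q, α)` is a modified 1-bump pseudo-heteroclinic solution: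
`-Q̈ + sin Q = μ sin Q · f(ωt + A) + α ψ_θ` with `∫ (Q - q_θ) ψ_θ = 0`. -/
def IsModPseudoHet (n : ℕ) (ω : Fin n → ℝ) (f : (Fin n → ℝ) → ℝ) (μ : ℝ)
    (A : Fin n → ℝ) (θ : ℝ) (C : ℝ) (Q : ℝ → ℝ) (α : ℝ) : Prop :=
  Continuous Q ∧
  (∀ t : ℝ, |Q t - q0 (t - θ)| ≤ C * |μ|) ∧
  (∀ t : ℝ,
    HasDerivAt Q (deriv Q t) t ∧
    HasDerivAt (deriv Q)
      (Real.sin (Q t) - μ * Real.sin (Q t) * f (fun i => ω i * t + A i)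
        - α * psi0 (t - θ)) t) ∧
  (∫ t : ℝ, (Q t - q0 (t - θ)) * psi0 (t - θ)) = 0 ∧
  Tendsto Q atBot (nhds 0) ∧
  Tendsto Q atTop (nhds (2 * Real.pi))

/-- The Lagrangian `ℒ_μ(q, q̇, t) = q̇²/2 + (1 - cos q) + μ (cos q - 1) f(ωt + A)`. -/
noncomputable def Lag (n : ℕ) (ω : Fin n → ℝ) (f : (Fin n → ℝ) → ℝ) (μ : ℝ)
    (A : Fin n → ℝ) (q : ℝ → ℝ) (t : ℝ) : ℝ :=
  (deriv q t) ^ 2 / 2 + (1 - Real.cos (q t)) +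
    μ * (Real.cos (q t) - 1) * f (fun i => ω i * t + A i)

/-- The homoclinic function `G_μ(A)`: action along `q^μ_{A,0}`. -/
noncomputable def Homoclinic (n : ℕ) (ω : Fin n → ℝ) (f : (Fin n → ℝ) → ℝ) (μ : ℝ)
    (A : Fin n → ℝ) (q : ℝ → ℝ) : ℝ :=
  (∫ t in Set.Iio (0:ℝ), Lag n ω f μ A q t) + (∫ t in Set.Ioi (0:ℝ), Lag n ω f μ A q t)

/-- The reduced homoclinic function `G̃_μ(A)`: action along `Q^μ_{A,0}`. -/
noncomputable def RedHomoclinic (n : ℕ) (ω : Fin n → ℝ) (f : (Fin n → ℝ) → ℝ) (μ : ℝ)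
    (A : Fin n → ℝ) (Q : ℝ → ℝ) : ℝ :=
  ∫ t : ℝ, Lag n ω f μ A Q t

section HomoclinicHelpers
open scoped Topology ContDiff BoundedContinuousFunction

open scoped Topology ContDiff

def SmoothNear {E F : Type*} [NormedAddCommGroup E] [NormedSpace ℝ E]
    [NormedAddCommGroup F] [NormedSpace ℝ F] (f : E → F) (x : E) : Prop :=
  ∀ᶠ y in 𝓝 x, ContDiffAt ℝ ∞ f y

section smoothnear
variable {E F G : Type*} [NormedAddCommGroup E] [NormedSpace ℝ E]
    [NormedAddCommGroup F] [NormedSpace ℝ F] [NormedAddCommGroup G] [NormedSpace ℝ G]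

theorem SmoothNear.self {f : E → F} {x : E} (h : SmoothNear f x) : ContDiffAt ℝ ∞ f x :=
  Eventually.self_of_nhds h

theorem SmoothNear.cont {f : E → F} {x : E} (h : SmoothNear f x) : ContinuousAt f x :=
  h.self.continuousAt

theorem SmoothNear.diff {f : E → F} {x : E} (h : SmoothNear f x) : DifferentiableAt ℝ f x :=
  h.self.differentiableAt (by simp)

theorem ContDiff.smoothNear {f : E → F} (h : ContDiff ℝ ∞ f) (x : E) : SmoothNear f x :=
  Eventually.of_forall fun _ => h.contDiffAt

theorem SmoothNear.comp {g : F → G} {f : E → F} {x : E} (hg : SmoothNear g (f x))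
    (hf : SmoothNear f x) : SmoothNear (fun y => g (f y)) x := by
  have h := hf.cont.eventually hg
  filter_upwards [hf, h] with y h1 h2
  exact ContDiffAt.comp y h2 h1

theorem SmoothNear.comp' {g : F → G} {f : E → F} {x : E} {y : F} (hg : SmoothNear g y)
    (hf : SmoothNear f x) (hy : f x = y) : SmoothNear (fun y => g (f y)) x := by
  subst hy; exact hg.comp hf

theorem SmoothNear.prodMk {g : E → G} {f : E → F} {x : E} (hf : SmoothNear f x)
    (hg : SmoothNear g x) : SmoothNear (fun y => (f y, g y)) x := by
  filter_upwards [hf, hg] with y h1 h2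
  exact h1.prodMk h2

theorem SmoothNear.congr {g f : E → F} {x : E} (hf : SmoothNear f x)
    (hg : g =ᶠ[𝓝 x] f) : SmoothNear g x := by
  filter_upwards [hf, eventually_eventually_nhds.2 hg] with y h1 h2
  exact h1.congr_of_eventuallyEq h2

theorem SmoothNear.add {g f : E → F} {x : E} (hf : SmoothNear f x)
    (hg : SmoothNear g x) : SmoothNear (fun y => f y + g y) x := by
  filter_upwards [hf, hg] with y h1 h2
  exact h1.add h2

theorem SmoothNear.sub {g f : E → F} {x : E} (hf : SmoothNear f x)
    (hg : SmoothNear g x) : SmoothNear (fun y => f y - g y) x := by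
  filter_upwards [hf, hg] with y h1 h2
  exact h1.sub h2

theorem SmoothNear.neg {f : E → F} {x : E} (hf : SmoothNear f x) :
    SmoothNear (fun y => - f y) x := by
  filter_upwards [hf] with y h1
  exact h1.neg

theorem SmoothNear.smul {g : E → F} {f : E → ℝ} {x : E} (hf : SmoothNear f x)
    (hg : SmoothNear g x) : SmoothNear (fun y => f y • g y) x := by
  filter_upwards [hf, hg] with y h1 h2
  exact h1.smul h2

theorem SmoothNear.mul {A : Type*} [NormedRing A] [NormedAlgebra ℝ A] {g f : E → A} {x : E}
    (hf : SmoothNear f x) (hg : SmoothNear g x) : SmoothNear (fun y => f y * g y) x := by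
  filter_upwards [hf, hg] with y h1 h2
  exact h1.mul h2

theorem SmoothNear.pow {A : Type*} [NormedRing A] [NormedAlgebra ℝ A] {f : E → A} {x : E}
    (hf : SmoothNear f x) (n : ℕ) : SmoothNear (fun y => f y ^ n) x := by
  filter_upwards [hf] with y h1
  exact h1.pow n

theorem SmoothNear.const (c : F) (x : E) : SmoothNear (fun _ : E => c) x :=
  contDiff_const.smoothNear x

theorem SmoothNear.clm (L : F →L[ℝ] G) {f : E → F} {x : E} (hf : SmoothNear f x) :
    SmoothNear (fun y => L (f y)) x :=
  (L.contDiff.smoothNear _).comp hf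

theorem SmoothNear.fst {f : E → F × G} {x : E} (hf : SmoothNear f x) :
    SmoothNear (fun y => (f y).1) x := hf.clm (ContinuousLinearMap.fst ℝ F G)

theorem SmoothNear.snd {f : E → F × G} {x : E} (hf : SmoothNear f x) :
    SmoothNear (fun y => (f y).2) x := hf.clm (ContinuousLinearMap.snd ℝ F G)

theorem SmoothNear.id (x : E) : SmoothNear (fun y : E => y) x := contDiff_id.smoothNear x

theorem SmoothNear.fderiv {f : E → F} {x : E} (hf : SmoothNear f x) :
    SmoothNear (fun y => fderiv ℝ f y) x := by
  filter_upwards [hf] with y h1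
  exact h1.fderiv_right (m := ∞) (by simp)

end smoothnear

/-- Implicit function theorem. -/
theorem ift_smooth {P Y Z : Type*} [NormedAddCommGroup P] [NormedSpace ℝ P] [CompleteSpace P]
    [NormedAddCommGroup Y] [NormedSpace ℝ Y] [CompleteSpace Y]
    [NormedAddCommGroup Z] [NormedSpace ℝ Z]
    (F : P × Y → Z) (p0 : P) (y0 : Y) (hF : SmoothNear F (p0, y0)) (h0 : F (p0, y0) = 0)
    (D : Y ≃L[ℝ] Z) (hD : HasFDerivAt (fun y => F (p0, y)) (D : Y →L[ℝ] Z) y0) :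
    ∃ φ : P → Y, φ p0 = y0 ∧ SmoothNear φ p0 ∧ (∀ᶠ p in 𝓝 p0, F (p, φ p) = 0) ∧
      (∀ᶠ z in 𝓝 (p0, y0), F z = 0 → z.2 = φ z.1) := by
  set H : P × Y → P × Z := fun z => (z.1, F z) with hH
  set F' := fderiv ℝ F (p0, y0) with hF'
  have hFd : HasFDerivAt F F' (p0, y0) := hF.diff.hasFDerivAt
  have hinr : ∀ y, F' (0, y) = D y := by
    have h2 : HasFDerivAt (fun y : Y => (p0, y)) (ContinuousLinearMap.inr ℝ P Y) y0 := by
      exact hasFDerivAt_prodMk_right p0 y0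
    have h1 := HasFDerivAt.comp y0 hFd h2
    have := h1.unique hD
    intro y
    have h3 := congrArg (fun L : Y →L[ℝ] Z => L y) this
    simpa using h3
  let e' : (P × Y) ≃L[ℝ] (P × Z) :=
    ContinuousLinearEquiv.skewProd (ContinuousLinearEquiv.refl ℝ P) D
      (F'.comp (ContinuousLinearMap.inl ℝ P Y))
  have hHs : SmoothNear H (p0, y0) := (SmoothNear.id _).fst.prodMk hF
  have hHd : HasFDerivAt H (e' : P × Y →L[ℝ] P × Z) (p0, y0) := by
    have : HasFDerivAt H ((ContinuousLinearMap.fst ℝ P Y).prod F') (p0, y0) :=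
      hasFDerivAt_fst.prodMk hFd
    convert this using 1
    apply ContinuousLinearMap.ext
    · rintro ⟨p, y⟩
      have : F' (p, y) = F' (p, 0) + F' (0, y) := by rw [← map_add]; simp
      simp [e', hinr, this, add_comm]
  let e := hHs.self.toOpenPartialHomeomorph H hHd (by simp)
  have hsrc : (p0, y0) ∈ e.source := hHs.self.mem_toOpenPartialHomeomorph_source hHd (by simp)
  have hecoe : (e : P × Y → P × Z) = H := rfl
  have hH0 : H (p0, y0) = (p0, 0) := by simp [hH, h0]
  have hsymm0 : e.symm (p0, 0) = (p0, y0) := by rw [← hH0, ← hecoe]; exact e.left_inv hsrc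
  have htgt : (p0, (0 : Z)) ∈ e.target := by rw [← hH0, ← hecoe]; exact e.map_source hsrc
  have hinv : ∀ᶠ z in 𝓝 (p0, y0), fderiv ℝ H z ∈
      Set.range ((↑) : ((P × Y) ≃L[ℝ] (P × Z)) → (P × Y →L[ℝ] P × Z)) := by
    have hc : ContinuousAt (fun z => fderiv ℝ H z) (p0, y0) := hHs.fderiv.cont
    apply hc
    show _ ∈ 𝓝 (fderiv ℝ H (p0, y0))
    rw [hHd.fderiv]
    exact e'.nhds
  have hsm : SmoothNear e.symm (p0, 0) := by
    have hc : ContinuousAt e.symm (p0, 0) := e.continuousAt_symm htgt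
    have hc' : Tendsto e.symm (𝓝 (p0, 0)) (𝓝 (p0, y0)) := by
      have := hc.tendsto; rwa [hsymm0] at this
    filter_upwards [e.open_target.mem_nhds htgt, hc'.eventually hHs, hc'.eventually hinv]
      with a h1 h2 h3
    obtain ⟨e2, he2⟩ := h3
    refine e.contDiffAt_symm h1 (f₀' := e2) ?_ h2
    rw [he2]
    exact (h2.differentiableAt (by simp)).hasFDerivAt
  have hι : SmoothNear (fun p : P => (p, (0 : Z))) p0 :=
    (SmoothNear.id _).prodMk (SmoothNear.const _ _)
  refine ⟨fun p => (e.symm (p, 0)).2, by simp [hsymm0], (hsm.comp' hι rfl).snd, ?_, ?_⟩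
  · have : ∀ᶠ p in 𝓝 p0, (p, (0 : Z)) ∈ e.target := hι.cont (e.open_target.mem_nhds htgt)
    filter_upwards [this] with p hp
    have h1 : H (e.symm (p, 0)) = (p, 0) := e.right_inv hp
    have h2 : (e.symm (p, 0)).1 = p := congrArg Prod.fst h1
    have h3 : F (e.symm (p, 0)) = 0 := congrArg Prod.snd h1
    have h4 : (p, (e.symm (p, 0)).2) = e.symm (p, 0) := Prod.ext h2.symm rfl
    simp only [h4, h3]
  · filter_upwards [e.open_source.mem_nhds hsrc] with z hz hz0
    have h1 : e.symm (H z) = z := e.left_inv hz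
    have h2 : H z = (z.1, 0) := by simp [hH, hz0]
    rw [h2] at h1
    simp [h1]

/-- Hadamard lemma with parameters. -/
theorem hadamard_smooth {P : Type*} [NormedAddCommGroup P] [NormedSpace ℝ P]
    (F : P × ℝ → ℝ) (p0 : P) (hF : SmoothNear F (p0, 0)) :
    ∃ H : P × ℝ → ℝ, SmoothNear H (p0, 0) ∧
      (∀ᶠ z in 𝓝 (p0, (0:ℝ)), F z = F (z.1, 0) + z.2 * H z) ∧
      (∀ᶠ p in 𝓝 p0, HasDerivAt (fun s => F (p, s)) (H (p, 0)) 0) := by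
  obtain ⟨δ, hδ, hball⟩ := Metric.eventually_nhds_iff_ball.1 hF
  set K : P × ℝ → ℝ := fun z => fderiv ℝ F z (0, 1) with hK
  have hKs : ∀ z ∈ Metric.ball (p0, (0:ℝ)) δ, ContDiffAt ℝ ∞ K z := fun z hz =>
    ((hball z hz).fderiv_right (m := ∞) (by simp)).clm_apply contDiffAt_const
  have hFd : ∀ p s, (p, s) ∈ Metric.ball (p0, (0:ℝ)) δ →
      HasDerivAt (fun s => F (p, s)) (K (p, s)) s := by
    intro p s hz
    have h1 := ((hball _ hz).differentiableAt (by simp)).hasFDerivAt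
    have h2 : HasDerivAt (fun s : ℝ => (p, s)) (0, 1) s :=
      (hasDerivAt_const s p).prodMk (hasDerivAt_id s)
    exact h1.comp_hasDerivAt s h2
  have hmem : ∀ z ∈ Metric.ball (p0, (0:ℝ)) δ, ∀ r : ℝ, |r| ≤ 1 →
      (z.1, z.2 * r) ∈ Metric.ball (p0, (0:ℝ)) δ := by
    intro z hz r hr
    rw [Metric.mem_ball, Prod.dist_eq, max_lt_iff] at hz ⊢
    refine ⟨hz.1, ?_⟩
    have := hz.2
    simp only [dist_zero_right, norm_mul, Real.norm_eq_abs] at this ⊢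
    nlinarith [abs_nonneg z.2, abs_nonneg r]
  let χ : ContDiffBump (0:ℝ) := ⟨2, 3, by norm_num, by norm_num⟩
  let g : P × ℝ → ℝ → ℝ := fun z y => χ y * (Real.cos y * K (z.1, z.2 * (- Real.sin y)))
  let f : ℝ → ℝ := Set.indicator (Set.Ioc 0 (π/2)) (fun _ => (1:ℝ))
  have hf : LocallyIntegrable f volume :=
    (IntegrableOn.integrable_indicator (by simp) measurableSet_Ioc).locallyIntegrable
  have hconv := contDiffOn_convolution_right_with_param_comp (n := ⊤) (μ := volume)
    (ContinuousLinearMap.mul ℝ ℝ)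
    (s := Metric.ball (p0, (0:ℝ)) δ) (v := fun _ => (0:ℝ)) contDiffOn_const (f := f) (g := g)
    (k := Metric.closedBall 0 3) Metric.isOpen_ball (isCompact_closedBall _ _) ?_ hf ?_
  rotate_left
  · intro z y _ hy
    have : χ y = 0 := χ.zero_of_le_dist (by
      simp only [Metric.mem_closedBall, not_le] at hy; exact hy.le)
    simp [g, this]
  · rintro ⟨z, y⟩ ⟨hz, -⟩
    apply ContDiffAt.contDiffWithinAt
    have h1 : ContDiffAt ℝ ∞ (fun q : (P × ℝ) × ℝ => K (q.1.1, q.1.2 * (- Real.sin q.2))) (z, y) := by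
      have := hKs _ (hmem z hz (- Real.sin y) (by rw [abs_neg]; exact Real.abs_sin_le_one y))
      refine ContDiffAt.comp (z, y) (f := fun q : (P × ℝ) × ℝ => (q.1.1, q.1.2 * (- Real.sin q.2)))
        this ?_
      fun_prop
    have h2 : ContDiffAt ℝ ∞ (fun q : (P × ℝ) × ℝ => χ q.2) (z, y) :=
      χ.contDiff.contDiffAt.comp (z, y) contDiffAt_snd
    have h3 : ContDiffAt ℝ ∞ (fun q : (P × ℝ) × ℝ => Real.cos q.2) (z, y) := by fun_prop
    exact h2.mul (h3.mul h1)
  set H : P × ℝ → ℝ := fun z => ∫ y in (0:ℝ)..(π/2), Real.cos y * K (z.1, z.2 * Real.sin y) with hHdef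
  have hHeq : ∀ z, (MeasureTheory.convolution f (g z) (ContinuousLinearMap.mul ℝ ℝ) volume) 0 = H z := by
    intro z
    rw [hHdef, convolution_def]
    simp only
    rw [intervalIntegral.integral_of_le (by positivity), ← integral_indicator measurableSet_Ioc]
    congr 1
    ext y
    by_cases hy : y ∈ Set.Ioc 0 (π/2)
    · have hχ : χ (0 - y) = 1 := χ.one_of_mem_closedBall (by
        simp only [Metric.mem_closedBall, zero_sub, dist_zero_right, norm_neg, Real.norm_eq_abs, χ]
        rw [abs_of_pos hy.1]; linarith [hy.2, Real.pi_le_four])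
      simp only [Set.indicator_of_mem hy, f, g, hχ]
      simp
    · simp [Set.indicator_of_notMem hy, f]
  have hHs : ContDiffOn ℝ ∞ H (Metric.ball (p0, (0:ℝ)) δ) := by
    refine hconv.congr fun z _ => ?_
    exact (hHeq z).symm
  have hbn : Metric.ball (p0, (0:ℝ)) δ ∈ 𝓝 (p0, (0:ℝ)) := Metric.ball_mem_nhds _ hδ
  refine ⟨H, ?_, ?_, ?_⟩
  · filter_upwards [Metric.isOpen_ball.mem_nhds (Metric.mem_ball_self hδ)] with z hz
    exact hHs.contDiffAt (Metric.isOpen_ball.mem_nhds hz)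
  · filter_upwards [hbn] with z hz
    have hintg : ∫ y in (0:ℝ)..(π/2), z.2 * (Real.cos y * K (z.1, z.2 * Real.sin y)) =
        F (z.1, z.2 * Real.sin (π/2)) - F (z.1, z.2 * Real.sin 0) := by
      apply intervalIntegral.integral_eq_sub_of_hasDerivAt (f := fun y => F (z.1, z.2 * Real.sin y))
      · intro y _
        have h1 := hFd z.1 (z.2 * Real.sin y) (hmem z hz _ (Real.abs_sin_le_one y))
        have h2 : HasDerivAt (fun y => z.2 * Real.sin y) (z.2 * Real.cos y) y :=
          (Real.hasDerivAt_sin y).const_mul _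
        convert! HasDerivAt.comp y h1 h2 using 1
        ring
      · apply Continuous.intervalIntegrable
        have : Continuous fun y => K (z.1, z.2 * Real.sin y) := by
          rw [continuous_iff_continuousAt]
          intro y
          have h1 := (hKs _ (hmem z hz _ (Real.abs_sin_le_one y))).continuousAt
          exact ContinuousAt.comp (f := fun y => (z.1, z.2 * Real.sin y)) h1 (by fun_prop)
        exact continuous_const.mul (Real.continuous_cos.mul this)
    rw [intervalIntegral.integral_const_mul] at hintg
    simp only [Real.sin_pi_div_two, mul_one, Real.sin_zero, mul_zero] at hintg
    rw [hHdef]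
    simp only
    linarith
  · have : ∀ᶠ p in 𝓝 p0, (p, (0:ℝ)) ∈ Metric.ball (p0, (0:ℝ)) δ := by
      have hc : ContinuousAt (fun p : P => (p, (0:ℝ))) p0 := by fun_prop
      exact hc hbn
    filter_upwards [this] with p hp
    have : H (p, 0) = K (p, 0) := by
      simp [hHdef, intervalIntegral.integral_mul_const]
    rw [this]
    exact hFd p 0 hp



section nem
variable {E : Type} [NormedAddCommGroup E] [NormedSpace ℝ E]

/-- all derivatives of `φ` are bounded along `x0` plus bounded sets -/
def NemGood (x0 : ℝ → E) {F : Type} [NormedAddCommGroup F] [NormedSpace ℝ F] (φ : E → F) : Prop :=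
  ∀ (k : ℕ) (R : ℝ), ∃ C : ℝ, ∀ (t : ℝ) (y : E), ‖y‖ ≤ R → ‖iteratedFDeriv ℝ k φ (x0 t + y)‖ ≤ C

theorem NemGood.fderiv {x0 : ℝ → E} {F : Type} [NormedAddCommGroup F] [NormedSpace ℝ F] {φ : E → F}
    (h : NemGood x0 φ) : NemGood x0 (fderiv ℝ φ) := by
  intro k R
  obtain ⟨C, hC⟩ := h (k+1) R
  refine ⟨C, fun t y hy => ?_⟩
  rw [norm_iteratedFDeriv_fderiv]
  exact hC t y hy

theorem nem_exists (x0 : ℝ → E) (hx0 : Continuous x0) {F : Type} [NormedAddCommGroup F]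
    [NormedSpace ℝ F] (φ : E → F) (hφ : Continuous φ) (hg : NemGood x0 φ) :
    ∃ N : (ℝ →ᵇ E) → (ℝ →ᵇ F), ∀ v t, N v t = φ (x0 t + v t) := by
  have : ∀ v : ℝ →ᵇ E, ∃ w : ℝ →ᵇ F, ∀ t, w t = φ (x0 t + v t) := by
    intro v
    obtain ⟨C, hC⟩ := hg 0 ‖v‖
    refine ⟨BoundedContinuousFunction.ofNormedAddCommGroup (fun t => φ (x0 t + v t))
      (hφ.comp (hx0.add v.continuous)) C (fun t => ?_), fun t => rfl⟩
    have := hC t (v t) (v.norm_coe_le_norm t)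
    rwa [norm_iteratedFDeriv_zero] at this
  choose N hN using this
  exact ⟨N, hN⟩

theorem bcfApply_bound {E F : Type} [NormedAddCommGroup E] [NormedSpace ℝ E]
    [NormedAddCommGroup F] [NormedSpace ℝ F] (a : ℝ →ᵇ (E →L[ℝ] F)) (k : ℝ →ᵇ E) (t : ℝ) :
    ‖a t (k t)‖ ≤ ‖a‖ * ‖k‖ :=
  ((a t).le_opNorm _).trans (mul_le_mul (a.norm_coe_le_norm t)
          (k.norm_coe_le_norm t) (norm_nonneg _) (norm_nonneg a))

/-- pointwise application -/
noncomputable def bcfApply (E F : Type) [NormedAddCommGroup E] [NormedSpace ℝ E]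
    [NormedAddCommGroup F] [NormedSpace ℝ F] :
    (ℝ →ᵇ (E →L[ℝ] F)) →L[ℝ] (ℝ →ᵇ E) →L[ℝ] (ℝ →ᵇ F) :=
  LinearMap.mkContinuous₂
    (LinearMap.mk₂ ℝ (fun (a : ℝ →ᵇ (E →L[ℝ] F)) (k : ℝ →ᵇ E) =>
      BoundedContinuousFunction.ofNormedAddCommGroup (fun t => a t (k t))
        (a.continuous.clm_apply k.continuous) (‖a‖ * ‖k‖)
        (bcfApply_bound a k))
      (by intros; ext t; simp) (by intros; ext t; simp) (by intros; ext t; simp)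
      (by intros; ext t; simp)) 1 (by
      intro a k
      rw [one_mul]
      exact (BoundedContinuousFunction.norm_le (by positivity)).2 (bcfApply_bound a k))

@[simp] theorem bcfApply_apply {F : Type} [NormedAddCommGroup F] [NormedSpace ℝ F]
    (a : ℝ →ᵇ (E →L[ℝ] F)) (k : ℝ →ᵇ E) (t : ℝ) : bcfApply E F a k t = a t (k t) := rfl

theorem nem_hasFDerivAt (x0 : ℝ → E) {F : Type} [NormedAddCommGroup F]
    [NormedSpace ℝ F] (φ : E → F) (hφ : ContDiff ℝ ∞ φ) (hg : NemGood x0 φ)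
    (N : (ℝ →ᵇ E) → (ℝ →ᵇ F)) (hN : ∀ v t, N v t = φ (x0 t + v t))
    (N1 : (ℝ →ᵇ E) → (ℝ →ᵇ (E →L[ℝ] F))) (hN1 : ∀ v t, N1 v t = fderiv ℝ φ (x0 t + v t))
    (v : ℝ →ᵇ E) : HasFDerivAt N (bcfApply E F (N1 v)) v := by
  obtain ⟨C, hC⟩ := hg.fderiv 1 (‖v‖ + 1)
  have hC0 : 0 ≤ C := (norm_nonneg _).trans (hC 0 0 (by simpa using by positivity))
  have hφ' : ContDiff ℝ ∞ (fderiv ℝ φ) := hφ.fderiv_right (by simp)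
  have key : ∀ k : ℝ →ᵇ E, ‖k‖ ≤ 1 →
      ‖N (v + k) - N v - bcfApply E F (N1 v) k‖ ≤ C * ‖k‖ * ‖k‖ := by
    intro k hk
    refine (BoundedContinuousFunction.norm_le (by positivity)).2 fun t => ?_
    simp only [BoundedContinuousFunction.coe_sub, Pi.sub_apply, hN, bcfApply_apply, hN1,
      BoundedContinuousFunction.coe_add, Pi.add_apply]
    have hvt := v.norm_coe_le_norm t
    have hkt := k.norm_coe_le_norm t
    set a := x0 t + v t
    have h2 : ∀ x ∈ Metric.closedBall a ‖k t‖, ‖fderiv ℝ (fderiv ℝ φ) x‖ ≤ C := by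
      intro x hx
      have := hC t (x - x0 t) (by
        have h3 : x - x0 t = (x - a) + v t := by simp [a]; abel
        rw [h3]
        have h4 : ‖x - a‖ ≤ ‖k t‖ := by simpa [dist_eq_norm] using hx
        linarith [norm_add_le (x - a) (v t)])
      rw [show x0 t + (x - x0 t) = x by abel] at this
      rwa [← norm_iteratedFDeriv_zero (𝕜 := ℝ) (f := fderiv ℝ (fderiv ℝ φ)),
        norm_iteratedFDeriv_fderiv]
    have hconv := convex_closedBall a ‖k t‖
    have hamem : a ∈ Metric.closedBall a ‖k t‖ := Metric.mem_closedBall_self (norm_nonneg _)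
    have hbmem : a + k t ∈ Metric.closedBall a ‖k t‖ := by simp
    have h3 : ∀ x ∈ Metric.closedBall a ‖k t‖, ‖fderiv ℝ φ x - fderiv ℝ φ a‖ ≤ C * ‖k t‖ := by
      intro x hx
      have := hconv.norm_image_sub_le_of_norm_fderiv_le (𝕜 := ℝ) (f := fderiv ℝ φ)
        (fun x _ => (hφ'.differentiable (by simp)) x) h2 hamem hx
      refine this.trans (mul_le_mul_of_nonneg_left ?_ hC0)
      simpa [dist_eq_norm] using hx
    have h5 := hconv.norm_image_sub_le_of_norm_fderiv_le' (𝕜 := ℝ) (f := φ) (φ := fderiv ℝ φ a)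
        (fun x _ => (hφ.differentiable (by simp)) x) h3 hamem hbmem
    rw [add_sub_cancel_left, ← add_assoc] at *
    refine h5.trans ?_
    have := norm_nonneg (k t)
    gcongr
  rw [hasFDerivAt_iff_isLittleO_nhds_zero, Asymptotics.isLittleO_iff]
  intro c hc
  have : ∀ᶠ k : ℝ →ᵇ E in 𝓝 0, ‖k‖ < min 1 (c / (C + 1)) := by
    have := Metric.ball_mem_nhds (0 : ℝ →ᵇ E) (ε := min 1 (c / (C+1))) (by positivity)
    filter_upwards [this] with k hk
    simpa using hk
  filter_upwards [this] with k hk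
  refine (key k (hk.le.trans (min_le_left _ _))).trans ?_
  have h1 : ‖k‖ ≤ c / (C+1) := hk.le.trans (min_le_right _ _)
  refine mul_le_mul_of_nonneg_right ?_ (norm_nonneg _)
  calc C * ‖k‖ ≤ (C+1) * (c / (C+1)) := by gcongr; linarith
    _ = c := by field_simp

theorem nem_contDiff_nat (x0 : ℝ → E) (hx0 : Continuous x0) (n : ℕ) :
    ∀ {F : Type} [NormedAddCommGroup F]
    [NormedSpace ℝ F] (φ : E → F) (_ : ContDiff ℝ ∞ φ) (_ : NemGood x0 φ)
    (N : (ℝ →ᵇ E) → (ℝ →ᵇ F)) (_ : ∀ v t, N v t = φ (x0 t + v t)), ContDiff ℝ n N := by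
  induction n with
  | zero =>
    intro F _ _ φ hφ hg N hN
    obtain ⟨N1, hN1⟩ := nem_exists x0 hx0 (fderiv ℝ φ) (hφ.continuous_fderiv (by simp)) hg.fderiv
    refine contDiff_zero.2 (continuous_iff_continuousAt.2 fun v => ?_)
    exact (nem_hasFDerivAt x0 φ hφ hg N hN N1 hN1 v).continuousAt
  | succ n ih =>
    intro F _ _ φ hφ hg N hN
    obtain ⟨N1, hN1⟩ := nem_exists x0 hx0 (fderiv ℝ φ) (hφ.continuous_fderiv (by simp)) hg.fderiv
    have h := ih (fderiv ℝ φ) (hφ.fderiv_right (by simp)) hg.fderiv N1 hN1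
    push_cast
    rw [contDiff_succ_iff_hasFDerivAt]
    have hcl : ContDiff ℝ n (bcfApply E F) := 
      ContinuousLinearMap.contDiff (𝕜 := ℝ) (E := ℝ →ᵇ (E →L[ℝ] F))
        (F := (ℝ →ᵇ E) →L[ℝ] (ℝ →ᵇ F)) (bcfApply E F)
    exact ⟨fun v => bcfApply E F (N1 v), hcl.comp h,
      nem_hasFDerivAt x0 φ hφ hg N hN N1 hN1⟩

theorem nem_contDiff (x0 : ℝ → E) (hx0 : Continuous x0) {F : Type} [NormedAddCommGroup F]
    [NormedSpace ℝ F] (φ : E → F) (hφ : ContDiff ℝ ∞ φ) (hg : NemGood x0 φ)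
    (N : (ℝ →ᵇ E) → (ℝ →ᵇ F)) (hN : ∀ v t, N v t = φ (x0 t + v t)) : ContDiff ℝ ∞ N :=
  contDiff_infty.2 fun n => nem_contDiff_nat x0 hx0 n φ hφ hg N hN

end nem

theorem nemGood_zero (φ : ℝ → ℝ) (hφ : ContDiff ℝ ∞ φ) : NemGood (fun _ : ℝ => (0:ℝ)) φ := by
  intro k R
  have hc : ContinuousOn (fun y => ‖iteratedFDeriv ℝ k φ y‖) (Metric.closedBall 0 R) :=
    ((hφ.continuous_iteratedFDeriv (m := k) (by exact_mod_cast le_top)).norm).continuousOn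
  obtain ⟨C, hC⟩ := (isCompact_closedBall (0:ℝ) R).bddAbove_image hc
  refine ⟨C, fun t y hy => ?_⟩
  rw [zero_add]
  exact hC ⟨y, by simpa using hy, rfl⟩

/-- composition with a smooth function, on bounded continuous functions -/
theorem nem_real (φ : ℝ → ℝ) (hφ : ContDiff ℝ ∞ φ) :
    ∃ N : (ℝ →ᵇ ℝ) → (ℝ →ᵇ ℝ), ContDiff ℝ ∞ N ∧ ∀ v t, N v t = φ (v t) := by
  obtain ⟨N, hN⟩ := nem_exists (fun _ : ℝ => (0:ℝ)) continuous_const φ hφ.continuous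
    (nemGood_zero φ hφ)
  exact ⟨N, nem_contDiff _ continuous_const φ hφ (nemGood_zero φ hφ) N hN, by simpa using hN⟩

theorem periodic_bdd {n : ℕ} {F : Type} [NormedAddCommGroup F] (g : (Fin n → ℝ) → F)
    (hg : Continuous g)
    (hper : ∀ (k : Fin n → ℤ) (x : Fin n → ℝ), g (x + fun i => 2 * Real.pi * (k i : ℝ)) = g x) :
    ∃ C, ∀ x, ‖g x‖ ≤ C := by
  obtain ⟨C, hC⟩ := (isCompact_closedBall (0 : Fin n → ℝ) (2 * π)).bddAbove_image
    hg.norm.continuousOn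
  refine ⟨C, fun x => ?_⟩
  rw [← hper (fun i => - ⌊x i / (2 * π)⌋) x]
  refine hC ⟨_, ?_, rfl⟩
  rw [mem_closedBall_zero_iff, pi_norm_le_iff_of_nonneg (by positivity)]
  intro i
  have hp : 0 < 2 * π := by positivity
  have h1 := Int.floor_le (x i / (2 * π))
  have h2 := Int.lt_floor_add_one (x i / (2 * π))
  rw [le_div_iff₀ hp] at h1
  rw [div_lt_iff₀ hp] at h2
  simp only [Pi.add_apply, Int.cast_neg, Real.norm_eq_abs, abs_le]
  constructor <;> nlinarith

/-- `A ↦ f(om · + A)` is a smooth map into bounded continuous functions. -/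
theorem forcing_exists {n : ℕ} (om : Fin n → ℝ) (f : (Fin n → ℝ) → ℝ) (hf : ContDiff ℝ ∞ f)
    (hper : ∀ (k : Fin n → ℤ) (x : Fin n → ℝ),
      f (x + fun i => 2 * Real.pi * (k i : ℝ)) = f x) :
    ∃ (fA : (Fin n → ℝ) → (ℝ →ᵇ ℝ)) (C : ℝ), 0 ≤ C ∧ ContDiff ℝ ∞ fA ∧
      (∀ A t, fA A t = f (fun i => om i * t + A i)) ∧ (∀ A, ‖fA A‖ ≤ C) ∧
      (∀ A, ‖fderiv ℝ fA A‖ ≤ C) := by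
  have hx0 : Continuous (fun t : ℝ => (fun i => om i * t : Fin n → ℝ)) := by fun_prop
  have hbd : ∀ k : ℕ, ∃ C, ∀ x, ‖iteratedFDeriv ℝ k f x‖ ≤ C := by
    intro k
    refine periodic_bdd _ (hf.continuous_iteratedFDeriv (m := k) (by exact_mod_cast le_top)) ?_
    intro m x
    have : (fun x => f (x + fun i => 2 * Real.pi * (m i : ℝ))) = f := by
      ext x; exact hper m x
    rw [← iteratedFDeriv_comp_add_right, this]
  have hgood : NemGood (fun t : ℝ => (fun i => om i * t : Fin n → ℝ)) f := by
    intro k R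
    obtain ⟨C, hC⟩ := hbd k
    exact ⟨C, fun t y _ => hC _⟩
  obtain ⟨N, hN⟩ := nem_exists _ hx0 f hf.continuous hgood
  have hNs := nem_contDiff _ hx0 f hf hgood N hN
  obtain ⟨C0, hC0⟩ := hbd 0
  obtain ⟨C1, hC1⟩ := hbd 1
  have hC0' : 0 ≤ C0 := (norm_nonneg _).trans (hC0 0)
  have hC1' : 0 ≤ C1 := (norm_nonneg _).trans (hC1 0)
  let cst : (Fin n → ℝ) →L[ℝ] (ℝ →ᵇ (Fin n → ℝ)) :=
    LinearMap.mkContinuous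
      { toFun := fun A => BoundedContinuousFunction.const ℝ A
        map_add' := by intros; ext; simp
        map_smul' := by intros; ext; simp } 1 (by
        intro A
        simp only [LinearMap.coe_mk, AddHom.coe_mk, one_mul]
        exact BoundedContinuousFunction.norm_const_le A)
  have hfA : ∀ A t, N (cst A) t = f (fun i => om i * t + A i) := by
    intro A t
    rw [hN]
    rfl
  refine ⟨fun A => N (cst A), C0 + C1, by positivity, hNs.comp cst.contDiff, hfA, ?_, ?_⟩
  · intro A
    refine (BoundedContinuousFunction.norm_le (by positivity)).2 fun t => ?_
    rw [hfA]
    have := hC0 (fun i => om i * t + A i)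
    rw [norm_iteratedFDeriv_zero] at this
    linarith
  · intro A
    have hlip : LipschitzWith (NNReal.mk C1 hC1') f := by
      refine lipschitzWith_of_nnnorm_fderiv_le (𝕜 := ℝ) (hf.differentiable (by simp)) fun x => ?_
      have := hC1 x
      rw [← NNReal.coe_le_coe]
      rw [← zero_add 1, ← norm_iteratedFDeriv_fderiv, norm_iteratedFDeriv_zero] at this
      exact this
    have : LipschitzWith (NNReal.mk C1 hC1') (fun A => N (cst A)) := by
      refine LipschitzWith.of_dist_le_mul fun A B => ?_
      refine (BoundedContinuousFunction.dist_le (by positivity)).2 fun t => ?_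
      rw [hfA, hfA]
      refine (hlip.dist_le_mul _ _).trans (le_of_eq ?_)
      congr 1
      rw [dist_eq_norm, dist_eq_norm]
      congr 1
      ext i; simp
    have h2 := norm_fderiv_le_of_lipschitz ℝ this (x₀ := A)
    refine h2.trans ?_
    show C1 ≤ C0 + C1
    linarith



/-- hyperbolic secant -/
noncomputable def sch (t : ℝ) : ℝ := (Real.cosh t)⁻¹

theorem sch_pos (t : ℝ) : 0 < sch t := inv_pos.2 (Real.cosh_pos t)
theorem sch_le_one (t : ℝ) : sch t ≤ 1 := inv_le_one_of_one_le₀ (Real.one_le_cosh t)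
theorem sch_mul_cosh (t : ℝ) : sch t * Real.cosh t = 1 := inv_mul_cancel₀ (Real.cosh_pos t).ne'
theorem sch_neg (t : ℝ) : sch (-t) = sch t := by simp [sch]
theorem sch_zero : sch 0 = 1 := by simp [sch]
theorem sch_contDiff : ContDiff ℝ ∞ sch := Real.contDiff_cosh.inv fun t => (Real.cosh_pos t).ne'
theorem sch_continuous : Continuous sch := sch_contDiff.continuous
theorem sch_hasDerivAt (t : ℝ) : HasDerivAt sch (-(tanh t * sch t)) t := by
  have := (Real.hasDerivAt_cosh t).inv (Real.cosh_pos t).ne'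
  refine HasDerivAt.congr_deriv (f := sch) this ?_
  rw [Real.tanh_eq_sinh_div_cosh, sch]
  field_simp
theorem tanh_hasDerivAt (t : ℝ) : HasDerivAt Real.tanh (sch t ^ 2) t := by
  have := (Real.hasDerivAt_sinh t).div (Real.hasDerivAt_cosh t) (Real.cosh_pos t).ne'
  have h2 : (fun x => sinh x / cosh x) = Real.tanh := by
    ext x; rw [Real.tanh_eq_sinh_div_cosh]
  change HasDerivAt (fun x => sinh x / cosh x) _ _ at this
  rw [h2] at this
  refine this.congr_deriv ?_
  have := Real.cosh_sq_sub_sinh_sq t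
  rw [sch]
  field_simp
  linarith
theorem tanh_continuous : Continuous Real.tanh :=
  continuous_iff_continuousAt.2 fun t => (tanh_hasDerivAt t).continuousAt
theorem tanh_sq_eq (t : ℝ) : tanh t ^ 2 = 1 - sch t ^ 2 := by
  have := Real.cosh_sq_sub_sinh_sq t
  have := Real.cosh_pos t
  rw [Real.tanh_eq_sinh_div_cosh, sch]
  field_simp
  linarith
theorem tanh_cosh (t : ℝ) : tanh t * cosh t = sinh t := by
  have := Real.cosh_pos t
  rw [Real.tanh_eq_sinh_div_cosh]; field_simp

theorem cosh_le_exp_abs (t : ℝ) : cosh t ≤ exp |t| := by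
  rw [Real.cosh_eq]
  have h1 : exp t ≤ exp |t| := exp_le_exp.2 (le_abs_self t)
  have h2 : exp (-t) ≤ exp |t| := exp_le_exp.2 (neg_le_abs t)
  linarith
theorem exp_abs_le_cosh (t : ℝ) : exp |t| ≤ 2 * cosh t := by
  rw [Real.cosh_eq]
  rcases abs_cases t with ⟨h, _⟩ | ⟨h, _⟩ <;> rw [h] <;> [have := exp_pos (-t); have := exp_pos t] <;>
    linarith
theorem sch_le (t : ℝ) : sch t ≤ 2 * exp (-|t|) := by
  rw [sch, exp_neg, inv_le_comm₀ (cosh_pos t) (by positivity)]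
  have := exp_abs_le_cosh t
  have h := exp_pos |t|
  rw [mul_inv, inv_inv]
  linarith

/-- the weight -/
noncomputable def wt (t : ℝ) : ℝ := exp (-(|t| / 2))
theorem wt_pos (t : ℝ) : 0 < wt t := exp_pos _
theorem wt_le_one (t : ℝ) : wt t ≤ 1 := by rw [wt, exp_le_one_iff]; have := abs_nonneg t; linarith
theorem wt_continuous : Continuous wt := by unfold wt; fun_prop
theorem wt_sq (t : ℝ) : wt t ^ 2 = exp (-|t|) := by rw [wt, ← exp_nat_mul]; congr 1; push_cast; ring
theorem wt_neg (t : ℝ) : wt (-t) = wt t := by simp [wt]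
theorem sch_le_wt (t : ℝ) : sch t ≤ 2 * wt t := by
  have h1 := sch_le t
  rw [← wt_sq] at h1
  have := wt_le_one t
  have := wt_pos t
  nlinarith

theorem exp_abs_integrable {a : ℝ} (ha : 0 < a) : Integrable (fun t : ℝ => exp (-(a * |t|))) := by
  rw [← integrableOn_univ, ← Set.Iic_union_Ioi (a := (0:ℝ))]
  refine IntegrableOn.union ?_ ?_
  · refine (integrableOn_exp_mul_Iic ha 0).congr_fun (fun t ht => ?_) measurableSet_Iic
    simp only [abs_of_nonpos (Set.mem_Iic.1 ht)]; congr 1; ring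
  · refine (integrableOn_exp_mul_Ioi (neg_lt_zero.2 ha) 0).congr_fun (fun t ht => ?_) measurableSet_Ioi
    simp only [abs_of_pos (Set.mem_Ioi.1 ht)]; congr 1; ring

/-! ### the separatrix -/
theorem q0_hasDerivAt (t : ℝ) : HasDerivAt q0 (2 * sch t) t := by
  have := ((Real.hasDerivAt_arctan (exp t)).comp t (Real.hasDerivAt_exp t)).const_mul 4
  refine HasDerivAt.congr_deriv (f := q0) this ?_
  rw [sch, Real.cosh_eq, exp_neg]
  have := exp_pos t
  field_simp
  ring
theorem q0_continuous : Continuous q0 :=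
  continuous_iff_continuousAt.2 fun t => (q0_hasDerivAt t).continuousAt
theorem sin_hlf (t : ℝ) : sin (2 * arctan (exp t)) = sch t := by
  rw [Real.sin_two_mul, Real.sin_arctan, Real.cos_arctan, sch, Real.cosh_eq, exp_neg]
  have h := exp_pos t
  have h2 : √(1 + exp t ^2) ^ 2 = 1 + exp t ^ 2 := Real.sq_sqrt (by positivity)
  have h3 : 0 < √(1 + exp t ^2) := Real.sqrt_pos.2 (by positivity)
  field_simp
  rw [h2]; ring
theorem cos_hlf (t : ℝ) : cos (2 * arctan (exp t)) = - tanh t := by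
  rw [Real.cos_two_mul, Real.cos_arctan, Real.tanh_eq_sinh_div_cosh, Real.cosh_eq, Real.sinh_eq, exp_neg]
  have h := exp_pos t
  have h2 : √(1 + exp t ^2) ^ 2 = 1 + exp t ^ 2 := Real.sq_sqrt (by positivity)
  have h3 : 0 < √(1 + exp t ^2) := Real.sqrt_pos.2 (by positivity)
  field_simp
  rw [h2]; ring
theorem q0_two (t : ℝ) : q0 t = 2 * (2 * arctan (exp t)) := by rw [q0]; ring
theorem sin_q0 (t : ℝ) : sin (q0 t) = -(2 * (tanh t * sch t)) := by
  rw [q0_two, Real.sin_two_mul, sin_hlf, cos_hlf]; ring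
theorem cos_q0 (t : ℝ) : cos (q0 t) = 1 - 2 * sch t ^ 2 := by
  rw [q0_two, Real.cos_two_mul, cos_hlf]
  have := tanh_sq_eq t
  linarith
theorem q0_zero : q0 0 = π := by rw [q0, exp_zero, arctan_one]; ring
theorem q0_deriv2 (t : ℝ) : HasDerivAt (fun t => 2 * sch t) (sin (q0 t)) t := by
  refine HasDerivAt.congr_deriv ((sch_hasDerivAt t).const_mul 2) ?_
  rw [sin_q0]; ring

theorem psi0_pos (t : ℝ) : 0 < psi0 t := by
  have := cosh_pos t
  rw [psi0]; positivity
theorem psi0_continuous : Continuous psi0 := by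
  unfold psi0
  exact (Real.continuous_cosh.pow 2).div₀ ((continuous_const.add Real.continuous_cosh).pow 3)
    fun t => by have := cosh_pos t; positivity
theorem psi0_le (t : ℝ) : psi0 t ≤ sch t := by
  have := cosh_pos t
  rw [psi0, sch, div_le_iff₀ (by positivity)]
  field_simp
  nlinarith [pow_pos this 2]
theorem psi0_eq (t : ℝ) : psi0 t = sch t * ((1 + sch t)⁻¹) ^ 3 := by
  have := cosh_pos t
  rw [psi0, sch]
  field_simp
  ring



/-- continuous with exponential bound -/
def Dec (a K : ℝ) (N : ℝ → ℝ) : Prop := Continuous N ∧ ∀ t, |N t| ≤ K * exp (-(a * |t|))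

theorem Dec.nonneg {a K : ℝ} {N : ℝ → ℝ} (h : Dec a K N) : 0 ≤ K := by
  have := (abs_nonneg _).trans (h.2 0)
  simpa using this
theorem Dec.refl {a K : ℝ} {N : ℝ → ℝ} (h : Dec a K N) : Dec a K (fun t => N (-t)) :=
  ⟨h.1.comp continuous_neg, fun t => by simpa using h.2 (-t)⟩
theorem Dec.bdd {a K : ℝ} (ha : 0 ≤ a) {N : ℝ → ℝ} (h : Dec a K N) (t : ℝ) : |N t| ≤ K := by
  refine (h.2 t).trans (mul_le_of_le_one_right h.nonneg ?_)
  rw [exp_le_one_iff]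
  have := mul_nonneg ha (abs_nonneg t)
  linarith

theorem sch_integrable : Integrable sch := by
  refine ((exp_abs_integrable one_pos).const_mul 2).mono' sch_continuous.aestronglyMeasurable
    (Eventually.of_forall fun t => ?_)
  rw [Real.norm_eq_abs, abs_of_pos (sch_pos t), one_mul]
  exact sch_le t

theorem mul_sch_integrable {N : ℝ → ℝ} {K : ℝ} (hc : Continuous N) (hb : ∀ t, |N t| ≤ K) :
    Integrable (fun t => N t * sch t) := by
  refine (sch_integrable.const_mul K).mono' (hc.mul sch_continuous).aestronglyMeasurable
    (Eventually.of_forall fun t => ?_)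
  rw [norm_mul, Real.norm_eq_abs, Real.norm_eq_abs, abs_of_pos (sch_pos t)]
  exact mul_le_mul_of_nonneg_right (hb t) (sch_pos t).le

/-- tail integral -/
noncomputable def hI (N : ℝ → ℝ) (t : ℝ) : ℝ := ∫ s in Set.Ioi t, N s * sch s
/-- primitive -/
noncomputable def hJ (N : ℝ → ℝ) (t : ℝ) : ℝ := ∫ s in (0:ℝ)..t, cosh s ^ 2 * hI N s

section half
variable {a K : ℝ} {N : ℝ → ℝ}

theorem hI_hasDerivAt (ha : 0 ≤ a) (h : Dec a K N) (t : ℝ) : HasDerivAt (hI N) (-(N t * sch t)) t := by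
  have hi := mul_sch_integrable h.1 (h.bdd ha)
  have h1 : hI N = fun t => hI N 0 - ∫ s in (0:ℝ)..t, N s * sch s := by
    ext t
    have := intervalIntegral.integral_interval_add_Ioi (a := 0) (b := t) hi.integrableOn hi.integrableOn
    simp only [hI]
    linarith
  rw [h1]
  have := ((h.1.mul sch_continuous).integral_hasStrictDerivAt 0 t).hasDerivAt
  simpa using this.const_sub (hI N 0)

theorem hI_continuous (ha : 0 ≤ a) (h : Dec a K N) : Continuous (hI N) :=
  continuous_iff_continuousAt.2 fun t => (hI_hasDerivAt ha h t).continuousAt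

theorem hJ_hasDerivAt (ha : 0 ≤ a) (h : Dec a K N) (t : ℝ) :
    HasDerivAt (hJ N) (cosh t ^ 2 * hI N t) t :=
  (((Real.continuous_cosh.pow 2).mul (hI_continuous ha h)).integral_hasStrictDerivAt 0 t).hasDerivAt

theorem hJ_continuous (ha : 0 ≤ a) (h : Dec a K N) : Continuous (hJ N) :=
  continuous_iff_continuousAt.2 fun t => (hJ_hasDerivAt ha h t).continuousAt

theorem hJ_zero : hJ N 0 = 0 := by simp [hJ]

theorem hI_bound (ha : 0 ≤ a) (h : Dec a K N) {t : ℝ} (ht : 0 ≤ t) :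
    |hI N t| ≤ 2 * K * exp (-((a + 1) * t)) := by
  have hK := h.nonneg
  have h1 : ∀ s ∈ Set.Ioi t, ‖N s * sch s‖ ≤ 2 * K * exp (-(a * t)) * exp (-s) := by
    intro s hs
    have hs0 : 0 ≤ s := ht.trans (le_of_lt hs)
    rw [norm_mul, Real.norm_eq_abs, Real.norm_eq_abs, abs_of_pos (sch_pos s)]
    have h2 : |N s| ≤ K * exp (-(a * t)) := by
      refine (h.2 s).trans (mul_le_mul_of_nonneg_left (exp_le_exp.2 ?_) hK)
      rw [abs_of_nonneg hs0]
      have := mul_le_mul_of_nonneg_left (le_of_lt hs) ha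
      linarith
    have h3 := sch_le s
    rw [abs_of_nonneg hs0] at h3
    calc |N s| * sch s ≤ (K * exp (-(a * t))) * (2 * exp (-s)) := by
          gcongr
          exact (sch_pos s).le
      _ = _ := by ring
  have hintg : IntegrableOn (fun s => 2 * K * exp (-(a * t)) * exp (-s)) (Set.Ioi t) := by
    have := (integrableOn_exp_mul_Ioi (a := -1) (by norm_num) t).const_mul (2 * K * exp (-(a * t)))
    simp only [neg_one_mul] at this
    exact this
  have h4 := norm_integral_le_of_norm_le hintg ((ae_restrict_mem measurableSet_Ioi).mono h1)
  rw [integral_const_mul, integral_exp_neg_Ioi] at h4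
  rw [hI, ← Real.norm_eq_abs]
  refine h4.trans (le_of_eq ?_)
  rw [mul_assoc, ← exp_add]; congr 2; ring

theorem hp_bound (ha : 0 ≤ a) (h : Dec a K N) {t : ℝ} (ht : 0 ≤ t) :
    |cosh t * hI N t| ≤ 2 * K * exp (-(a * t)) := by
  have hK := h.nonneg
  rw [abs_mul, abs_of_pos (cosh_pos t)]
  have h1 := cosh_le_exp_abs t
  rw [abs_of_nonneg ht] at h1
  calc cosh t * |hI N t| ≤ exp t * (2 * K * exp (-((a + 1) * t))) := by
        gcongr
        exact hI_bound ha h ht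
    _ = 2 * K * (exp t * exp (-((a + 1) * t))) := by ring
    _ = _ := by rw [← exp_add]; congr 2; ring

theorem hJ_bound (ha : 0 ≤ a) (ha2 : a ≤ 1 / 2) (h : Dec a K N) {t : ℝ} (ht : 0 ≤ t) :
    |hJ N t| ≤ 4 * K * exp ((1 - a) * t) := by
  have hK := h.nonneg
  have h1 : ∀ s ∈ Set.Ioc 0 t, ‖cosh s ^ 2 * hI N s‖ ≤ 2 * K * exp ((1 - a) * s) := by
    intro s hs
    have h2 := hp_bound ha h hs.1.le
    have h3 := cosh_le_exp_abs s
    rw [abs_of_pos hs.1] at h3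
    calc ‖cosh s ^ 2 * hI N s‖ = cosh s * |cosh s * hI N s| := by
          rw [Real.norm_eq_abs, pow_two, mul_assoc, abs_mul, abs_of_pos (cosh_pos s)]
      _ ≤ exp s * (2 * K * exp (-(a * s))) := by gcongr
      _ = 2 * K * (exp s * exp (-(a * s))) := by ring
      _ = _ := by rw [← exp_add]; congr 2; ring
  have h5 : ∀ s, HasDerivAt (fun s => 2 * K / (1 - a) * exp ((1 - a) * s)) (2 * K * exp ((1 - a) * s)) s := by
    intro s
    have := (((hasDerivAt_id s).const_mul (1 - a)).exp).const_mul (2 * K / (1 - a))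
    refine this.congr_deriv ?_
    have : 1 - a ≠ 0 := by linarith
    field_simp
    simp
  have hcont : Continuous (fun s => 2 * K * exp ((1 - a) * s)) := by fun_prop
  have h4 := intervalIntegral.norm_integral_le_of_norm_le ht (Eventually.of_forall h1)
    (hcont.intervalIntegrable (μ := volume) 0 t)
  rw [intervalIntegral.integral_eq_sub_of_hasDerivAt (fun s _ => h5 s) (hcont.intervalIntegrable 0 t)] at h4
  rw [hJ, ← Real.norm_eq_abs]
  refine h4.trans ?_
  have h6 : 2 * K / (1 - a) ≤ 4 * K := by
    rw [div_le_iff₀ (by linarith)]; nlinarith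
  have h7 : 0 ≤ 2 * K / (1 - a) := div_nonneg (by linarith) (by linarith)
  have := mul_le_mul_of_nonneg_right h6 (exp_pos ((1 - a) * t)).le
  have h8 := mul_nonneg h7 (exp_pos ((1 - a) * 0)).le
  linarith

theorem hG_bound (ha : 0 ≤ a) (ha2 : a ≤ 1 / 2) (h : Dec a K N) {t : ℝ} (ht : 0 ≤ t) :
    |sch t * hJ N t| ≤ 8 * K * exp (-(a * t)) := by
  have hK := h.nonneg
  have h3 := sch_le t
  rw [abs_of_nonneg ht] at h3
  rw [abs_mul, abs_of_pos (sch_pos t)]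
  calc sch t * |hJ N t| ≤ (2 * exp (-t)) * (4 * K * exp ((1 - a) * t)) := by
        gcongr
        exact hJ_bound ha ha2 h ht
    _ = 8 * K * (exp (-t) * exp ((1 - a) * t)) := by ring
    _ = _ := by rw [← exp_add]; congr 2; ring

theorem hG_hasDerivAt (ha : 0 ≤ a) (h : Dec a K N) (t : ℝ) :
    HasDerivAt (fun t => sch t * hJ N t) (cosh t * hI N t - tanh t * (sch t * hJ N t)) t := by
  refine ((sch_hasDerivAt t).mul (hJ_hasDerivAt ha h t)).congr_deriv ?_
  have := sch_mul_cosh t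
  linear_combination (cosh t * hI N t) * this

theorem hp_hasDerivAt (ha : 0 ≤ a) (h : Dec a K N) (t : ℝ) :
    HasDerivAt (fun t => cosh t * hI N t) (tanh t * (cosh t * hI N t) - N t) t := by
  refine ((Real.hasDerivAt_cosh t).mul (hI_hasDerivAt ha h t)).congr_deriv ?_
  have := sch_mul_cosh t
  have := tanh_cosh t
  linear_combination - (hI N t) * tanh_cosh t - N t * sch_mul_cosh t

theorem const_Ici {E : ℝ → ℝ} (hc : Continuous E) (hd : ∀ t > 0, HasDerivAt E 0 t) {t : ℝ} (ht : 0 ≤ t) :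
    E t = E 0 := by
  rcases ht.eq_or_lt with rfl | ht
  · rfl
  obtain ⟨c, _, h⟩ := exists_hasDerivAt_eq_slope E (fun _ => 0) ht hc.continuousOn
    (fun x hx => hd x hx.1)
  rw [eq_comm, div_eq_zero_iff] at h
  rcases h with h | h <;> linarith

theorem half_rep (ha : 0 ≤ a) (h : Dec a K N) {D D1 : ℝ → ℝ} {B : ℝ} (hDc : Continuous D)
    (hB : ∀ t, |D t| ≤ B)
    (h1 : ∀ t > 0, HasDerivAt D (D1 t) t)
    (h2 : ∀ t > 0, HasDerivAt D1 (cos (q0 t) * D t - N t) t) :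
    (∀ t ≥ 0, D t = D 0 * sch t + sch t * hJ N t) ∧
    (∀ t > 0, D1 t + tanh t * D t = cosh t * hI N t) := by
  have hP : ∀ t > 0, HasDerivAt (fun t => (D1 t + tanh t * D t) * sch t - hI N t) 0 t := by
    intro t ht
    have := (((h2 t ht).add ((tanh_hasDerivAt t).mul (h1 t ht))).mul (sch_hasDerivAt t)).sub
      (hI_hasDerivAt ha h t)
    refine this.congr_deriv ?_
    simp only [Pi.add_apply, Pi.mul_apply]
    rw [cos_q0]
    have := tanh_sq_eq t
    linear_combination (- D t * sch t) * this
  obtain ⟨l, hl⟩ : ∃ l, ∀ t > 0, (D1 t + tanh t * D t) * sch t - hI N t = l := by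
    refine ⟨_, fun t ht => IsOpen.is_const_of_deriv_eq_zero (𝕜 := ℝ) isOpen_Ioi isPreconnected_Ioi
      (fun t ht => (hP t ht).differentiableAt.differentiableWithinAt) (fun t ht => (hP t ht).deriv)
      (x := t) (y := 1) ht (by simp)⟩
  have hP' : ∀ t > 0, D1 t + tanh t * D t = cosh t * (hI N t + l) := by
    intro t ht
    linear_combination (cosh t) * hl t ht - (D1 t + tanh t * D t) * sch_mul_cosh t
  have hE : ∀ t ≥ 0, D t * cosh t - hJ N t - l * ((t + sinh t * cosh t) / 2) = D 0 := by
    intro t ht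
    have := const_Ici (E := fun t => D t * cosh t - hJ N t - l * ((t + sinh t * cosh t) / 2))
      (((hDc.mul continuous_cosh).sub (hJ_continuous ha h)).sub (by fun_prop)) (fun t ht => by
        have := (((h1 t ht).mul (hasDerivAt_cosh t)).sub (hJ_hasDerivAt ha h t)).sub
          ((((hasDerivAt_id t).add ((hasDerivAt_sinh t).mul (hasDerivAt_cosh t))).div_const 2).const_mul l)
        refine this.congr_deriv ?_
        have e1 := hP' t ht
        have e2 := tanh_cosh t
        have e3 := cosh_sq_sub_sinh_sq t
        linear_combination (cosh t) * e1 - D t * e2 + l / 2 * e3) ht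
    simpa [hJ_zero] using this
  have hl0 : l = 0 := by
    have hK := h.nonneg
    have hbig : ∀ t ≥ 0, |l| * (sinh t / 2) ≤ B + |D 0| + 8 * K := by
      intro t ht
      have e1 : l * (sch t * (t + sinh t * cosh t) / 2) = D t - D 0 * sch t - sch t * hJ N t := by
        linear_combination (- sch t) * hE t ht + D t * sch_mul_cosh t
      have hdec0 : Dec 0 K N := ⟨h.1, fun t => by simpa using h.bdd ha t⟩
      have e2 := hG_bound le_rfl (by norm_num) hdec0 ht
      have e3 : |l| * (sch t * (t + sinh t * cosh t) / 2) ≤ B + |D 0| + 8 * K := by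
        have hs := sch_pos t
        have hsh : 0 ≤ sinh t := sinh_nonneg_iff.2 ht
        have hch := cosh_pos t
        rw [← abs_of_nonneg (show 0 ≤ sch t * (t + sinh t * cosh t) / 2 by positivity), ← abs_mul, e1]
        have e4 : |D 0 * sch t| ≤ |D 0| := by
          rw [abs_mul, abs_of_pos hs]; exact mul_le_of_le_one_right (abs_nonneg _) (sch_le_one t)
        have e5 := abs_sub (D t - D 0 * sch t) (sch t * hJ N t)
        have e6 := abs_sub (D t) (D 0 * sch t)
        simp only [zero_mul, neg_zero, exp_zero, mul_one] at e2
        linarith [hB t]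
      refine le_trans (mul_le_mul_of_nonneg_left ?_ (abs_nonneg _)) e3
      have e7 : sch t * (t + sinh t * cosh t) / 2 = sch t * t / 2 + sinh t / 2 := by
        linear_combination (sinh t / 2) * sch_mul_cosh t
      rw [e7]
      have := mul_nonneg (sch_pos t).le ht
      linarith
    by_contra hne
    have hpos : 0 < |l| := abs_pos.2 hne
    set M := B + |D 0| + 8 * K
    have hM : 0 ≤ M := by have := (abs_nonneg _).trans (hB 0); positivity
    have h3 := hbig ((2 * M + 2) / |l|) (by positivity)
    have h4 : (2 * M + 2) / |l| ≤ sinh ((2 * M + 2) / |l|) := self_le_sinh_iff.2 (by positivity)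
    have h5 : |l| * ((2 * M + 2) / |l| / 2) = M + 1 := by field_simp
    have h6 : |l| * ((2 * M + 2) / |l| / 2) ≤ |l| * (sinh ((2 * M + 2) / |l|) / 2) := by gcongr
    linarith
  subst hl0
  refine ⟨fun t ht => ?_, fun t ht => by rw [hP' t ht, add_zero]⟩
  linear_combination (sch t) * hE t ht - D t * sch_mul_cosh t
end half



/-- the first-order factor -/
noncomputable def pN (N : ℝ → ℝ) (t : ℝ) : ℝ :=
  if 0 < t then cosh t * hI N t else -(cosh t * hI (fun s => N (-s)) (-t))
/-- the Green operator -/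
noncomputable def GN (N : ℝ → ℝ) (t : ℝ) : ℝ :=
  if 0 ≤ t then sch t * hJ N t else sch t * hJ (fun s => N (-s)) (-t)

section full
variable {a K : ℝ} {N : ℝ → ℝ}

theorem GN_zero : GN N 0 = 0 := by simp [GN, hJ_zero]
theorem GN_of_nonneg {t : ℝ} (ht : 0 ≤ t) : GN N t = sch t * hJ N t := if_pos ht
theorem GN_of_nonpos {t : ℝ} (ht : t ≤ 0) : GN N t = sch (-t) * hJ (fun s => N (-s)) (-t) := by
  rcases ht.eq_or_lt with rfl | ht
  · simp [GN, hJ_zero]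
  · rw [GN, if_neg (not_le.2 ht), sch_neg]
theorem pN_of_pos {t : ℝ} (ht : 0 < t) : pN N t = cosh t * hI N t := if_pos ht
theorem pN_of_nonpos {t : ℝ} (ht : t ≤ 0) : pN N t = -(cosh (-t) * hI (fun s => N (-s)) (-t)) := by
  rw [pN, if_neg (not_lt.2 ht), cosh_neg]

theorem GN_continuous (ha : 0 ≤ a) (h : Dec a K N) : Continuous (GN N) := by
  refine Continuous.if_le (sch_continuous.mul (hJ_continuous ha h))
    (sch_continuous.mul ((hJ_continuous ha h.refl).comp continuous_neg)) continuous_const continuous_id ?_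
  rintro x rfl
  simp [hJ_zero]

theorem pN_measurable (ha : 0 ≤ a) (h : Dec a K N) : Measurable (pN N) :=
  Measurable.ite measurableSet_Ioi (continuous_cosh.mul (hI_continuous ha h)).measurable
    (continuous_cosh.mul ((hI_continuous ha h.refl).comp continuous_neg)).neg.measurable

theorem pN_bound (ha : 0 ≤ a) (h : Dec a K N) (t : ℝ) : |pN N t| ≤ 2 * K * exp (-(a * |t|)) := by
  rcases lt_or_ge 0 t with ht | ht
  · rw [pN_of_pos ht, abs_of_pos ht]; exact hp_bound ha h ht.le
  · rw [pN_of_nonpos ht, abs_neg, abs_of_nonpos ht]; exact hp_bound ha h.refl (by linarith)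

theorem GN_bound (ha : 0 ≤ a) (ha2 : a ≤ 1 / 2) (h : Dec a K N) (t : ℝ) :
    |GN N t| ≤ 8 * K * exp (-(a * |t|)) := by
  rcases le_or_gt 0 t with ht | ht
  · rw [GN_of_nonneg ht, abs_of_nonneg ht]; exact hG_bound ha ha2 h ht
  · rw [GN_of_nonpos ht.le, abs_of_neg ht]; exact hG_bound ha ha2 h.refl (by linarith)

theorem GN_dec (ha : 0 ≤ a) (ha2 : a ≤ 1 / 2) (h : Dec a K N) : Dec a (8 * K) (GN N) :=
  ⟨GN_continuous ha h, GN_bound ha ha2 h⟩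

theorem GN_hasDerivAt (ha : 0 ≤ a) (h : Dec a K N) {t : ℝ} (ht : t ≠ 0) :
    HasDerivAt (GN N) (pN N t - tanh t * GN N t) t := by
  rcases lt_or_gt_of_ne ht with ht | ht
  · have h1 := (hG_hasDerivAt ha h.refl (-t)).comp t (hasDerivAt_neg t)
    have h2 : GN N =ᶠ[𝓝 t] (fun t => sch t * hJ (fun s => N (-s)) t) ∘ Neg.neg := by
      filter_upwards [Iio_mem_nhds ht] with s hs
      exact GN_of_nonpos (le_of_lt hs)
    refine (h1.congr_of_eventuallyEq h2).congr_deriv ?_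
    rw [pN_of_nonpos ht.le, GN_of_nonpos ht.le, tanh_neg]
    ring
  · have h2 : GN N =ᶠ[𝓝 t] (fun t => sch t * hJ N t) := by
      filter_upwards [Ioi_mem_nhds ht] with s hs
      exact GN_of_nonneg (le_of_lt hs)
    refine ((hG_hasDerivAt ha h t).congr_of_eventuallyEq h2).congr_deriv ?_
    rw [pN_of_pos ht, GN_of_nonneg ht.le]

theorem pN_hasDerivAt (ha : 0 ≤ a) (h : Dec a K N) {t : ℝ} (ht : t ≠ 0) :
    HasDerivAt (pN N) (tanh t * pN N t - N t) t := by
  rcases lt_or_gt_of_ne ht with ht | ht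
  · have h1 := ((hp_hasDerivAt ha h.refl (-t)).comp t (hasDerivAt_neg t)).neg
    have h2 : pN N =ᶠ[𝓝 t] -((fun t => cosh t * hI (fun s => N (-s)) t) ∘ Neg.neg) := by
      filter_upwards [Iio_mem_nhds ht] with s hs
      exact pN_of_nonpos (le_of_lt hs)
    refine (h1.congr_of_eventuallyEq h2).congr_deriv ?_
    rw [pN_of_nonpos ht.le, tanh_neg, neg_neg]
    ring
  · have h2 : pN N =ᶠ[𝓝 t] (fun t => cosh t * hI N t) := by
      filter_upwards [Ioi_mem_nhds ht] with s hs
      exact pN_of_pos hs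
    refine ((hp_hasDerivAt ha h t).congr_of_eventuallyEq h2).congr_deriv ?_
    rw [pN_of_pos ht]

theorem total_sch (ha : 0 ≤ a) (h : Dec a K N) :
    ∫ t, N t * sch t = hI N 0 + hI (fun s => N (-s)) 0 := by
  have hi := mul_sch_integrable h.1 (h.bdd ha)
  rw [← intervalIntegral.integral_Iic_add_Ioi (b := 0) hi.integrableOn hi.integrableOn, add_comm, hI, hI]
  congr 1
  have := integral_comp_neg_Ioi 0 (fun s => N s * sch s)
  rw [neg_zero] at this
  rw [← this]
  simp only [sch_neg]

theorem full_rep (ha : 0 ≤ a) (h : Dec a K N) {D D1 : ℝ → ℝ} {B : ℝ} (hDc : Continuous D)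
    (hB : ∀ t, |D t| ≤ B)
    (h1 : ∀ t ≠ 0, HasDerivAt D (D1 t) t)
    (h2 : ∀ t ≠ 0, HasDerivAt D1 (cos (q0 t) * D t - N t) t) :
    (∀ t, D t = D 0 * sch t + GN N t) ∧ (ContinuousAt D1 0 → ∫ t, N t * sch t = 0) := by
  obtain ⟨r1, r2⟩ := half_rep ha h hDc hB (fun t ht => h1 t (ne_of_gt ht)) (fun t ht => h2 t (ne_of_gt ht))
  have hq : ∀ t, cos (q0 (-t)) = cos (q0 t) := by intro t; rw [cos_q0, cos_q0, sch_neg]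
  obtain ⟨l1, l2⟩ := half_rep (D := fun t => D (-t)) (D1 := fun t => - D1 (-t)) ha h.refl
    (hDc.comp continuous_neg) (fun t => hB (-t))
    (fun t ht => ((h1 (-t) (by linarith [ht] : (-t) < 0).ne).comp t (hasDerivAt_neg t)).congr_deriv
      (by ring))
    (fun t ht => ((h2 (-t) (by linarith [ht] : (-t) < 0).ne).comp t (hasDerivAt_neg t)).neg.congr_deriv
      (by rw [hq]; ring))
  refine ⟨fun t => ?_, fun hc => ?_⟩
  · rcases le_total 0 t with ht | ht
    · rw [r1 t ht, GN_of_nonneg ht]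
    · have := l1 (-t) (by linarith)
      rw [GN_of_nonpos ht]
      simpa [sch_neg] using this
  · rw [total_sch ha h]
    have hcl : ContinuousAt (fun t => D1 t + tanh t * D t) 0 :=
      hc.add (tanh_continuous.mul hDc).continuousAt
    have e1 : D1 0 = hI N 0 := by
      have t1 : Tendsto (fun t => D1 t + tanh t * D t) (𝓝[>] 0) (𝓝 (D1 0)) := by
        have := hcl.tendsto.mono_left (nhdsWithin_le_nhds (s := Set.Ioi 0))
        simpa using this
      have t2 : Tendsto (fun t => cosh t * hI N t) (𝓝[>] 0) (𝓝 (hI N 0)) := by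
        have hcc : Continuous (fun t => cosh t * hI N t) := continuous_cosh.mul (hI_continuous ha h)
        have := (hcc.tendsto 0).mono_left
          (nhdsWithin_le_nhds (s := Set.Ioi 0))
        simpa using this
      refine tendsto_nhds_unique_of_eventuallyEq t1 t2 ?_
      filter_upwards [self_mem_nhdsWithin] with t ht using r2 t ht
    have e2 : - D1 0 = hI (fun s => N (-s)) 0 := by
      have t1 : Tendsto (fun t => - D1 (-t) + tanh t * D (-t)) (𝓝[>] 0) (𝓝 (- D1 0)) := by
        have hm : ContinuousAt (fun t : ℝ => -t) 0 := continuous_neg.continuousAt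
        have hcc : ContinuousAt (fun t => - D1 (-t) + tanh t * D (-t)) 0 :=
          (ContinuousAt.comp (f := fun t : ℝ => -t) (g := D1) (by simpa using hc) hm).neg.add
            (tanh_continuous.mul (hDc.comp continuous_neg)).continuousAt
        have := hcc.tendsto.mono_left (nhdsWithin_le_nhds (s := Set.Ioi 0))
        simpa using this
      have t2 : Tendsto (fun t => cosh t * hI (fun s => N (-s)) t) (𝓝[>] 0)
          (𝓝 (hI (fun s => N (-s)) 0)) := by
        have hcc : Continuous (fun t => cosh t * hI (fun s => N (-s)) t) :=
          continuous_cosh.mul (hI_continuous ha h.refl)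
        have := (hcc.tendsto 0).mono_left
          (nhdsWithin_le_nhds (s := Set.Ioi 0))
        simpa using this
      refine tendsto_nhds_unique_of_eventuallyEq t1 t2 ?_
      filter_upwards [self_mem_nhdsWithin] with t ht using l2 t ht
    linarith

theorem hI_lin (ha : 0 ≤ a) (h : Dec a K N) {a' K' : ℝ} {N' : ℝ → ℝ} (ha' : 0 ≤ a') (h' : Dec a' K' N') (c : ℝ)
    (t : ℝ) : hI (fun t => N t + c * N' t) t = hI N t + c * hI N' t := by
  have hi := mul_sch_integrable h.1 (h.bdd ha)
  have hi' := (mul_sch_integrable h'.1 (h'.bdd ha')).const_mul c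
  rw [hI, hI, hI, ← integral_const_mul, ← integral_add hi.integrableOn hi'.integrableOn]
  congr 1; ext s; ring

theorem hJ_lin (ha : 0 ≤ a) (h : Dec a K N) {a' K' : ℝ} {N' : ℝ → ℝ} (ha' : 0 ≤ a') (h' : Dec a' K' N') (c : ℝ)
    (t : ℝ) : hJ (fun t => N t + c * N' t) t = hJ N t + c * hJ N' t := by
  have c1 : Continuous (fun s => cosh s ^ 2 * hI N s) := (continuous_cosh.pow 2).mul (hI_continuous ha h)
  have c2 : Continuous (fun s => c * (cosh s ^ 2 * hI N' s)) :=
    continuous_const.mul ((continuous_cosh.pow 2).mul (hI_continuous ha' h'))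
  rw [hJ, hJ, hJ, ← intervalIntegral.integral_const_mul, ← intervalIntegral.integral_add
    (c1.intervalIntegrable _ _) (c2.intervalIntegrable _ _)]
  congr 1; ext s; rw [hI_lin ha h ha' h']; ring

theorem GN_lin (ha : 0 ≤ a) (h : Dec a K N) {a' K' : ℝ} {N' : ℝ → ℝ} (ha' : 0 ≤ a') (h' : Dec a' K' N') (c : ℝ)
    (t : ℝ) : GN (fun t => N t + c * N' t) t = GN N t + c * GN N' t := by
  rcases le_total 0 t with ht | ht
  · rw [GN_of_nonneg ht, GN_of_nonneg ht, GN_of_nonneg ht, hJ_lin ha h ha' h']; ring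
  · rw [GN_of_nonpos ht, GN_of_nonpos ht, GN_of_nonpos ht, hJ_lin ha h.refl ha' h'.refl]; ring

/-- integral of a derivative on the line, one exceptional point -/
theorem integral_deriv_zero {F F' : ℝ → ℝ} (hc : Continuous F) (hd : ∀ t ≠ 0, HasDerivAt F (F' t) t)
    (hi : Integrable F') {A b : ℝ} (hb : 0 < b) (hF : ∀ t, |F t| ≤ A * exp (-(b * |t|))) : ∫ t, F' t = 0 := by
  have hbig : Tendsto (fun t : ℝ => A * exp (-(b * t))) atTop (𝓝 0) := by
    have := (tendsto_exp_atBot.comp (tendsto_neg_atTop_atBot.comp (tendsto_id.const_mul_atTop hb))).const_mul A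
    simpa using this
  have h1 : Tendsto F atTop (𝓝 0) := by
    refine squeeze_zero_norm (fun t => hF t) (hbig.comp tendsto_abs_atTop_atTop)
  have h2 : Tendsto F atBot (𝓝 0) := by
    refine squeeze_zero_norm (fun t => hF t) (hbig.comp tendsto_abs_atBot_atTop)
  rw [← intervalIntegral.integral_Iic_add_Ioi (b := 0) hi.integrableOn hi.integrableOn,
    integral_Ioi_of_hasDerivAt_of_tendsto hc.continuousWithinAt (fun t ht => hd t (ne_of_gt ht)) hi.integrableOn h1,
    integral_Iic_of_hasDerivAt_of_tendsto hc.continuousWithinAt (fun t ht => hd t (ne_of_lt ht)) hi.integrableOn h2]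
  ring

theorem dec_mul_integrable {F G : ℝ → ℝ} {A B : ℝ} (hF : Measurable F) (hG : Measurable G)
    (hFb : ∀ t, |F t| ≤ A * exp (-(1 / 2 * |t|))) (hGb : ∀ t, |G t| ≤ B * exp (-(1 / 2 * |t|))) :
    Integrable (fun t => F t * G t) := by
  have hB : 0 ≤ B := by have := (abs_nonneg _).trans (hGb 0); simpa using this
  have hA : 0 ≤ A := by have := (abs_nonneg _).trans (hFb 0); simpa using this
  refine ((exp_abs_integrable one_pos).const_mul (A * B)).mono' (hF.mul hG).aestronglyMeasurable
    (Eventually.of_forall fun t => ?_)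
  rw [norm_mul, Real.norm_eq_abs, Real.norm_eq_abs]
  calc |F t| * |G t| ≤ (A * exp (-(1 / 2 * |t|))) * (B * exp (-(1 / 2 * |t|))) := by
        gcongr
        · exact hFb t
        · exact hGb t
    _ = A * B * (exp (-(1 / 2 * |t|)) * exp (-(1 / 2 * |t|))) := by ring
    _ = _ := by rw [← exp_add]; congr 2; ring

theorem green_symm {N N' : ℝ → ℝ} {K K' : ℝ} (h : Dec (1/2) K N) (h' : Dec (1/2) K' N') :
    ∫ t, N t * GN N' t = ∫ t, pN N t * pN N' t := by
  have ha : (0:ℝ) ≤ 1 / 2 := by norm_num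
  have i1 := dec_mul_integrable h.1.measurable (GN_continuous ha h').measurable h.2 (GN_bound ha le_rfl h')
  have i2 := dec_mul_integrable (pN_measurable ha h) (pN_measurable ha h') (pN_bound ha h) (pN_bound ha h')
  have hcont : Continuous (fun t => pN N t * GN N' t) := by
    refine continuous_iff_continuousAt.2 fun t => ?_
    rcases eq_or_ne t 0 with rfl | ht
    · rw [ContinuousAt, GN_zero, mul_zero]
      have hz : Tendsto (fun t => 2 * K * |GN N' t|) (𝓝 0) (𝓝 0) := by
        have := ((GN_continuous ha h').abs.const_mul (2 * K)).tendsto 0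
        simpa [GN_zero] using this
      refine squeeze_zero_norm (fun t => ?_) hz
      rw [norm_mul, Real.norm_eq_abs, Real.norm_eq_abs]
      refine mul_le_mul_of_nonneg_right ((pN_bound ha h t).trans ?_) (abs_nonneg _)
      refine mul_le_of_le_one_right (by have := h.nonneg; positivity) ?_
      rw [exp_le_one_iff]; have := abs_nonneg t; linarith
    · exact (pN_hasDerivAt ha h ht).continuousAt.mul (GN_hasDerivAt ha h' ht).continuousAt
  have hd : ∀ t ≠ 0, HasDerivAt (fun t => pN N t * GN N' t) (pN N t * pN N' t - N t * GN N' t) t := by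
    intro t ht
    refine ((pN_hasDerivAt ha h ht).mul (GN_hasDerivAt ha h' ht)).congr_deriv ?_
    ring
  have := integral_deriv_zero (A := 2 * K * (8 * K')) (b := 1) hcont hd (i2.sub i1) one_pos (fun t => by
    rw [abs_mul]
    have hK := h.nonneg
    have hK' := h'.nonneg
    calc |pN N t| * |GN N' t| ≤ (2 * K * exp (-(1 / 2 * |t|))) * (8 * K' * exp (-(1 / 2 * |t|))) := by
          gcongr
          · exact pN_bound ha h t
          · exact GN_bound ha le_rfl h' t
      _ = 2 * K * (8 * K') * (exp (-(1 / 2 * |t|)) * exp (-(1 / 2 * |t|))) := by ring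
      _ = _ := by rw [← exp_add]; congr 2; ring)
  rw [integral_sub i2 i1] at this
  linarith
end full



/-- bounded continuous functions -/
abbrev XB := ℝ →ᵇ ℝ

/-- make a bounded continuous function -/
noncomputable def mkB (f : ℝ → ℝ) (hf : Continuous f) (C : ℝ) (hC : ∀ t, |f t| ≤ C) : XB :=
  BoundedContinuousFunction.ofNormedAddCommGroup f hf C hC
@[simp] theorem mkB_apply (f : ℝ → ℝ) (hf : Continuous f) (C : ℝ) (hC : ∀ t, |f t| ≤ C) (t : ℝ) :
    mkB f hf C hC t = f t := rfl
theorem mkB_norm (f : ℝ → ℝ) (hf : Continuous f) (C : ℝ) (hC : ∀ t, |f t| ≤ C) : ‖mkB f hf C hC‖ ≤ C :=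
  (BoundedContinuousFunction.norm_le ((abs_nonneg _).trans (hC 0))).2 hC
theorem XB.le (v : XB) (t : ℝ) : |v t| ≤ ‖v‖ := v.norm_coe_le_norm t
theorem XB.mul_apply (v w : XB) (t : ℝ) : (v * w) t = v t * w t := rfl
theorem XB.add_apply (v w : XB) (t : ℝ) : (v + w) t = v t + w t := rfl
theorem XB.sub_apply (v w : XB) (t : ℝ) : (v - w) t = v t - w t := rfl
theorem XB.neg_apply (v : XB) (t : ℝ) : (-v) t = -v t := rfl
theorem XB.smul_apply (c : ℝ) (v : XB) (t : ℝ) : (c • v) t = c * v t := rfl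
theorem XB.one_apply (t : ℝ) : (1 : XB) t = 1 := rfl
theorem XB.zero_apply (t : ℝ) : (0 : XB) t = 0 := rfl

noncomputable def wB : XB := mkB wt wt_continuous 1 fun t => by
  rw [abs_of_pos (wt_pos t)]; exact wt_le_one t
noncomputable def kB : XB := mkB (fun t => sch t / wt t)
  (sch_continuous.div₀ wt_continuous fun t => (wt_pos t).ne') 2 fun t => by
    rw [abs_of_pos (div_pos (sch_pos t) (wt_pos t)), div_le_iff₀ (wt_pos t)]; exact sch_le_wt t
noncomputable def tB : XB := mkB tanh tanh_continuous 1 fun t => (abs_tanh_lt_one t).le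
noncomputable def sB : XB := mkB sch sch_continuous 1 fun t => by
  rw [abs_of_pos (sch_pos t)]; exact sch_le_one t
noncomputable def cB : XB := mkB (fun t => cos (q0 t)) (continuous_cos.comp q0_continuous) 1
  fun t => abs_cos_le_one _
/-- `sin q0 / w` -/
noncomputable def mB : XB := (-2 : ℝ) • (tB * kB)
theorem mB_apply (t : ℝ) : wt t * mB t = sin (q0 t) := by
  have := wt_pos t
  rw [mB, XB.smul_apply, XB.mul_apply, sin_q0, tB, kB, mkB_apply, mkB_apply]
  field_simp
theorem kB_apply (t : ℝ) : wt t * kB t = sch t := by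
  have := wt_pos t
  rw [kB, mkB_apply]; field_simp
theorem wB_apply (t : ℝ) : wB t = wt t := rfl
theorem cB_apply (t : ℝ) : cB t = cos (q0 t) := rfl
theorem tB_apply (t : ℝ) : tB t = tanh t := rfl
theorem sB_apply (t : ℝ) : sB t = sch t := rfl
/-- `psi0 / w^2` -/
noncomputable def pB : XB := mkB (fun t => psi0 t / wt t ^ 2)
  (psi0_continuous.div₀ (wt_continuous.pow 2) fun t => (pow_pos (wt_pos t) 2).ne') 2 fun t => by
    rw [abs_of_pos (div_pos (psi0_pos t) (pow_pos (wt_pos t) 2)), div_le_iff₀ (pow_pos (wt_pos t) 2),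
      wt_sq]
    exact (psi0_le t).trans (sch_le t)
theorem pB_apply (t : ℝ) : wt t ^ 2 * pB t = psi0 t := by
  have := wt_pos t
  rw [pB, mkB_apply]; field_simp

theorem wt_dec (M : XB) : Dec (1/2) ‖M‖ (fun t => wt t * M t) :=
  ⟨wt_continuous.mul M.continuous, fun t => by
    rw [abs_mul, abs_of_pos (wt_pos t), mul_comm]
    refine mul_le_mul (M.le t) (le_of_eq ?_) (wt_pos t).le (norm_nonneg M)
    rw [wt]; congr 1; ring⟩

theorem wt2_integrable (M : XB) : Integrable (fun t => wt t ^ 2 * M t) := by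
  refine ((exp_abs_integrable one_pos).const_mul ‖M‖).mono'
    ((wt_continuous.pow 2).mul M.continuous).aestronglyMeasurable (Eventually.of_forall fun t => ?_)
  rw [norm_mul, Real.norm_eq_abs, Real.norm_eq_abs, abs_of_pos (pow_pos (wt_pos t) 2), wt_sq, one_mul, mul_comm]
  exact mul_le_mul_of_nonneg_right (M.le t) (exp_pos _).le

theorem ell_aux (M : XB) : ‖∫ t, wt t ^ 2 * M t‖ ≤ (∫ t, exp (-(1 * |t|))) * ‖M‖ := by
  rw [mul_comm, ← integral_const_mul]
  refine norm_integral_le_of_norm_le ((exp_abs_integrable one_pos).const_mul ‖M‖)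
    (Eventually.of_forall fun t => ?_)
  rw [norm_mul, Real.norm_eq_abs, Real.norm_eq_abs, abs_of_pos (pow_pos (wt_pos t) 2), wt_sq, one_mul,
    mul_comm]
  exact mul_le_mul_of_nonneg_right (M.le t) (exp_pos _).le

/-- weighted integral -/
noncomputable def ell : XB →L[ℝ] ℝ :=
  LinearMap.mkContinuous
    { toFun := fun M => ∫ t, wt t ^ 2 * M t
      map_add' := fun M M' => by
        rw [← integral_add (wt2_integrable M) (wt2_integrable M')]
        congr 1; ext t; rw [XB.add_apply]; ring
      map_smul' := fun c M => by
        rw [RingHom.id_apply, smul_eq_mul, ← integral_const_mul]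
        congr 1; ext t; rw [XB.smul_apply]; ring } (∫ t, exp (-(1 * |t|))) ell_aux
theorem ell_apply (M : XB) : ell M = ∫ t, wt t ^ 2 * M t := rfl

theorem GwB_aux (M : XB) (t : ℝ) : |(wt t)⁻¹ * GN (fun s => wt s * M s) t| ≤ 8 * ‖M‖ := by
  have := GN_bound (by norm_num) le_rfl (wt_dec M) t
  have hw := wt_pos t
  rw [abs_mul, abs_of_pos (inv_pos.2 hw), inv_mul_le_iff₀ hw]
  refine this.trans (le_of_eq ?_)
  rw [mul_comm (wt t), wt]; congr 2; ring

/-- weighted Green operator -/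
noncomputable def Gw : XB →L[ℝ] XB :=
  LinearMap.mkContinuous
    { toFun := fun M => mkB (fun t => (wt t)⁻¹ * GN (fun s => wt s * M s) t)
        ((wt_continuous.inv₀ fun t => (wt_pos t).ne').mul (GN_continuous (by norm_num) (wt_dec M)))
        (8 * ‖M‖) (GwB_aux M)
      map_add' := fun M M' => by
        ext t
        rw [XB.add_apply, mkB_apply, mkB_apply, mkB_apply, ← mul_add]
        have := GN_lin (by norm_num) (wt_dec M) (by norm_num) (wt_dec M') 1 t
        rw [one_mul] at this
        rw [← this]
        congr 2; ext s; rw [XB.add_apply]; ring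
      map_smul' := fun c M => by
        ext t
        rw [RingHom.id_apply, XB.smul_apply, mkB_apply, mkB_apply]
        have := GN_lin (by norm_num) (wt_dec 0) (by norm_num) (wt_dec M) c t
        have h0 : GN (fun s => wt s * (0 : XB) s) t = 0 := by
          simp [GN, hJ, hI]
        rw [h0, zero_add] at this
        have h2 : (fun s => wt s * (c • M) s) = (fun t => wt t * (0 : XB) t + c * (wt t * M t)) := by
          ext s; rw [XB.smul_apply, XB.zero_apply]; ring
        rw [h2, this]; ring } 8 (fun M => mkB_norm _ _ _ (GwB_aux M))
theorem Gw_apply (M : XB) (t : ℝ) : wt t * Gw M t = GN (fun s => wt s * M s) t := by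
  have := wt_pos t
  change wt t * ((wt t)⁻¹ * GN (fun s => wt s * M s) t) = _
  field_simp

theorem ell_Gw (M M' : XB) :
    ell (M * Gw M') = ∫ t, pN (fun s => wt s * M s) t * pN (fun s => wt s * M' s) t := by
  rw [← green_symm (wt_dec M) (wt_dec M'), ell_apply]
  congr 1; ext t
  rw [← Gw_apply, XB.mul_apply]; ring
theorem ell_symm (M M' : XB) : ell (M * Gw M') = ell (M' * Gw M) := by
  rw [ell_Gw, ell_Gw]; congr 1; ext t; ring

/-! ### nonlinearity -/
theorem sinc_contDiff : ContDiff ℝ ∞ sinc := by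
  refine contDiff_iff_contDiffAt.2 fun x => ?_
  rcases eq_or_ne x 0 with rfl | hx
  · have h : AnalyticAt ℝ sin 0 := analyticAt_sin
    obtain ⟨p, hp⟩ := h
    have h2 := hp.has_fpower_series_dslope_fslope
    rw [← sinc_eq_dslope] at h2
    exact h2.analyticAt.contDiffAt
  · have : sinc =ᶠ[𝓝 x] fun x => sin x / x := by
      filter_upwards [isOpen_ne.mem_nhds hx] with y hy using sinc_of_ne_zero hy
    exact (ContDiffAt.div contDiff_sin.contDiffAt contDiffAt_id hx).congr_of_eventuallyEq this

noncomputable def NS : XB → XB := (nem_real sinc sinc_contDiff).choose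
theorem NS_contDiff : ContDiff ℝ ∞ NS := (nem_real sinc sinc_contDiff).choose_spec.1
theorem NS_apply (v : XB) (t : ℝ) : NS v t = sinc (v t) := (nem_real sinc sinc_contDiff).choose_spec.2 v t
noncomputable def NC : XB → XB := (nem_real cos contDiff_cos).choose
theorem NC_contDiff : ContDiff ℝ ∞ NC := (nem_real cos contDiff_cos).choose_spec.1
theorem NC_apply (v : XB) (t : ℝ) : NC v t = cos (v t) := (nem_real cos contDiff_cos).choose_spec.2 v t

/-- `sin(wv)/w` -/
noncomputable def sinw (v : XB) : XB := v * NS (wB * v)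
noncomputable def cosw (v : XB) : XB := NC (wB * v)
theorem sinw_contDiff : ContDiff ℝ ∞ sinw :=
  contDiff_id.mul (NS_contDiff.comp (contDiff_const.mul contDiff_id))
theorem cosw_contDiff : ContDiff ℝ ∞ cosw := NC_contDiff.comp (contDiff_const.mul contDiff_id)
theorem sinw_apply (v : XB) (t : ℝ) : wt t * sinw v t = sin (wt t * v t) := by
  rw [sinw, XB.mul_apply, NS_apply, XB.mul_apply, wB_apply]
  by_cases h : wt t * v t = 0
  · rw [h, ← mul_assoc, h]; simp
  · rw [sinc_of_ne_zero h, ← mul_assoc, mul_div_cancel₀ _ h]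
theorem cosw_apply (v : XB) (t : ℝ) : cosw v t = cos (wt t * v t) := by
  rw [cosw, NC_apply, XB.mul_apply, wB_apply]

/-- `sin(q0+u)/w` -/
noncomputable def sqB (v : XB) : XB := mB * cosw v + cB * sinw v
theorem sqB_contDiff : ContDiff ℝ ∞ sqB :=
  (contDiff_const.mul cosw_contDiff).add (contDiff_const.mul sinw_contDiff)
theorem sqB_apply (v : XB) (t : ℝ) : wt t * sqB v t = sin (q0 t + wt t * v t) := by
  rw [sqB, XB.add_apply, XB.mul_apply, XB.mul_apply, sin_add, ← mB_apply, ← sinw_apply, cosw_apply, cB_apply]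
  ring
/-- `(1 - cos(q0+u))/w^2` -/
noncomputable def UB (v : XB) : XB :=
  (2 : ℝ) • (kB * kB * cosw v) + (2 : ℝ) • (sinw ((1/2 : ℝ) • v) * sinw ((1/2 : ℝ) • v)) + mB * sinw v
theorem UB_contDiff : ContDiff ℝ ∞ UB := by
  have h1 : ContDiff ℝ ∞ (fun v : XB => sinw ((1/2 : ℝ) • v)) := sinw_contDiff.comp (contDiff_const_smul _)
  exact ((contDiff_const.mul cosw_contDiff).const_smul (2:ℝ)).add ((h1.mul h1).const_smul (2:ℝ)) |>.add
    (contDiff_const.mul sinw_contDiff)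
theorem UB_apply (v : XB) (t : ℝ) : wt t ^ 2 * UB v t = 1 - cos (q0 t + wt t * v t) := by
  have e1 := sinw_apply v t
  have e2 := sinw_apply ((1/2:ℝ) • v) t
  rw [XB.smul_apply] at e2
  have e3 : cos (wt t * v t) = 1 - 2 * sin (wt t * (1 / 2 * v t)) ^ 2 := by
    have := Real.cos_two_mul (wt t * (1/2 * v t))
    have h := Real.sin_sq_add_cos_sq (wt t * (1/2 * v t))
    rw [show 2 * (wt t * (1/2 * v t)) = wt t * v t by ring] at this
    linarith
  rw [UB]
  simp only [XB.add_apply, XB.smul_apply, XB.mul_apply, cosw_apply]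
  rw [cos_add, cos_q0, ← kB_apply, ← mB_apply, ← e1]
  rw [e3, ← e2]
  ring
/-- nonlinear remainder -/
noncomputable def MB (v h : XB) : XB := h * sqB v - (sqB v - mB - cB * v)
theorem MB_contDiff : ContDiff ℝ ∞ (fun z : XB × XB => MB z.1 z.2) := by
  have h1 : ContDiff ℝ ∞ (fun z : XB × XB => sqB z.1) := sqB_contDiff.comp contDiff_fst
  exact (contDiff_snd.mul h1).sub ((h1.sub contDiff_const).sub (contDiff_const.mul contDiff_fst))
theorem MB_apply (v h : XB) (t : ℝ) : wt t * MB v h t =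
    h t * sin (q0 t + wt t * v t) - (sin (q0 t + wt t * v t) - sin (q0 t) - cos (q0 t) * (wt t * v t)) := by
  rw [MB]
  simp only [XB.sub_apply, XB.mul_apply]
  rw [← sqB_apply, ← mB_apply, cB_apply]; ring
/-- the action (up to a constant) -/
noncomputable def SB (h v Mt : XB) : ℝ :=
  (1/2 : ℝ) * ell (Mt * Gw Mt) + ell ((1 - h) * UB v - mB * v - (1/2 : ℝ) • (cB * (v * v)))

/-- evaluation as a CLM -/
noncomputable def evB (t : ℝ) : XB →L[ℝ] ℝ := BoundedContinuousFunction.evalCLM ℝ t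
theorem evB_apply (t : ℝ) (v : XB) : evB t v = v t := rfl

theorem hasDerivAt_eval {F : ℝ → XB} {F' : XB} {s : ℝ} (h : HasDerivAt F F' s) (t : ℝ) :
    HasDerivAt (fun s => F s t) (F' t) s := (evB t).hasFDerivAt.comp_hasDerivAt s h

theorem UB_hasDerivAt {v : ℝ → XB} {v' : XB} {s : ℝ} (hv : HasDerivAt v v' s) :
    HasDerivAt (fun s => UB (v s)) (sqB (v s) * v') s := by
  have hU : DifferentiableAt ℝ UB (v s) := UB_contDiff.differentiable (by simp) _
  have h := hU.hasFDerivAt.comp_hasDerivAt s hv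
  have : fderiv ℝ UB (v s) v' = sqB (v s) * v' := by
    ext t
    have h1 := (hasDerivAt_eval h t).const_mul (wt t ^ 2)
    have h2 : HasDerivAt (fun s => wt t ^ 2 * UB (v s) t) (wt t ^ 2 * (sqB (v s) * v') t) s := by
      simp_rw [UB_apply]
      have := ((((hasDerivAt_eval hv t).const_mul (wt t)).const_add (q0 t)).cos).const_sub 1
      refine this.congr_deriv ?_
      rw [← sqB_apply, XB.mul_apply]; ring
    exact mul_left_cancel₀ (pow_pos (wt_pos t) 2).ne' (h1.unique h2)
  rw [← this]; exact h

theorem variation (h : XB) {v Mt : ℝ → XB} {c : ℝ → ℝ} {v' Mt' Ps : XB} {c' al s0 : ℝ}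
    (hv : HasDerivAt v v' s0) (hM : HasDerivAt Mt Mt' s0) (hc : HasDerivAt c c' s0)
    (hMs : Mt s0 = MB (v s0) h + al • Ps)
    (heq : ∀ᶠ s in 𝓝 s0, v s = Gw (Mt s) + c s • kB) :
    HasDerivAt (fun s => SB h (v s) (Mt s)) (al * ell (v' * Ps) - c' * ell (Mt s0 * kB)) s0 := by
  have hG : HasDerivAt (fun s => Gw (Mt s)) (Gw Mt') s0 := Gw.hasFDerivAt.comp_hasDerivAt s0 hM
  have hv2 : v' = Gw Mt' + c' • kB :=
    hv.unique ((hG.add (hc.smul_const kB)).congr_of_eventuallyEq heq)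
  have d1 := (ell.hasFDerivAt.comp_hasDerivAt s0 (hM.mul hG)).const_mul (1/2 : ℝ)
  have d2 := ell.hasFDerivAt.comp_hasDerivAt s0
    ((((UB_hasDerivAt hv).const_mul (1 - h)).sub (hv.const_mul mB)).sub
      (((hv.mul hv).const_mul cB).const_smul (1/2:ℝ)))
  refine (d1.add d2).congr_deriv ?_
  have hGe : Gw Mt' = v' - c' • kB := by rw [hv2]; simp
  have e0 : (1/2 : ℝ) * ell (Mt' * Gw (Mt s0) + Mt s0 * Gw Mt') = ell (Mt s0 * v') - c' * ell (Mt s0 * kB) := by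
    rw [map_add, ell_symm Mt' (Mt s0), hGe, mul_sub, map_sub, mul_smul_comm, map_smul, smul_eq_mul]; ring
  rw [e0]
  have e1 : (1 - h) * (sqB (v s0) * v') - mB * v' - (1/2 : ℝ) • (cB * (v' * v s0 + v s0 * v'))
      = al • (v' * Ps) - Mt s0 * v' := by
    rw [hMs, MB]
    ext t
    simp only [XB.sub_apply, XB.add_apply, XB.mul_apply, XB.smul_apply, XB.one_apply]
    ring
  rw [e1, map_sub, map_smul, smul_eq_mul]
  ring



theorem inv_smooth {T : ℝ → XB} (hT : SmoothNear T 0) {c : ℝ} (hc : 0 < c) (h0 : ∀ t, c ≤ T 0 t) :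
    SmoothNear (fun s => Ring.inverse (T s)) 0 ∧ ∀ᶠ s in 𝓝 (0:ℝ), ∀ t, T s t * Ring.inverse (T s) t = 1 := by
  have hne : ∀ t, T 0 t ≠ 0 := fun t => (hc.trans_le (h0 t)).ne'
  let R : XB := mkB (fun t => (T 0 t)⁻¹) ((T 0).continuous.inv₀ hne) c⁻¹ fun t => by
    rw [abs_of_pos (inv_pos.2 (hc.trans_le (h0 t)))]
    exact inv_anti₀ hc (h0 t)
  have hu : IsUnit (T 0) := by
    refine IsUnit.of_mul_eq_one R ?_
    ext t
    rw [XB.mul_apply, mkB_apply, XB.one_apply]; exact mul_inv_cancel₀ (hne t)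
  have hev : ∀ᶠ y in 𝓝 (T 0), IsUnit y := Units.isOpen.mem_nhds hu
  have hI : SmoothNear (Ring.inverse : XB → XB) (T 0) := by
    filter_upwards [hev] with y hy
    obtain ⟨u, rfl⟩ := hy
    exact contDiffAt_ringInverse ℝ u
  refine ⟨hI.comp hT, ?_⟩
  filter_upwards [hT.cont.eventually hev] with s hs t
  rw [← XB.mul_apply, Ring.mul_inverse_cancel _ hs, XB.one_apply]

/-- `cosh (t-θ) / cosh t` -/
noncomputable def TB (s : ℝ) : XB := cosh s • (1 : XB) - sinh s • tB
theorem TB_smooth : ContDiff ℝ ∞ TB :=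
  (Real.contDiff_cosh.smul contDiff_const).sub (Real.contDiff_sinh.smul contDiff_const)
theorem TB_zero : TB 0 = 1 := by simp [TB]
theorem TB_apply (s t : ℝ) : cosh t * TB s t = cosh (t - s) := by
  rw [TB, XB.sub_apply, XB.smul_apply, XB.smul_apply, XB.one_apply, tB_apply, cosh_sub]
  have := tanh_cosh t
  have h2 : sinh t = tanh t * cosh t := by rw [tanh_eq_sinh_div_cosh, div_mul_cancel₀ _ (cosh_pos t).ne']
  rw [h2]; ring

/-- `psi0 (t-θ) / w t` -/
noncomputable def PsiB (s : ℝ) : XB := kB * (TB s * TB s) * (Ring.inverse (sB + TB s)) ^ 3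
theorem PsiB_aux : SmoothNear (fun s => Ring.inverse (sB + TB s)) 0 ∧
    ∀ᶠ s in 𝓝 (0:ℝ), ∀ t, (sB + TB s) t * Ring.inverse (sB + TB s) t = 1 := inv_smooth (T := fun s => sB + TB s) (c := 1)
  ((SmoothNear.const _ _).add (TB_smooth.smoothNear 0)) one_pos
  (fun t => by simp only [TB_zero, XB.add_apply, XB.one_apply, sB_apply]; linarith [sch_pos t])
theorem PsiB_smooth : SmoothNear PsiB 0 :=
  ((SmoothNear.const _ _).mul ((TB_smooth.smoothNear 0).mul (TB_smooth.smoothNear 0))).mul (PsiB_aux.1.pow 3)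
theorem PsiB_apply : ∀ᶠ s in 𝓝 (0:ℝ), ∀ t, wt t * PsiB s t = psi0 (t - s) := by
  filter_upwards [PsiB_aux.2] with s hs t
  have h1 := hs t
  rw [XB.add_apply, sB_apply] at h1
  have h3 := TB_apply s t
  have hc := cosh_pos t
  have hp := cosh_pos (t - s)
  have h4 := sch_mul_cosh t
  have e : PsiB s t = kB t * (TB s t * TB s t) * (Ring.inverse (sB + TB s) t) ^ 3 := rfl
  rw [e, psi0, ← mul_assoc, ← mul_assoc, kB_apply, eq_div_iff (by positivity), ← h3]
  generalize Ring.inverse (sB + TB s) t = I at *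
  generalize TB s t = T at *
  have h5 : 1 + cosh t * T = cosh t * (sch t + T) := by linear_combination - h4
  rw [h5]
  linear_combination (sch t * cosh t ^ 3 * T ^ 2) * (((sch t + T) * I) ^ 2 + (sch t + T) * I + 1) * h1 + cosh t ^ 2 * T ^ 2 * h4

noncomputable def NA : XB → XB := (nem_real arctan contDiff_arctan).choose
theorem NA_contDiff : ContDiff ℝ ∞ NA := (nem_real arctan contDiff_arctan).choose_spec.1
theorem NA_apply (v : XB) (t : ℝ) : NA v t = arctan (v t) := (nem_real arctan contDiff_arctan).choose_spec.2 v t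

/-- `q0 (t+θ) - q0 t` -/
noncomputable def YB (s : ℝ) : XB := (4:ℝ) • NA (sinh (s/2) • (sB * Ring.inverse (TB (-(s/2)))))
theorem YB_aux : SmoothNear (fun s : ℝ => Ring.inverse (TB (-(s/2)))) 0 ∧
    ∀ᶠ s : ℝ in 𝓝 (0:ℝ), ∀ t, TB (-(s/2)) t * Ring.inverse (TB (-(s/2))) t = 1 := inv_smooth (T := fun s => TB (-(s/2))) (c := 1)
  ((TB_smooth.comp (g := TB) (f := fun s : ℝ => -(s/2)) (by fun_prop)).smoothNear 0) one_pos
  (fun t => by simp [TB_zero])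
theorem YB_smooth : SmoothNear YB 0 := by
  have h1 : SmoothNear (fun s : ℝ => sinh (s/2)) 0 :=
    ContDiff.smoothNear (Real.contDiff_sinh.comp (by fun_prop)) 0
  exact (SmoothNear.const (4:ℝ) _).smul ((NA_contDiff.smoothNear _).comp
    (h1.smul ((SmoothNear.const sB _).mul YB_aux.1)))
theorem YB_apply : ∀ᶠ s in 𝓝 (0:ℝ), ∀ t, YB s t = q0 (t + s) - q0 t := by
  filter_upwards [YB_aux.2] with s hs t
  have h1 := hs t
  have h3 := TB_apply (-(s/2)) t
  have e : YB s t = 4 * NA (sinh (s/2) • (sB * Ring.inverse (TB (-(s/2))))) t := rfl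
  rw [e, NA_apply, XB.smul_apply, XB.mul_apply, sB_apply, q0, q0, ← mul_sub, sub_eq_add_neg, ← arctan_neg,
    arctan_add]
  · congr 2
    have h4 := sch_mul_cosh t
    generalize Ring.inverse (TB (-(s/2))) t = I at *
    generalize TB (-(s/2)) t = T at *
    have hc := cosh_pos t
    have hp := cosh_pos (t - -(s/2))
    have e5 : sch t * I = (cosh (t - -(s/2)))⁻¹ := by
      refine eq_inv_of_mul_eq_one_left ?_
      rw [← h3]
      linear_combination (sch t * cosh t) * h1 + h4
    rw [e5, cosh_eq, sinh_eq]
    have e6 : exp (t + s) = exp t * exp (s/2) * exp (s/2) := by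
      rw [← exp_add, ← exp_add]; congr 1; ring
    have e7 : exp (t - -(s/2)) = exp t * exp (s/2) := by
      rw [← exp_add]; congr 1; ring
    have e8 : exp (-(t - -(s/2))) = (exp t * exp (s/2))⁻¹ := by rw [exp_neg, e7]
    rw [e6, e7, e8, exp_neg]
    have p1 := exp_pos t
    have p2 := exp_pos (s/2)
    generalize exp t = x at *
    generalize exp (s/2) = y at *
    have q1 : 1 - x * y * y * -x = 1 + x ^ 2 * y ^ 2 := by ring
    rw [q1]
    have q2 : 0 < 1 + x ^ 2 * y ^ 2 := by positivity
    field_simp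
    ring
  · have := exp_pos (t + s)
    have := exp_pos t
    nlinarith [mul_pos (exp_pos (t+s)) (exp_pos t)]

/-- constraint offset -/
noncomputable def kap (s : ℝ) : ℝ := ell (YB s * pB)
theorem kap_smooth : SmoothNear kap 0 := (YB_smooth.mul (SmoothNear.const pB _)).clm ell
theorem kap_zero : kap 0 = 0 := by
  have h := YB_apply.self_of_nhds
  have : YB 0 = 0 := by ext t; rw [h t]; simp
  rw [kap, this, zero_mul, map_zero]
theorem kap_apply : ∀ᶠ s in 𝓝 (0:ℝ), kap s = ∫ t, (q0 t - q0 (t - s)) * psi0 (t - s) := by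
  filter_upwards [YB_apply] with s hs
  rw [kap, ell_apply, ← integral_sub_right_eq_self (fun t => wt t ^ 2 * (YB s * pB) t) s]
  congr 1; ext t
  rw [XB.mul_apply, hs, ← pB_apply]
  simp only [sub_add_cancel]; ring
noncomputable def a0 : ℝ := ell (PsiB 0 * kB)
theorem PsiB_zero_apply (t : ℝ) : wt t * PsiB 0 t = psi0 t := by
  simpa using PsiB_apply.self_of_nhds t
theorem a0_eq : a0 = ∫ t, psi0 t * sch t := by
  rw [a0, ell_apply]; congr 1; ext t
  rw [XB.mul_apply, ← kB_apply, ← PsiB_zero_apply]; ring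
theorem a0_pos : 0 < a0 := by
  have hi : Integrable (fun t => psi0 t * sch t) := by
    refine (wt2_integrable (PsiB 0 * kB)).congr (Eventually.of_forall fun t => ?_)
    simp only [XB.mul_apply]
    rw [← kB_apply, ← PsiB_zero_apply]; ring
  rw [a0_eq]
  refine (integral_pos_iff_support_of_nonneg (fun t => (mul_pos (psi0_pos t) (sch_pos t)).le) hi).2 ?_
  have : Function.support (fun t => psi0 t * sch t) = Set.univ := by
    ext t; simp [(psi0_pos t).ne', (sch_pos t).ne']
  rw [this]; simp
theorem kap_deriv : HasDerivAt kap (2 * a0) 0 := by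
  have hY : HasDerivAt YB (deriv YB 0) 0 := YB_smooth.diff.hasDerivAt
  have e : deriv YB 0 = (2:ℝ) • sB := by
    ext t
    have h1 := hasDerivAt_eval hY t
    have h2 : HasDerivAt (fun s => YB s t) (2 * sch t) 0 := by
      have hq : HasDerivAt q0 (2 * sch t) (t + 0) := by rw [add_zero]; exact q0_hasDerivAt t
      have := (hq.comp_const_add t 0).sub_const (q0 t)
      refine this.congr_of_eventuallyEq ?_
      filter_upwards [YB_apply] with s hs using hs t
    exact h1.unique h2
  have h := ell.hasFDerivAt.comp_hasDerivAt (0:ℝ) (hY.mul_const pB)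
  refine HasDerivAt.congr_deriv (f := kap) h ?_
  rw [e, a0_eq, ell_apply, ← integral_const_mul]
  congr 1; ext t
  rw [XB.mul_apply, XB.smul_apply, sB_apply, ← pB_apply]; ring



/-- right hand side with the multiplier -/
noncomputable def MT (v h : XB) (al th : ℝ) : XB := MB v h + al • PsiB th

theorem MB_zero : MB 0 0 = 0 := by
  ext t
  refine mul_left_cancel₀ (wt_pos t).ne' ?_
  rw [MB_apply, XB.zero_apply]; simp
theorem MT_zero : MT 0 0 0 0 = 0 := by rw [MT, MB_zero]; simp
theorem MT_al_zero (v h : XB) (th : ℝ) : MT v h 0 th = MB v h := by rw [MT]; simp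

theorem MB_fderiv : HasFDerivAt (fun v : XB => MB v 0) (0 : XB →L[ℝ] XB) 0 := by
  have hd : DifferentiableAt ℝ (fun v : XB => MB v 0) 0 := by
    have : ContDiff ℝ ∞ (fun v : XB => MB v 0) :=
      MB_contDiff.comp (g := fun z : XB × XB => MB z.1 z.2) (f := fun v => (v, 0)) (contDiff_id.prodMk contDiff_const)
    exact this.differentiable (by simp) _
  have h := hd.hasFDerivAt
  have e : fderiv ℝ (fun v : XB => MB v 0) 0 = 0 := by
    ext w t
    have hl : HasDerivAt (fun s : ℝ => s • w) w 0 := by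
      simpa using (hasDerivAt_id (0:ℝ)).smul_const w
    have h0 : HasFDerivAt (fun v : XB => MB v 0) (fderiv ℝ (fun v : XB => MB v 0) 0) ((0:ℝ) • w) := by
      rw [zero_smul]; exact h
    have h1 := (hasDerivAt_eval (h0.comp_hasDerivAt (0:ℝ) hl) t).const_mul (wt t)
    have h2 : HasDerivAt (fun s : ℝ => wt t * MB (s • w) 0 t) 0 0 := by
      have hh : HasDerivAt (fun s : ℝ => wt t * (s • w) t) (wt t * w t) 0 := (hasDerivAt_eval hl t).const_mul (wt t)
      have := ((((hh.const_add (q0 t)).sin).sub_const (sin (q0 t))).sub (hh.const_mul (cos (q0 t)))).neg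
      have h3 : HasDerivAt (fun s : ℝ => wt t * MB (s • w) 0 t)
        (-(cos (q0 t + wt t * ((0:ℝ) • w) t) * (wt t * w t) - cos (q0 t) * (wt t * w t))) 0 := by
        refine this.congr_of_eventuallyEq (Eventually.of_forall fun s => ?_)
        simp only [MB_apply, XB.zero_apply, Pi.neg_apply, Pi.sub_apply]
        ring
      refine h3.congr_deriv ?_
      rw [XB.smul_apply]; simp
    have := h1.unique h2
    exact mul_left_cancel₀ (wt_pos t).ne' (this.trans (by simp))
  rw [e] at h; exact h

section
variable {P : Type*} [NormedAddCommGroup P] [NormedSpace ℝ P]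
theorem MT_smooth {v h : P → XB} {al th : P → ℝ} {p : P} (hv : SmoothNear v p) (hh : SmoothNear h p)
    (ha : SmoothNear al p) (ht : SmoothNear th p) (h0 : th p = 0) :
    SmoothNear (fun p => MT (v p) (h p) (al p) (th p)) p :=
  ((MB_contDiff.smoothNear _).comp' (hv.prodMk hh) rfl).add (ha.smul (PsiB_smooth.comp' ht h0))

theorem SB_smooth {v h M : P → XB} {p : P} (hh : SmoothNear h p) (hv : SmoothNear v p) (hM : SmoothNear M p) :
    SmoothNear (fun p => SB (h p) (v p) (M p)) p := by
  refine SmoothNear.add ?_ ?_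
  · exact (SmoothNear.const _ _).mul ((hM.mul (hM.clm Gw)).clm ell)
  · refine SmoothNear.clm ell ?_
    refine SmoothNear.sub (SmoothNear.sub ?_ ?_) ?_
    · exact ((SmoothNear.const _ _).sub hh).mul ((UB_contDiff.smoothNear _).comp' hv rfl)
    · exact (SmoothNear.const _ _).mul hv
    · exact (SmoothNear.const (1/2:ℝ) _).smul ((SmoothNear.const cB _).mul (hv.mul hv))

theorem MT_fderiv (v : P →L[ℝ] XB) (al th : P →L[ℝ] ℝ) :
    HasFDerivAt (fun p => MT (v p) 0 (al p) (th p)) (al.smulRight (PsiB 0)) 0 := by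
  have h1 : HasFDerivAt (fun v : XB => MB v 0) (0 : XB →L[ℝ] XB) (v 0) := by rw [map_zero]; exact MB_fderiv
  have h2 := h1.comp (0:P) v.hasFDerivAt
  have h3 : HasFDerivAt PsiB (fderiv ℝ PsiB 0) (th 0) := by rw [map_zero]; exact PsiB_smooth.diff.hasFDerivAt
  have h4 := (al.hasFDerivAt (x := (0:P))).smul (h3.comp (0:P) th.hasFDerivAt)
  refine (h2.add h4).congr_fderiv ?_
  ext1 x
  simp
end

theorem V_exists : ∃ V : (XB × ℝ) × ℝ → XB, V 0 = 0 ∧ SmoothNear V 0 ∧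
    (∀ᶠ p in 𝓝 (0 : (XB × ℝ) × ℝ), V p = Gw (MT (V p) p.1.1 p.2 p.1.2)) ∧
    (∀ᶠ z in 𝓝 ((0, 0) : ((XB × ℝ) × ℝ) × XB), z.2 = Gw (MT z.2 z.1.1.1 z.1.2 z.1.1.2) → z.2 = V z.1) := by
  let F : ((XB × ℝ) × ℝ) × XB → XB := fun z => z.2 - Gw (MT z.2 z.1.1.1 z.1.2 z.1.1.2)
  have hid := SmoothNear.id ((0,0) : ((XB × ℝ) × ℝ) × XB)
  have hF : SmoothNear F (0, 0) :=
    hid.snd.sub ((MT_smooth hid.snd hid.fst.fst.fst hid.fst.snd hid.fst.fst.snd rfl).clm Gw)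
  have h0 : F (0, 0) = 0 := by
    simp only [F, Prod.fst_zero, Prod.snd_zero, MT_zero, map_zero, sub_zero]
  have hD : HasFDerivAt (fun y => F (0, y)) ((ContinuousLinearEquiv.refl ℝ XB : XB ≃L[ℝ] XB) : XB →L[ℝ] XB) 0 := by
    have h1 := MT_fderiv (ContinuousLinearMap.id ℝ XB) (0 : XB →L[ℝ] ℝ) 0
    have h2 := (hasFDerivAt_id (𝕜 := ℝ) (0:XB)).sub (Gw.hasFDerivAt.comp (0:XB) h1)
    refine HasFDerivAt.congr_fderiv (f := fun y => F (0, y)) h2 ?_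
    ext1 x; simp
  obtain ⟨V, a, b, c, d⟩ := ift_smooth F 0 0 hF h0 _ hD
  refine ⟨V, a, b, ?_, ?_⟩
  · filter_upwards [c] with p hp using sub_eq_zero.1 hp
  · filter_upwards [d] with z hz h using hz (sub_eq_zero.2 h)

/-- the Q equations -/
def QE (v h : XB) (al th c : ℝ) : Prop :=
  v = Gw (MT v h al th) + c • kB ∧ ell (MT v h al th * kB) = 0 ∧ ell (v * PsiB th) + kap th = 0

theorem Q_exists (ec et : ℝ) (hne : ec + 2 * et ≠ 0) :
    ∃ φ : XB × ℝ → XB × ℝ × ℝ, φ 0 = 0 ∧ SmoothNear φ 0 ∧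
    (∀ᶠ p in 𝓝 (0 : XB × ℝ), QE (φ p).1 p.1 (φ p).2.1 (p.2 + et * (φ p).2.2) (ec * (φ p).2.2)) ∧
    (∀ᶠ z in 𝓝 ((0, 0) : (XB × ℝ) × (XB × ℝ × ℝ)),
      QE z.2.1 z.1.1 z.2.2.1 (z.1.2 + et * z.2.2.2) (ec * z.2.2.2) → z.2 = φ z.1) := by
  let F : (XB × ℝ) × (XB × ℝ × ℝ) → XB × ℝ × ℝ := fun z =>
    (z.2.1 - (Gw (MT z.2.1 z.1.1 z.2.2.1 (z.1.2 + et * z.2.2.2)) + (ec * z.2.2.2) • kB),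
      ell (MT z.2.1 z.1.1 z.2.2.1 (z.1.2 + et * z.2.2.2) * kB),
      ell (z.2.1 * PsiB (z.1.2 + et * z.2.2.2)) + kap (z.1.2 + et * z.2.2.2))
  have hFQ : ∀ z, F z = 0 ↔ QE z.2.1 z.1.1 z.2.2.1 (z.1.2 + et * z.2.2.2) (ec * z.2.2.2) := by
    intro z
    simp only [F, QE, Prod.mk_eq_zero, sub_eq_zero]
  have hid := SmoothNear.id ((0,0) : (XB × ℝ) × (XB × ℝ × ℝ))
  have hth : SmoothNear (fun z : (XB × ℝ) × (XB × ℝ × ℝ) => z.1.2 + et * z.2.2.2) (0,0) :=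
    hid.fst.snd.add ((SmoothNear.const et _).mul hid.snd.snd.snd)
  have hth0 : (fun z : (XB × ℝ) × (XB × ℝ × ℝ) => z.1.2 + et * z.2.2.2) (0,0) = 0 := by simp
  have hMT := MT_smooth hid.snd.fst hid.fst.fst hid.snd.snd.fst hth hth0
  have hF : SmoothNear F (0, 0) := by
    refine SmoothNear.prodMk ?_ (SmoothNear.prodMk ?_ ?_)
    · exact hid.snd.fst.sub ((hMT.clm Gw).add (((SmoothNear.const ec _).mul hid.snd.snd.snd).smul (SmoothNear.const kB _)))
    · exact (hMT.mul (SmoothNear.const kB _)).clm ell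
    · exact ((hid.snd.fst.mul (PsiB_smooth.comp' hth hth0)).clm ell).add (kap_smooth.comp' hth hth0)
  have h0 : F (0, 0) = 0 := by
    rw [hFQ]
    simp [QE, MT_zero, kap_zero]
  let v : XB × ℝ × ℝ →L[ℝ] XB := ContinuousLinearMap.fst ℝ XB (ℝ × ℝ)
  let al : XB × ℝ × ℝ →L[ℝ] ℝ := (ContinuousLinearMap.fst ℝ ℝ ℝ).comp (ContinuousLinearMap.snd ℝ XB (ℝ × ℝ))
  let r : XB × ℝ × ℝ →L[ℝ] ℝ := (ContinuousLinearMap.snd ℝ ℝ ℝ).comp (ContinuousLinearMap.snd ℝ XB (ℝ × ℝ))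
  let mr (b : XB) : XB →L[ℝ] XB := (ContinuousLinearMap.mul ℝ XB).flip b
  let D1 : XB × ℝ × ℝ →L[ℝ] XB := v - (Gw.comp (al.smulRight (PsiB 0)) + (ec • r).smulRight kB)
  let D2 : XB × ℝ × ℝ →L[ℝ] ℝ := a0 • al
  let D3 : XB × ℝ × ℝ →L[ℝ] ℝ := ell.comp ((mr (PsiB 0)).comp v) + (2 * a0 * et) • r
  let DL : XB × ℝ × ℝ →L[ℝ] XB × ℝ × ℝ := D1.prod (D2.prod D3)
  have hDa : ∀ x, DL x = (x.1 - (Gw (x.2.1 • PsiB 0) + (ec * x.2.2) • kB), a0 * x.2.1,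
      ell (x.1 * PsiB 0) + 2 * a0 * et * x.2.2) := fun x => rfl
  have ha := a0_pos.ne'
  have hak : ell (kB * PsiB 0) = a0 := by rw [mul_comm]; rfl
  have hinj : DL.ker = ⊥ := by
    refine (LinearMap.ker_eq_bot'.2 ?_)
    intro x hx
    have hx' : DL x = 0 := hx
    rw [hDa] at hx'
    obtain ⟨x1, x2, x3⟩ := x
    simp only [Prod.mk_eq_zero] at hx' ⊢
    obtain ⟨e1, e2, e3⟩ := hx'
    have f2 : x2 = 0 := (mul_eq_zero.1 e2).resolve_left ha
    have f1 : x1 = (ec * x3) • kB := by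
      rw [f2] at e1; simpa [sub_eq_zero] using e1
    have f3 : x3 = 0 := by
      rw [f1, smul_mul_assoc, map_smul, hak, smul_eq_mul] at e3
      have : (a0 * (ec + 2 * et)) * x3 = 0 := by linear_combination e3
      exact (mul_eq_zero.1 this).resolve_left (mul_ne_zero ha hne)
    exact ⟨by rw [f1, f3]; simp, f2, f3⟩
  have hsur : DL.range = ⊤ := by
    refine LinearMap.range_eq_top.2 ?_
    rintro ⟨z1, z2, z3⟩
    let w : XB := z1 + Gw ((z2 / a0) • PsiB 0)
    let r3 : ℝ := (z3 - ell (w * PsiB 0)) / (a0 * (ec + 2 * et))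
    refine ⟨(w + (ec * r3) • kB, z2 / a0, r3), ?_⟩
    change DL _ = _
    rw [hDa]
    simp only [Prod.mk.injEq]
    refine ⟨?_, ?_, ?_⟩
    · simp only [w]; abel
    · field_simp
    · rw [add_mul, map_add, smul_mul_assoc, map_smul, hak, smul_eq_mul]
      have : r3 * (a0 * (ec + 2 * et)) = z3 - ell (w * PsiB 0) := div_mul_cancel₀ _ (mul_ne_zero ha hne)
      linear_combination this
  have hD : HasFDerivAt (fun y => F (0, y)) ((ContinuousLinearEquiv.ofBijective DL hinj hsur : (XB × ℝ × ℝ) ≃L[ℝ] (XB × ℝ × ℝ)) : (XB × ℝ × ℝ) →L[ℝ] (XB × ℝ × ℝ)) 0 := by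
    rw [ContinuousLinearEquiv.coe_ofBijective]
    have hm := MT_fderiv v al (et • r)
    have ht : HasFDerivAt (fun y : XB × ℝ × ℝ => et * y.2.2) (et • r) 0 := (et • r).hasFDerivAt
    have i1 : HasFDerivAt (fun y : XB × ℝ × ℝ => y.1 - (Gw (MT y.1 0 y.2.1 (et * y.2.2)) + (ec * y.2.2) • kB)) D1 0 :=
      v.hasFDerivAt.sub ((Gw.hasFDerivAt.comp (0 : XB × ℝ × ℝ) hm).add ((ec • r).smulRight kB).hasFDerivAt)
    have i2 : HasFDerivAt (fun y : XB × ℝ × ℝ => ell (MT y.1 0 y.2.1 (et * y.2.2) * kB)) D2 0 := by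
      refine HasFDerivAt.congr_fderiv ((ell.comp (mr kB)).hasFDerivAt.comp (0 : XB × ℝ × ℝ) hm) ?_
      refine ContinuousLinearMap.ext fun x => ?_
      change ell ((al x • PsiB 0) * kB) = a0 * al x
      rw [smul_mul_assoc, map_smul, smul_eq_mul, mul_comm]; rfl
    have i3 : HasFDerivAt (fun y : XB × ℝ × ℝ => ell (y.1 * PsiB (et * y.2.2)) + kap (et * y.2.2)) D3 0 := by
      have hz : (et * (0 : XB × ℝ × ℝ).2.2) = 0 := by simp
      have j1 : HasFDerivAt (fun y : XB × ℝ × ℝ => PsiB (et * y.2.2)) _ 0 :=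
        HasFDerivAt.comp (0 : XB × ℝ × ℝ) (g := PsiB) (by rw [hz]; exact PsiB_smooth.diff.hasFDerivAt) ht
      have j2 : HasFDerivAt (fun y : XB × ℝ × ℝ => kap (et * y.2.2)) _ 0 :=
        HasFDerivAt.comp (0 : XB × ℝ × ℝ) (g := kap) (by rw [hz]; exact kap_deriv.hasFDerivAt) ht
      have j3 := (ell.hasFDerivAt.comp (0 : XB × ℝ × ℝ) ((v.hasFDerivAt (x := 0)).mul j1)).add j2
      refine HasFDerivAt.congr_fderiv j3 ?_
      refine ContinuousLinearMap.ext fun x => ?_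
      simp [v, r, D3, mr, mul_comm]
      ring
    have := i1.prodMk (i2.prodMk i3)
    refine this.congr_of_eventuallyEq (Eventually.of_forall fun y => ?_)
    simp only [F, Prod.fst_zero, Prod.snd_zero, zero_add]
  obtain ⟨V, a, b, c, d⟩ := ift_smooth F 0 0 hF h0 _ hD
  refine ⟨V, a, b, ?_, ?_⟩
  · filter_upwards [c] with p hp using (hFQ _).1 hp
  · filter_upwards [d] with z hz h using hz ((hFQ _).2 h)



section
variable {P E : Type*} [NormedAddCommGroup P] [NormedSpace ℝ P] [NormedAddCommGroup E] [NormedSpace ℝ E]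
theorem part_hasDerivAt {f : P × ℝ → E} {p : P × ℝ} (h : DifferentiableAt ℝ f p) :
    HasDerivAt (fun s => f (p.1, s)) (fderiv ℝ f p (0, 1)) p.2 := by
  have h1 : HasDerivAt (fun s : ℝ => (p.1, s)) ((0, 1) : P × ℝ) p.2 :=
    (hasDerivAt_const p.2 p.1).prodMk (hasDerivAt_id p.2)
  exact HasFDerivAt.comp_hasDerivAt (l := f) p.2 h.hasFDerivAt h1
theorem part_eventually {Q : P × ℝ → Prop} {p : P × ℝ} (h : ∀ᶠ q in 𝓝 p, Q q) :
    ∀ᶠ s in 𝓝 p.2, Q (p.1, s) := by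
  have h1 : ContinuousAt (fun s : ℝ => (p.1, s)) p.2 := by fun_prop
  exact h1.eventually (p := Q) h
end

theorem Qfam : ∃ (vh : XB × ℝ → XB) (ah ch e : XB × ℝ → ℝ) (R : (XB × ℝ) × ℝ → ℝ),
    (vh 0 = 0 ∧ ah 0 = 0 ∧ ch 0 = 0 ∧ e 0 = - (2 * a0) ∧ R (0, 0) = 0) ∧
    (SmoothNear vh 0 ∧ SmoothNear ah 0 ∧ SmoothNear ch 0 ∧ SmoothNear e 0 ∧ SmoothNear R (0, 0)) ∧
    (∀ᶠ p in 𝓝 (0 : XB × ℝ), QE (vh p) p.1 (ah p) p.2 (ch p)) ∧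
    (∀ᶠ z in 𝓝 ((0, 0) : (XB × ℝ) × (XB × ℝ × ℝ)),
      QE z.2.1 z.1.1 z.2.2.1 z.1.2 z.2.2.2 → z.2 = (vh z.1, ah z.1, ch z.1)) ∧
    (∀ᶠ z in 𝓝 ((0, 0) : (XB × ℝ) × ℝ),
      SB z.1.1 (vh (z.1.1, z.1.2 + z.2)) (MT (vh (z.1.1, z.1.2 + z.2)) z.1.1 (ah (z.1.1, z.1.2 + z.2)) (z.1.2 + z.2)) =
      SB z.1.1 (vh z.1) (MT (vh z.1) z.1.1 (ah z.1) z.1.2) + z.2 * (ah z.1 * e z.1) + z.2 ^ 2 * R z) := by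
  obtain ⟨φ, φ0, φs, φe, φu⟩ := Q_exists 1 0 (by norm_num)
  simp only [zero_mul, add_zero, one_mul] at φe φu
  let vh : XB × ℝ → XB := fun p => (φ p).1
  let ah : XB × ℝ → ℝ := fun p => (φ p).2.1
  let ch : XB × ℝ → ℝ := fun p => (φ p).2.2
  have vh0 : vh 0 = 0 := by simp [vh, φ0]
  have ah0 : ah 0 = 0 := by simp [ah, φ0]
  have ch0 : ch 0 = 0 := by simp [ch, φ0]
  have vs : SmoothNear vh 0 := φs.fst
  have as : SmoothNear ah 0 := φs.snd.fst
  have cs : SmoothNear ch 0 := φs.snd.snd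
  have qe : ∀ᶠ p in 𝓝 (0 : XB × ℝ), QE (vh p) p.1 (ah p) p.2 (ch p) := φe
  have hid := SmoothNear.id (0 : XB × ℝ)
  let Mh : XB × ℝ → XB := fun p => MT (vh p) p.1 (ah p) p.2
  have Ms : SmoothNear Mh 0 := MT_smooth vs hid.fst as hid.snd rfl
  let e : XB × ℝ → ℝ := fun p => ell (fderiv ℝ vh p (0, 1) * PsiB p.2)
  have es : SmoothNear e 0 := by
    have h1 : SmoothNear (fun p => fderiv ℝ vh p (0, 1)) 0 :=
      vs.fderiv.clm (ContinuousLinearMap.apply ℝ XB ((0, 1) : XB × ℝ))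
    exact (h1.mul (PsiB_smooth.comp' hid.snd rfl)).clm ell
  have hv0 : HasDerivAt (fun s => vh (0, s)) (fderiv ℝ vh 0 (0, 1)) 0 := part_hasDerivAt vs.diff
  have ha0 : HasDerivAt (fun s => ah (0, s)) (fderiv ℝ ah 0 (0, 1)) 0 := part_hasDerivAt as.diff
  have hP0 : HasDerivAt PsiB (deriv PsiB 0) 0 := PsiB_smooth.diff.hasDerivAt
  have qe0 : ∀ᶠ s in 𝓝 (0:ℝ), QE (vh (0, s)) 0 (ah (0, s)) s (ch (0, s)) := part_eventually (p := (0 : XB × ℝ)) qe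
  have vh00 : vh (0, 0) = 0 := vh0
  have ah00 : ah (0, 0) = 0 := ah0
  have e0 : e 0 = -(2 * a0) := by
    have h1 := (ell.hasFDerivAt.comp_hasDerivAt (0:ℝ) (hv0.mul hP0)).add kap_deriv
    have h2 : HasDerivAt (fun _ : ℝ => (0:ℝ)) _ 0 := h1.congr_of_eventuallyEq (by
      filter_upwards [qe0] with s hs
      exact hs.2.2.symm)
    have h3 := h2.unique (hasDerivAt_const (0:ℝ) (0:ℝ))
    rw [vh00, zero_mul, add_zero] at h3
    have : e 0 = ell (fderiv ℝ vh 0 (0, 1) * PsiB 0) := rfl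
    rw [this]; linarith
  have ad0 : fderiv ℝ ah 0 (0, 1) = 0 := by
    have hM1 : HasFDerivAt (fun v : XB => MB v 0) (0 : XB →L[ℝ] XB) (vh (0, (0:ℝ))) := by rw [vh00]; exact MB_fderiv
    have h1 := (hM1.comp_hasDerivAt (0:ℝ) hv0).add (ha0.smul hP0)
    have h2 := ell.hasFDerivAt.comp_hasDerivAt (0:ℝ) (h1.mul_const kB)
    have h3 : HasDerivAt (fun _ : ℝ => (0:ℝ)) _ 0 := h2.congr_of_eventuallyEq (by
      filter_upwards [qe0] with s hs
      exact hs.2.1.symm)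
    have h4 := h3.unique (hasDerivAt_const (0:ℝ) (0:ℝ))
    rw [ah00, zero_smul, zero_add, ContinuousLinearMap.zero_apply, zero_add, smul_mul_assoc, map_smul, smul_eq_mul] at h4
    exact (mul_eq_zero.1 h4).resolve_right a0_pos.ne'
  let SQ : XB × ℝ → ℝ := fun p => SB p.1 (vh p) (Mh p)
  have Ss : SmoothNear SQ 0 := SB_smooth hid.fst vs Ms
  have SQd : ∀ᶠ p in 𝓝 (0 : XB × ℝ), HasDerivAt (fun s => SQ (p.1, s)) (ah p * e p) p.2 := by
    filter_upwards [eventually_eventually_nhds.2 qe, vs, Ms, cs] with p hp1 hp2 hp3 hp4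
    have d1 := part_hasDerivAt (hp2.differentiableAt (by simp))
    have d2 := part_hasDerivAt (hp3.differentiableAt (by simp))
    have d3 := part_hasDerivAt (hp4.differentiableAt (by simp))
    have := variation p.1 (al := ah p) (Ps := PsiB p.2) d1 d2 d3 rfl (by
      filter_upwards [part_eventually hp1] with s hs using hs.1)
    refine HasDerivAt.congr_deriv (f := fun s => SQ (p.1, s)) this ?_
    have hz : ell (Mh p * kB) = 0 := hp1.self_of_nhds.2.1
    change _ - _ * ell (Mh p * kB) = _
    rw [hz, mul_zero, sub_zero]
  let T : (XB × ℝ) × ℝ → ℝ := fun z => SQ (z.1.1, z.1.2 + z.2)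
  have hid2 := SmoothNear.id ((0, 0) : (XB × ℝ) × ℝ)
  have Ts : SmoothNear T (0, 0) := Ss.comp' (hid2.fst.fst.prodMk (hid2.fst.snd.add hid2.snd)) (by simp)
  obtain ⟨H2, H2s, H2e, H2d⟩ := hadamard_smooth T 0 Ts
  obtain ⟨R, Rs, Re, -⟩ := hadamard_smooth H2 0 H2s
  have H20 : ∀ᶠ p in 𝓝 (0 : XB × ℝ), H2 (p, 0) = ah p * e p := by
    filter_upwards [H2d, SQd] with p h1 h2
    have h3 : HasDerivAt (fun s => SQ (p.1, s)) (ah p * e p) (p.2 + 0) := by rw [add_zero]; exact h2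
    exact h1.unique (h3.comp_const_add p.2 0)
  have tend : Tendsto (fun z : (XB × ℝ) × ℝ => z.1) (𝓝 (0,0)) (𝓝 0) := continuous_fst.tendsto' _ _ rfl
  have Tay : ∀ᶠ z in 𝓝 ((0, 0) : (XB × ℝ) × ℝ),
      SQ (z.1.1, z.1.2 + z.2) = SQ z.1 + z.2 * (ah z.1 * e z.1) + z.2 ^ 2 * R z := by
    filter_upwards [H2e, Re, tend.eventually H20] with z h1 h2 h3
    have h4 : T (z.1, 0) = SQ z.1 := by simp [T]
    change T z = _
    rw [h1, h2, h3, h4]; ring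
  have R0 : R (0, 0) = 0 := by
    let ρ : ℝ → ℝ := fun s => R (0, s)
    have ρs : SmoothNear ρ 0 := Rs.comp' ((SmoothNear.const (0 : XB × ℝ) (0:ℝ)).prodMk (SmoothNear.id 0)) rfl
    have ρd : ∀ᶠ s in 𝓝 (0:ℝ), HasDerivAt ρ (fderiv ℝ ρ s 1) s := by
      filter_upwards [ρs] with s hs
      exact (hs.differentiableAt (by simp)).hasFDerivAt.hasDerivAt
    have k1 : ∀ᶠ s in 𝓝 (0:ℝ), SQ (0, s) = SQ 0 + s ^ 2 * ρ s := by
      have := part_eventually (p := ((0, 0) : (XB × ℝ) × ℝ)) Tay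
      filter_upwards [this] with s hs
      simpa [ah0] using hs
    have k2 : ∀ᶠ s in 𝓝 (0:ℝ), HasDerivAt (fun s => SQ (0, s)) (ah (0, s) * e (0, s)) s :=
      part_eventually (p := (0 : XB × ℝ)) SQd
    have k3 : ∀ᶠ s in 𝓝 (0:ℝ), ah (0, s) * e (0, s) = 2 * s * ρ s + s ^ 2 * fderiv ℝ ρ s 1 := by
      filter_upwards [eventually_eventually_nhds.2 k1, k2, ρd] with s h1 h2 h3
      have h4 : HasDerivAt (fun s => SQ (0, s)) (2 * s * ρ s + s ^ 2 * fderiv ℝ ρ s 1) s := by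
        have := (((hasDerivAt_id s).pow 2).mul h3).const_add (SQ 0)
        refine (this.congr_of_eventuallyEq h1).congr_deriv ?_
        simp
      exact h2.unique h4
    have he0 : HasDerivAt (fun s => e (0, s)) (fderiv ℝ e 0 (0, 1)) 0 := part_hasDerivAt es.diff
    have l1 : HasDerivAt (fun s => ah (0, s) * e (0, s)) 0 0 := by
      refine (ha0.mul he0).congr_deriv ?_
      rw [ad0, ah00]; simp
    have l2 : HasDerivAt (fun s => 2 * s * ρ s + s ^ 2 * fderiv ℝ ρ s 1) (2 * ρ 0) 0 := by
      have m1 := ((hasDerivAt_id (0:ℝ)).const_mul 2).mul (ρs.diff.hasDerivAt)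
      have m2 : HasDerivAt (fun s => fderiv ℝ ρ s 1) _ 0 :=
        (ρs.fderiv.clm (ContinuousLinearMap.apply ℝ ℝ (1:ℝ))).diff.hasDerivAt
      refine (m1.add (((hasDerivAt_id (0:ℝ)).pow 2).mul m2)).congr_deriv ?_
      simp
    have := l1.unique (l2.congr_of_eventuallyEq k3)
    have h : ρ 0 = 0 := by linarith
    exact h
  exact ⟨vh, ah, ch, e, R, ⟨vh0, ah0, ch0, e0, R0⟩, ⟨vs, as, cs, es, Rs⟩, qe, φu, Tay⟩

theorem Vfam : ∃ (V : (XB × ℝ) × ℝ → XB) (vq : XB → XB) (bb : (XB × ℝ) × ℝ → ℝ),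
    vq 0 = 0 ∧ SmoothNear vq 0 ∧ SmoothNear bb (0, 0) ∧
    (∀ᶠ h in 𝓝 (0 : XB), vq h = Gw (MB (vq h) h)) ∧
    (∀ᶠ z in 𝓝 ((0, 0) : ((XB × ℝ) × ℝ) × XB), z.2 = Gw (MT z.2 z.1.1.1 z.1.2 z.1.1.2) → z.2 = V z.1) ∧
    (∀ᶠ z in 𝓝 ((0, 0) : (XB × ℝ) × ℝ), SB z.1.1 (V z) (MT (V z) z.1.1 z.2 z.1.2) =
      SB z.1.1 (vq z.1.1) (MB (vq z.1.1) z.1.1) + z.2 ^ 2 * bb z) := by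
  obtain ⟨V, V0, Vs, Ve, Vu⟩ := V_exists
  let vq : XB → XB := fun h => V ((h, 0), 0)
  have hid := SmoothNear.id ((0, 0) : (XB × ℝ) × ℝ)
  have Vs' : SmoothNear V (0, 0) := Vs
  have Ms : SmoothNear (fun z : (XB × ℝ) × ℝ => MT (V z) z.1.1 z.2 z.1.2) (0, 0) :=
    MT_smooth Vs' hid.fst.fst hid.snd hid.fst.snd rfl
  let SV : (XB × ℝ) × ℝ → ℝ := fun z => SB z.1.1 (V z) (MT (V z) z.1.1 z.2 z.1.2)
  have Ss : SmoothNear SV (0, 0) := SB_smooth hid.fst.fst Vs' Ms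
  have tz : Tendsto (fun p : XB × ℝ => (p, (0:ℝ))) (𝓝 0) (𝓝 0) := by
    refine Continuous.tendsto' (by fun_prop) _ _ rfl
  have SVd : ∀ᶠ p in 𝓝 (0 : XB × ℝ), HasDerivAt (fun s => SV (p, s)) 0 0 := by
    filter_upwards [tz.eventually (eventually_eventually_nhds.2 Ve), tz.eventually Vs, tz.eventually Ms] with p h1 h2 h3
    have d1 := part_hasDerivAt (h2.differentiableAt (by simp))
    have d2 := part_hasDerivAt (h3.differentiableAt (by simp))
    have := variation p.1 (al := 0) (Ps := PsiB p.2) (c := fun _ => 0) d1 d2 (hasDerivAt_const _ _) rfl (by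
      filter_upwards [part_eventually h1] with s hs
      rw [zero_smul, add_zero]; exact hs)
    refine HasDerivAt.congr_deriv (f := fun s => SV (p, s)) this ?_
    simp
  obtain ⟨H1, H1s, H1e, H1d⟩ := hadamard_smooth SV 0 Ss
  obtain ⟨bb, bs, be, -⟩ := hadamard_smooth H1 0 H1s
  have tend : Tendsto (fun z : (XB × ℝ) × ℝ => z.1) (𝓝 (0,0)) (𝓝 0) := continuous_fst.tendsto' _ _ rfl
  have te : Tendsto (fun h : XB => ((h, (0:ℝ)), (0:ℝ))) (𝓝 0) (𝓝 0) := by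
    refine Continuous.tendsto' (by fun_prop) _ _ rfl
  have same : ∀ᶠ p in 𝓝 (0 : XB × ℝ), V (p, 0) = vq p.1 := by
    have t1 : Tendsto (fun p : XB × ℝ => (((p.1, (0:ℝ)), (0:ℝ)), V (p, 0))) (𝓝 0) (𝓝 (0, 0)) := by
      have hc : ContinuousAt (fun p : XB × ℝ => V (p, 0)) 0 := by
        have : ContinuousAt V ((fun p : XB × ℝ => (p, (0:ℝ))) 0) := Vs.cont
        exact ContinuousAt.comp this (by fun_prop)
      have h0 : V ((0 : XB × ℝ), (0:ℝ)) = 0 := V0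
      have hc' : Tendsto (fun p : XB × ℝ => V (p, 0)) (𝓝 0) (𝓝 0) := by
        have := hc.tendsto; rwa [h0] at this
      refine Tendsto.prodMk_nhds ?_ hc'
      refine Continuous.tendsto' (by fun_prop) _ _ rfl
    filter_upwards [t1.eventually Vu, tz.eventually Ve] with p h1 h2
    refine h1 ?_
    simp only [MT_al_zero] at h2 ⊢
    exact h2
  refine ⟨V, vq, bb, V0, Vs.comp' (((SmoothNear.id 0).prodMk (SmoothNear.const 0 _)).prodMk (SmoothNear.const 0 _)) rfl,
    bs, ?_, Vu, ?_⟩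
  · filter_upwards [te.eventually Ve] with h hh
    simpa only [MT_al_zero] using hh
  · have H10 : ∀ᶠ p in 𝓝 (0 : XB × ℝ), H1 (p, 0) = 0 := by
      filter_upwards [H1d, SVd] with p h1 h2 using h1.unique h2
    filter_upwards [H1e, be, tend.eventually H10, tend.eventually same] with z h1 h2 h3 h4
    change SV z = _
    have h5 : SV (z.1, 0) = SB z.1.1 (vq z.1.1) (MB (vq z.1.1) z.1.1) := by
      simp only [SV, MT_al_zero, h4]
    rw [h1, h2, h3, h5]; ring



theorem core : ∃ (Γ : XB → ℝ) (vq vQ : XB → XB) (aQ cQ : XB → ℝ),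
    (Γ 0 = 0 ∧ vq 0 = 0 ∧ vQ 0 = 0) ∧
    (SmoothNear Γ 0 ∧ ContinuousAt vq 0 ∧ ContinuousAt vQ 0) ∧
    (∀ᶠ h in 𝓝 (0 : XB), vq h = Gw (MB (vq h) h) ∧ QE (vQ h) h (aQ h) (Γ h) (cQ h) ∧
      SB h (vq h) (MB (vq h) h) = SB h (vQ h) (MT (vQ h) h (aQ h) (Γ h))) := by
  obtain ⟨vh, ah, ch, e, R, ⟨vh0, ah0, ch0, e0, R0⟩, ⟨vs, as, cs, es, Rs⟩, qe, qu, Tay⟩ := Qfam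
  obtain ⟨V, vq, bb, vq0, vqs, bs, vqe, Vu, VT⟩ := Vfam
  obtain ⟨φ, φ0, φs, φe, -⟩ := Q_exists 0 1 (by norm_num)
  simp only [zero_mul, one_mul] at φe
  let st : XB → XB × ℝ × ℝ := fun h => φ (h, 0)
  have sts : SmoothNear st 0 := φs.comp' ((SmoothNear.id 0).prodMk (SmoothNear.const 0 _)) rfl
  have st0 : st 0 = 0 := φ0
  let v1 : XB → XB := fun h => (st h).1
  let a1 : XB → ℝ := fun h => (st h).2.1
  let t1 : XB → ℝ := fun h => (st h).2.2
  have v1s : SmoothNear v1 0 := sts.fst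
  have a1s : SmoothNear a1 0 := sts.snd.fst
  have t1s : SmoothNear t1 0 := sts.snd.snd
  have v10 : v1 0 = 0 := by simp [v1, st0]
  have a10 : a1 0 = 0 := by simp [a1, st0]
  have t10 : t1 0 = 0 := by simp [t1, st0]
  have te : Tendsto (fun h : XB => (h, (0:ℝ))) (𝓝 0) (𝓝 0) := by
    refine Continuous.tendsto' (by fun_prop) _ _ rfl
  have ste : ∀ᶠ h in 𝓝 (0:XB), QE (v1 h) h (a1 h) (t1 h) 0 := by
    filter_upwards [te.eventually φe] with h hh
    simpa using hh
  have hid := SmoothNear.id (0 : XB)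
  have tv1 : Tendsto v1 (𝓝 0) (𝓝 0) := by simpa [v10] using v1s.cont.tendsto
  have ta1 : Tendsto a1 (𝓝 0) (𝓝 0) := by simpa [a10] using a1s.cont.tendsto
  have tt1 : Tendsto t1 (𝓝 0) (𝓝 0) := by simpa [t10] using t1s.cont.tendsto
  have tp : Tendsto (fun h => (h, t1 h)) (𝓝 (0:XB)) (𝓝 0) := tendsto_id.prodMk_nhds tt1
  have tpa : Tendsto (fun h => ((h, t1 h), a1 h)) (𝓝 (0:XB)) (𝓝 (0, 0)) := tp.prodMk_nhds ta1
  have isQ : ∀ᶠ h in 𝓝 (0:XB), v1 h = vh (h, t1 h) ∧ a1 h = ah (h, t1 h) := by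
    have tt : Tendsto (fun h => ((h, t1 h), (v1 h, a1 h, (0:ℝ)))) (𝓝 (0:XB)) (𝓝 (0, 0)) :=
      tp.prodMk_nhds (tv1.prodMk_nhds (ta1.prodMk_nhds tendsto_const_nhds))
    filter_upwards [tt.eventually qu, ste] with h h1 h2
    have := h1 h2
    simp only [Prod.mk.injEq] at this
    exact ⟨this.1, this.2.1⟩
  have isV : ∀ᶠ h in 𝓝 (0:XB), v1 h = V ((h, t1 h), a1 h) := by
    have tt : Tendsto (fun h => (((h, t1 h), a1 h), v1 h)) (𝓝 (0:XB)) (𝓝 (0, 0)) := tpa.prodMk_nhds tv1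
    filter_upwards [tt.eventually Vu, ste] with h h1 h2
    refine h1 ?_
    have := h2.1
    rwa [zero_smul, add_zero] at this
  -- the scalar equation for the ratio
  let s0 : ℝ := bb (0, 0) / (2 * a0)
  have ha := a0_pos
  let F : XB × ℝ → ℝ := fun z => bb ((z.1, t1 z.1), a1 z.1) + z.2 * e (z.1, t1 z.1)
    + z.2 ^ 2 * R ((z.1, t1 z.1), a1 z.1 * z.2)
  have hid2 := SmoothNear.id ((0, s0) : XB × ℝ)
  have at1 : SmoothNear (fun z : XB × ℝ => t1 z.1) (0, s0) := t1s.comp' hid2.fst rfl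
  have aa1 : SmoothNear (fun z : XB × ℝ => a1 z.1) (0, s0) := a1s.comp' hid2.fst rfl
  have Fs : SmoothNear F (0, s0) := by
    refine SmoothNear.add (SmoothNear.add ?_ ?_) ?_
    · exact bs.comp' ((hid2.fst.prodMk at1).prodMk aa1) (by simp [t10, a10])
    · exact hid2.snd.mul (es.comp' (hid2.fst.prodMk at1) (by simp [t10]))
    · exact (hid2.snd.pow 2).mul (Rs.comp' ((hid2.fst.prodMk at1).prodMk (aa1.mul hid2.snd)) (by simp [t10, a10]))
  have Fl : ∀ s, F (0, s) = bb (0, 0) + s * (-(2 * a0)) := by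
    intro s
    simp only [F, t10, a10, zero_mul]
    have h1 : ((0, 0) : XB × ℝ) = 0 := rfl
    rw [h1, R0, e0, mul_zero, add_zero]
  have F0 : F (0, s0) = 0 := by
    rw [Fl]; simp only [s0]; field_simp; ring
  have hne : -(2 * a0) ≠ 0 := by
    intro h; linarith
  let D : ℝ ≃L[ℝ] ℝ := ContinuousLinearEquiv.unitsEquivAut ℝ (Units.mk0 _ hne)
  have hD : HasFDerivAt (fun y => F (0, y)) (D : ℝ →L[ℝ] ℝ) s0 := by
    have h1 : HasDerivAt (fun y => F (0, y)) (-(2 * a0)) s0 := by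
      simp_rw [Fl]
      simpa using ((hasDerivAt_id s0).mul_const (-(2 * a0))).const_add (bb (0, 0))
    refine h1.hasFDerivAt.congr_fderiv ?_
    ext; simp [D]
  obtain ⟨σ, σ0, σs, σe, -⟩ := ift_smooth F 0 s0 Fs F0 D hD
  let Γ : XB → ℝ := fun h => t1 h + a1 h * σ h
  have Γs : SmoothNear Γ 0 := t1s.add (a1s.mul σs)
  have Γ0 : Γ 0 = 0 := by simp [Γ, t10, a10]
  have tG : Tendsto Γ (𝓝 0) (𝓝 0) := by simpa [Γ0] using Γs.cont.tendsto
  have tpG : Tendsto (fun h => (h, Γ h)) (𝓝 (0:XB)) (𝓝 0) := tendsto_id.prodMk_nhds tG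
  have hvQ0 : vh (0, Γ 0) = 0 := by rw [Γ0]; exact vh0
  refine ⟨Γ, vq, fun h => vh (h, Γ h), fun h => ah (h, Γ h), fun h => ch (h, Γ h), ⟨Γ0, vq0, hvQ0⟩,
    ⟨Γs, vqs.cont, ?_⟩, ?_⟩
  · have : ContinuousAt vh ((fun h => (h, Γ h)) (0:XB)) := by
      simp only [Γ0]; exact vs.cont
    exact ContinuousAt.comp this (continuousAt_id.prodMk Γs.cont)
  · have tT : Tendsto (fun h => ((h, t1 h), a1 h * σ h)) (𝓝 (0:XB)) (𝓝 (0, 0)) := by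
      refine tp.prodMk_nhds ?_
      have := (a1s.mul σs).cont.tendsto
      simpa [a10] using this
    filter_upwards [vqe, tpG.eventually qe, tT.eventually Tay, tpa.eventually VT, isQ, isV, σe]
      with h h1 h2 h3 h4 h5 h6 h7
    refine ⟨h1, h2, ?_⟩
    have h8 : bb ((h, t1 h), a1 h) + σ h * e (h, t1 h) + σ h ^ 2 * R ((h, t1 h), a1 h * σ h) = 0 := h7
    rw [← h5.1, ← h5.2] at h3
    rw [← h6] at h4
    change _ = SB h (vh (h, t1 h + a1 h * σ h)) (MT (vh (h, t1 h + a1 h * σ h)) h (ah (h, t1 h + a1 h * σ h)) (t1 h + a1 h * σ h))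
    rw [h3, h4]
    linear_combination (-(a1 h) ^ 2) * h8



/-- action of the separatrix (kinetic part) -/
noncomputable def K0 : ℝ := ell ((2:ℝ) • (kB * kB))

theorem rep_u {v Mt : XB} {c : ℝ} (hv : v = Gw Mt + c • kB) (t : ℝ) :
    wt t * v t = GN (fun s => wt s * Mt s) t + c * sch t := by
  have : v t = Gw Mt t + c * kB t := by conv_lhs => rw [hv]
                                        rfl
  rw [this, mul_add, Gw_apply, ← kB_apply]; ring

theorem rep_deriv {v Mt : XB} {c : ℝ} (hv : v = Gw Mt + c • kB) {t : ℝ} (ht : t ≠ 0) :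
    HasDerivAt (fun t => wt t * v t) (pN (fun s => wt s * Mt s) t - tanh t * (wt t * v t)) t := by
  have e : (fun t => wt t * v t) = fun t => GN (fun s => wt s * Mt s) t + c * sch t := by
    ext s; exact rep_u hv s
  rw [rep_u hv, e]
  have h := (GN_hasDerivAt (by norm_num) (wt_dec Mt) ht).add ((sch_hasDerivAt t).const_mul c)
  refine HasDerivAt.congr_deriv (f := fun t => GN (fun s => wt s * Mt s) t + c * sch t) h ?_
  ring

theorem action_id (h v Mt : XB) (c : ℝ) (hv : v = Gw Mt + c • kB) :
    ∫ t, ((deriv (fun t => q0 t + wt t * v t) t) ^ 2 / 2 + (1 - cos (q0 t + wt t * v t)) * (1 - h t)) =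
      K0 + SB h v Mt ∧
    Integrable (fun t => (deriv (fun t => q0 t + wt t * v t) t) ^ 2 / 2 + (1 - cos (q0 t + wt t * v t)) * (1 - h t)) := by
  set p : ℝ → ℝ := pN (fun s => wt s * Mt s) with hp
  have hpm : Measurable p := pN_measurable (by norm_num) (wt_dec Mt)
  have hpb : ∀ t, |p t| ≤ 2 * ‖Mt‖ * exp (-(1 / 2 * |t|)) := pN_bound (by norm_num) (wt_dec Mt)
  have hud : ∀ t ≠ 0, HasDerivAt (fun t => wt t * v t) (p t - tanh t * (wt t * v t)) t := fun t ht => rep_deriv hv ht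
  have hq : ∀ t ≠ 0, deriv (fun t => q0 t + wt t * v t) t = 2 * sch t + (p t - tanh t * (wt t * v t)) := by
    intro t ht
    exact ((q0_hasDerivAt t).add (hud t ht)).deriv
  let X : XB := (-4:ℝ) • (kB * tB * v) + (tB * tB) * (v * v) - (1/2:ℝ) • (v * v * (sB * sB))
  let F : ℝ → ℝ := fun t => 2 * sch t * (wt t * v t) - 1 / 2 * ((wt t * v t) * (wt t * v t) * tanh t)
  let F' : ℝ → ℝ := fun t => p t * (wt t * ((2:ℝ) • kB - v * tB) t) + wt t ^ 2 * X t
  have hi1 : Integrable (fun t => p t * (wt t * ((2:ℝ) • kB - v * tB) t)) :=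
    dec_mul_integrable hpm (wt_dec _).1.measurable hpb (wt_dec _).2
  have hF'i : Integrable F' := hi1.add (wt2_integrable X)
  have hF'0 : ∫ t, F' t = 0 := by
    have hwc := wt_continuous
    have hvc := v.continuous
    have hsc := sch_continuous
    have htc := tanh_continuous
    refine integral_deriv_zero (F := F) (by fun_prop) ?_ hF'i (A := ‖(2:ℝ) • (kB * v) - (1/2:ℝ) • (v * v * tB)‖) one_pos ?_
    · intro t ht
      have h1 := (((sch_hasDerivAt t).const_mul 2).mul (hud t ht)).sub
        ((((hud t ht).mul (hud t ht)).mul (tanh_hasDerivAt t)).const_mul (1/2))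
      refine HasDerivAt.congr_deriv (f := F) h1 ?_
      simp only [F', X, XB.sub_apply, XB.add_apply, XB.mul_apply, XB.smul_apply, tB_apply, sB_apply]
      rw [← kB_apply]
      simp only [Pi.mul_apply]
      ring
    · intro t
      have e : F t = wt t ^ 2 * ((2:ℝ) • (kB * v) - (1/2:ℝ) • (v * v * tB)) t := by
        simp only [F, XB.sub_apply, XB.mul_apply, XB.smul_apply, tB_apply]
        rw [← kB_apply]; ring
      rw [e, abs_mul, abs_of_pos (pow_pos (wt_pos t) 2), wt_sq, one_mul, mul_comm]
      exact mul_le_mul_of_nonneg_right (XB.le _ t) (exp_pos _).le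
  let Y : XB := (2:ℝ) • (kB * kB) + ((1 - h) * UB v - mB * v - (1/2 : ℝ) • (cB * (v * v)))
  have hpp : Integrable (fun t => p t * p t) := dec_mul_integrable hpm hpm hpb hpb
  have hae : (fun t => (deriv (fun t => q0 t + wt t * v t) t) ^ 2 / 2 + (1 - cos (q0 t + wt t * v t)) * (1 - h t))
      =ᵐ[volume] fun t => F' t + (1/2 * (p t * p t) + wt t ^ 2 * Y t) := by
    have : ∀ᵐ t : ℝ, t ≠ 0 := by simp [ae_iff, measure_singleton]
    filter_upwards [this] with t ht
    rw [hq t ht, ← UB_apply]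
    simp only [F', X, Y, XB.sub_apply, XB.add_apply, XB.mul_apply, XB.smul_apply, tB_apply, sB_apply, XB.one_apply,
      cB_apply]
    have e1 := kB_apply t
    have e2 := mB_apply t
    rw [sin_q0] at e2
    have e3 := cos_q0 t
    have e4 := tanh_sq_eq t
    rw [e3]
    rw [← e1] at e2 e4 ⊢
    have hw := (wt_pos t).ne'
    have e5 : mB t = -(2 * (tanh t * kB t)) := mul_left_cancel₀ hw (by rw [e2]; ring)
    rw [e5]
    linear_combination (-(1/2) * (wt t * v t) ^ 2) * e4
  have hY := wt2_integrable Y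
  have hZ : Integrable (fun t => 1/2 * (p t * p t) + wt t ^ 2 * Y t) := (hpp.const_mul _).add hY
  have hintg : Integrable (fun t => F' t + (1/2 * (p t * p t) + wt t ^ 2 * Y t)) :=
    hF'i.add hZ
  refine ⟨?_, hintg.congr hae.symm⟩
  rw [integral_congr_ae hae, integral_add hF'i hZ, hF'0,
    integral_add (hpp.const_mul _) hY, integral_const_mul, ← ell_Gw, ← ell_apply, SB, K0]
  simp only [Y]
  rw [map_add]; ring



theorem zero_of_half {D : ℝ → ℝ} {B : ℝ} (hB : ∀ t, |D t| ≤ B)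
    (h : ∀ S, (∀ t, |D t| ≤ S) → ∀ t, |D t| ≤ S / 2) (t : ℝ) : D t = 0 := by
  have hbd : BddAbove (Set.range fun t => |D t|) := ⟨B, by rintro _ ⟨t, rfl⟩; exact hB t⟩
  have h1 : ∀ t, |D t| ≤ ⨆ t, |D t| := fun t => le_ciSup hbd t
  have h2 := ciSup_le (h _ h1)
  have h3 := h1 t
  have h4 := abs_nonneg (D t)
  exact abs_eq_zero.1 (by linarith)

/-- pointwise nonlinearity -/
noncomputable def Nu (h u : ℝ → ℝ) (t : ℝ) : ℝ :=
  h t * sin (q0 t + u t) - (sin (q0 t + u t) - sin (q0 t) - cos (q0 t) * u t)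

theorem abs_sin_sub_le (x y : ℝ) : |sin x - sin y| ≤ |x - y| := by
  have := Convex.norm_image_sub_le_of_norm_hasDerivWithin_le (f := sin) (f' := cos) (s := Set.univ) (C := 1)
    (fun x _ => (hasDerivAt_sin x).hasDerivWithinAt) (fun x _ => abs_cos_le_one x) convex_univ (Set.mem_univ y) (Set.mem_univ x)
  simpa using this
theorem abs_cos_sub_le (x y : ℝ) : |cos x - cos y| ≤ |x - y| := by
  have := Convex.norm_image_sub_le_of_norm_hasDerivWithin_le (f := cos) (f' := fun x => -sin x) (s := Set.univ) (C := 1)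
    (fun x _ => (hasDerivAt_cos x).hasDerivWithinAt) (fun x _ => by simpa using abs_sin_le_one x) convex_univ (Set.mem_univ y) (Set.mem_univ x)
  simpa using this
theorem sin_rem_le (a x y d : ℝ) (hx : |x| ≤ d) (hy : |y| ≤ d) :
    |(sin (a + x) - cos a * x) - (sin (a + y) - cos a * y)| ≤ d * |x - y| := by
  have := Convex.norm_image_sub_le_of_norm_hasDerivWithin_le (f := fun u => sin (a + u) - cos a * u)
    (f' := fun u => cos (a + u) - cos a) (s := Set.Icc (-d) d) (C := d)
    (fun u _ => ?_) (fun u hu => ?_) (convex_Icc _ _) (abs_le.1 hy) (abs_le.1 hx)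
  · simpa using this
  · have := ((((hasDerivAt_id u).const_add a).sin).sub ((hasDerivAt_id u).const_mul (cos a)))
    exact (HasDerivAt.congr_deriv (f := fun u => sin (a + u) - cos a * u) this (by simp)).hasDerivWithinAt
  · have := abs_cos_sub_le (a + u) a
    rw [add_sub_cancel_left] at this
    exact this.trans (abs_le.2 hu)

theorem Nu_diff {h u1 u2 : ℝ → ℝ} {e d S : ℝ} (he : ∀ t, |h t| ≤ e) (h1 : ∀ t, |u1 t| ≤ d) (h2 : ∀ t, |u2 t| ≤ d)
    (hS : ∀ t, |u1 t - u2 t| ≤ S) (t : ℝ) : |Nu h u1 t - Nu h u2 t| ≤ (e + d) * S := by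
  have a1 := abs_sin_sub_le (q0 t + u1 t) (q0 t + u2 t)
  rw [add_sub_add_left_eq_sub] at a1
  have a2 := sin_rem_le (q0 t) (u1 t) (u2 t) d (h1 t) (h2 t)
  have e0 : 0 ≤ e := (abs_nonneg _).trans (he t)
  have d0 : 0 ≤ d := (abs_nonneg _).trans (h1 t)
  have a3 : |h t * (sin (q0 t + u1 t) - sin (q0 t + u2 t))| ≤ e * S := by
    rw [abs_mul]; exact mul_le_mul (he t) (a1.trans (hS t)) (abs_nonneg _) e0
  have a4 := a2.trans (mul_le_mul_of_nonneg_left (hS t) d0)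
  have : Nu h u1 t - Nu h u2 t = h t * (sin (q0 t + u1 t) - sin (q0 t + u2 t)) -
    ((sin (q0 t + u1 t) - cos (q0 t) * u1 t) - (sin (q0 t + u2 t) - cos (q0 t) * u2 t)) := by
    rw [Nu, Nu]; ring
  rw [this]
  refine (abs_sub _ _).trans ?_
  linarith

theorem Nu_cont {h u : ℝ → ℝ} (hc : Continuous h) (hu : Continuous u) : Continuous (Nu h u) := by
  have := q0_continuous
  unfold Nu; fun_prop

theorem dec_zero {N : ℝ → ℝ} {K : ℝ} (hc : Continuous N) (hb : ∀ t, |N t| ≤ K) : Dec 0 K N :=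
  ⟨hc, fun t => by simpa using hb t⟩

theorem Nu_dec {h u : ℝ → ℝ} {e d : ℝ} (hc : Continuous h) (hu : Continuous u) (he : ∀ t, |h t| ≤ e)
    (h1 : ∀ t, |u t| ≤ d) : Dec 0 (e + 2 + d) (Nu h u) := by
  refine dec_zero (Nu_cont hc hu) fun t => ?_
  have s1 := abs_sin_le_one (q0 t + u t)
  have s2 := abs_sin_le_one (q0 t)
  have s3 := abs_cos_le_one (q0 t)
  have m1 : |h t * sin (q0 t + u t)| ≤ e * 1 := by
    rw [abs_mul]; exact mul_le_mul (he t) s1 (abs_nonneg _) ((abs_nonneg _).trans (he t))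
  have m2 : |cos (q0 t) * u t| ≤ 1 * d := by
    rw [abs_mul]; exact mul_le_mul s3 (h1 t) (abs_nonneg _) zero_le_one
  rw [Nu]
  rw [abs_le] at *
  constructor <;> linarith [m1.1, m1.2, m2.1, m2.2, s1.1, s1.2, s2.1, s2.2]

theorem uniq_q {h u1 u2 : ℝ → ℝ} {e d : ℝ} (hc : Continuous h) (c1 : Continuous u1) (c2 : Continuous u2)
    (he : ∀ t, |h t| ≤ e) (h1 : ∀ t, |u1 t| ≤ d) (h2 : ∀ t, |u2 t| ≤ d) (hsm : 16 * (e + d) ≤ 1)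
    (r1 : ∀ t, u1 t = GN (Nu h u1) t) (r2 : ∀ t, u2 t = GN (Nu h u2) t) (t : ℝ) : u1 t = u2 t := by
  refine sub_eq_zero.1 (zero_of_half (D := fun t => u1 t - u2 t) (B := d + d)
    (fun t => (abs_sub _ _).trans (add_le_add (h1 t) (h2 t))) (fun S hS t => ?_) t)
  have hl := GN_lin le_rfl (Nu_dec hc c1 he h1) le_rfl (Nu_dec hc c2 he h2) (-1) t
  have hS0 : 0 ≤ S := (abs_nonneg _).trans (hS 0)
  have hd : Dec 0 ((e + d) * S) (fun t => Nu h u1 t + (-1) * Nu h u2 t) := by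
    refine dec_zero ((Nu_cont hc c1).add (continuous_const.mul (Nu_cont hc c2))) fun t => ?_
    have := Nu_diff he h1 h2 hS t
    rwa [neg_one_mul, ← sub_eq_add_neg]
  have hb := GN_bound le_rfl (by norm_num) hd t
  rw [hl] at hb
  have e1 : u1 t - u2 t = GN (Nu h u1) t + -1 * GN (Nu h u2) t := by rw [← r1, ← r2]; ring
  rw [e1]
  refine hb.trans ?_
  simp only [zero_mul, neg_zero, exp_zero, mul_one]
  nlinarith

theorem uniq_Q {h u1 u2 P : ℝ → ℝ} {e d al1 al2 b1 b2 a : ℝ} (hc : Continuous h) (c1 : Continuous u1)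
    (c2 : Continuous u2) (cP : Continuous P) (P0 : ∀ t, 0 ≤ P t) (P1 : ∀ t, P t ≤ 1) (hPi : Integrable P)
    (PI : ∫ t, P t ≤ ∫ t, sch t) (ha0 : 0 < a) (ha : a ≤ ∫ t, P t * sch t)
    (he : ∀ t, |h t| ≤ e) (h1 : ∀ t, |u1 t| ≤ d) (h2 : ∀ t, |u2 t| ≤ d)
    (hsm : 16 * (e + d) * (1 + (∫ t, sch t) / a) ^ 2 ≤ 1)
    (r1 : ∀ t, u1 t = b1 * sch t + GN (fun t => Nu h u1 t + al1 * P t) t)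
    (r2 : ∀ t, u2 t = b2 * sch t + GN (fun t => Nu h u2 t + al2 * P t) t)
    (o1 : ∫ t, (Nu h u1 t + al1 * P t) * sch t = 0) (o2 : ∫ t, (Nu h u2 t + al2 * P t) * sch t = 0)
    (k : ∫ t, u1 t * P t = ∫ t, u2 t * P t) (t : ℝ) : u1 t = u2 t := by
  have hPd : Dec 0 1 P := dec_zero cP fun t => by rw [abs_of_nonneg (P0 t)]; exact P1 t
  have I0 : 0 ≤ ∫ t, sch t := integral_nonneg fun t => (sch_pos t).le
  set I := ∫ t, sch t with hI
  set aa := ∫ t, P t * sch t with haa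
  have aa0 : 0 < aa := ha0.trans_le ha
  refine sub_eq_zero.1 (zero_of_half (D := fun t => u1 t - u2 t) (B := d + d)
    (fun t => (abs_sub _ _).trans (add_le_add (h1 t) (h2 t))) (fun S hS => ?_) t)
  have hS0 : 0 ≤ S := (abs_nonneg _).trans (hS 0)
  have e0 : 0 ≤ e := (abs_nonneg _).trans (he 0)
  have d0 : 0 ≤ d := (abs_nonneg _).trans (h1 0)
  let DN : ℝ → ℝ := fun t => Nu h u1 t + (-1) * Nu h u2 t
  have DNc : Continuous DN := (Nu_cont hc c1).add (continuous_const.mul (Nu_cont hc c2))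
  have DNb : ∀ t, |DN t| ≤ (e + d) * S := fun t => by
    have := Nu_diff he h1 h2 hS t
    simp only [DN]
    rwa [neg_one_mul, ← sub_eq_add_neg]
  set y := (e + d) * S with hy
  have y0 : 0 ≤ y := by positivity
  let da := al1 - al2
  let db := b1 - b2
  have iDN : Integrable (fun t => DN t * sch t) := mul_sch_integrable DNc DNb
  have iP : Integrable (fun t => P t * sch t) := mul_sch_integrable cP (K := 1) (fun t => by rw [abs_of_nonneg (P0 t)]; exact P1 t)
  have iN1 : Integrable (fun t => Nu h u1 t * sch t) := mul_sch_integrable (Nu_cont hc c1) (K := e + 2 + d)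
    (fun t => by simpa using (Nu_dec hc c1 he h1).2 t)
  have iN2 : Integrable (fun t => Nu h u2 t * sch t) := mul_sch_integrable (Nu_cont hc c2) (K := e + 2 + d)
    (fun t => by simpa using (Nu_dec hc c2 he h2).2 t)
  have bnd : ∀ {F G : ℝ → ℝ} {K : ℝ}, Integrable G volume → (∀ t, 0 ≤ G t) → (∀ t, |F t| ≤ K) →
      |∫ t, F t * G t| ≤ K * ∫ t, G t := by
    intro F G K hG hG0 hF
    rw [← integral_const_mul, ← Real.norm_eq_abs]
    refine norm_integral_le_of_norm_le (hG.const_mul K) (Eventually.of_forall fun t => ?_)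
    rw [norm_mul, Real.norm_eq_abs, Real.norm_eq_abs, abs_of_nonneg (hG0 t)]
    exact mul_le_mul_of_nonneg_right (hF t) (hG0 t)
  have f1 : da * aa = - ∫ t, DN t * sch t := by
    have s1 : (∫ t, Nu h u1 t * sch t) + al1 * aa = 0 := by
      rw [haa, ← integral_const_mul, ← integral_add iN1 (iP.const_mul _), ← o1]
      congr 1; ext t; ring
    have s2 : (∫ t, Nu h u2 t * sch t) + al2 * aa = 0 := by
      rw [haa, ← integral_const_mul, ← integral_add iN2 (iP.const_mul _), ← o2]
      congr 1; ext t; ring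
    have s3 : ∫ t, DN t * sch t = (∫ t, Nu h u1 t * sch t) - ∫ t, Nu h u2 t * sch t := by
      rw [← integral_sub iN1 iN2]; congr 1; ext t; simp only [DN]; ring
    rw [s3]; simp only [da]; linear_combination s1 - s2
  have f2 : |da| ≤ y * (I / a) := by
    have : |da| * aa ≤ y * I := by
      rw [← abs_of_pos aa0, ← abs_mul, f1, abs_neg]
      exact bnd sch_integrable (fun t => (sch_pos t).le) DNb
    rw [← mul_div_assoc, le_div_iff₀ ha0]
    exact (mul_le_mul_of_nonneg_left ha (abs_nonneg _)).trans this
  let G : ℝ → ℝ := GN (fun t => DN t + da * P t)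
  have Gd : Dec 0 (y + |da|) (fun t => DN t + da * P t) := by
    refine dec_zero (DNc.add (continuous_const.mul cP)) fun t => ?_
    refine (abs_add_le _ _).trans (add_le_add (DNb t) ?_)
    rw [abs_mul, abs_of_nonneg (P0 t)]
    exact mul_le_of_le_one_right (abs_nonneg _) (P1 t)
  have Gb : ∀ t, |G t| ≤ 8 * (y + |da|) := fun t => by
    simpa using GN_bound le_rfl (by norm_num) Gd t
  have rD : ∀ t, u1 t - u2 t = db * sch t + G t := by
    intro t
    have l1 := GN_lin le_rfl (Nu_dec hc c1 he h1) le_rfl hPd al1 t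
    have l2 := GN_lin le_rfl (Nu_dec hc c2 he h2) le_rfl hPd al2 t
    have l3 := GN_lin le_rfl (dec_zero DNc DNb) le_rfl hPd da t
    have l4 := GN_lin le_rfl (Nu_dec hc c1 he h1) le_rfl (Nu_dec hc c2 he h2) (-1) t
    rw [r1, r2, l1, l2]
    simp only [G]
    rw [l3]
    simp only [DN]
    rw [l4]; simp only [da, db]; ring
  have iG : Integrable (fun t => G t * P t) := by
    refine (hPi.const_mul (8 * (y + |da|))).mono' ((GN_continuous le_rfl Gd).mul cP).aestronglyMeasurable
      (Eventually.of_forall fun t => ?_)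
    rw [norm_mul, Real.norm_eq_abs, Real.norm_eq_abs, abs_of_nonneg (P0 t)]
    exact mul_le_mul_of_nonneg_right (Gb t) (P0 t)
  have iu : ∀ {u : ℝ → ℝ}, Continuous u → (∀ t, |u t| ≤ d) → Integrable (fun t => u t * P t) := by
    intro u hu hb
    refine (hPi.const_mul d).mono' (hu.mul cP).aestronglyMeasurable (Eventually.of_forall fun t => ?_)
    rw [norm_mul, Real.norm_eq_abs, Real.norm_eq_abs, abs_of_nonneg (P0 t)]
    exact mul_le_mul_of_nonneg_right (hb t) (P0 t)
  have g1 : db * aa = - ∫ t, G t * P t := by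
    have : ∫ t, (u1 t * P t - u2 t * P t) = 0 := by
      rw [integral_sub (iu c1 h1) (iu c2 h2), k, sub_self]
    have s : (∫ t, db * (P t * sch t)) + ∫ t, G t * P t = 0 := by
      rw [← integral_add (iP.const_mul _) iG, ← this]
      congr 1; ext t
      rw [← sub_mul, rD]; ring
    rw [integral_const_mul, ← haa] at s
    linarith
  have g2 : |db| ≤ 8 * (y + |da|) * (I / a) := by
    have hn : 0 ≤ 8 * (y + |da|) := by positivity
    have : |db| * aa ≤ 8 * (y + |da|) * I := by
      rw [← abs_of_pos aa0, ← abs_mul, g1, abs_neg]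
      exact (bnd hPi P0 Gb).trans (mul_le_mul_of_nonneg_left PI hn)
    rw [← mul_div_assoc, le_div_iff₀ ha0]
    exact (mul_le_mul_of_nonneg_left ha (abs_nonneg _)).trans this
  intro t
  rw [rD]
  refine (abs_add_le _ _).trans ?_
  have m1 : |db * sch t| ≤ |db| := by
    rw [abs_mul, abs_of_pos (sch_pos t)]
    exact mul_le_of_le_one_right (abs_nonneg _) (sch_le_one t)
  have m2 := Gb t
  set r := I / a with hr
  have r0 : 0 ≤ r := by positivity
  have m3 : 8 * (y + |da|) * (1 + r) ≤ 8 * (y * (1 + r)) * (1 + r) := by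
    refine mul_le_mul_of_nonneg_right ?_ (by positivity)
    linarith
  have m4 : 16 * (y * (1 + r)) * (1 + r) ≤ S := by
    have := mul_le_mul_of_nonneg_right hsm hS0
    rw [hy]; linarith
  linarith



theorem wtv_bound (v : XB) {d : ℝ} (hv : ‖v‖ ≤ d) (t : ℝ) : |wt t * v t| ≤ d := by
  rw [abs_mul, abs_of_pos (wt_pos t)]
  exact (mul_le_of_le_one_left (abs_nonneg _) (wt_le_one t)).trans ((XB.le v t).trans hv)

theorem wtv_cont (v : XB) : Continuous (fun t => wt t * v t) := wt_continuous.mul v.continuous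

theorem MB_Nu (v h : XB) : (fun t => wt t * MB v h t) = Nu h (fun t => wt t * v t) := by
  ext t; rw [MB_apply, Nu]

theorem q_ident (h v : XB) (hv : v = Gw (MB v h)) (q : ℝ → ℝ) (hqc : Continuous q) {d e : ℝ}
    (hqd : ∀ t, |q t - q0 t| ≤ d) (hvd : ‖v‖ ≤ d) (he : ‖h‖ ≤ e) (hsm : 16 * (e + d) ≤ 1)
    (ho : ∀ t ≠ 0, HasDerivAt q (deriv q t) t ∧ HasDerivAt (deriv q) (sin (q t) - h t * sin (q t)) t)
    (hq0 : q 0 = π) : q = fun t => q0 t + wt t * v t := by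
  have hhe : ∀ t, |h t| ≤ e := fun t => (XB.le h t).trans he
  have c1 : Continuous (fun t => q t - q0 t) := hqc.sub q0_continuous
  have hd := Nu_dec h.continuous c1 hhe hqd
  have hr := (full_rep (D := fun t => q t - q0 t) (D1 := fun t => deriv q t - 2 * sch t) le_rfl hd c1 hqd
    (fun t ht => (ho t ht).1.sub (q0_hasDerivAt t))
    (fun t ht => ((ho t ht).2.sub (q0_deriv2 t)).congr_deriv (by
      rw [Nu]; rw [show q0 t + (q t - q0 t) = q t by ring]; ring))).1
  ext t
  have := uniq_q (u1 := fun t => q t - q0 t) (u2 := fun t => wt t * v t) h.continuous c1 (wtv_cont v) hhe hqd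
    (wtv_bound v hvd) hsm (fun t => by rw [hr t, hq0, q0_zero]; ring)
    (fun t => by
      have hv2 : v = Gw (MB v h) + (0:ℝ) • kB := by rw [zero_smul, add_zero]; exact hv
      have := rep_u hv2 t
      rw [this, MB_Nu]; ring) t
  linarith

theorem Q_ident (h v : XB) {al th c : ℝ} (hQE : QE v h al th c) (Q : ℝ → ℝ) (hQc : Continuous Q)
    {d e a be : ℝ} (hQd : ∀ t, |Q t - q0 t| ≤ d) (hvd : ‖v‖ ≤ d) (he : ‖h‖ ≤ e)
    (hP : ∀ t, wt t * PsiB th t = psi0 (t - th))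
    (hk : kap th = ∫ t, (q0 t - q0 (t - th)) * psi0 (t - th))
    (ha0 : 0 < a) (ha : a ≤ ell (PsiB th * kB))
    (hsm : 16 * (e + d) * (1 + (∫ t, sch t) / a) ^ 2 ≤ 1)
    (ho : ∀ t, HasDerivAt Q (deriv Q t) t ∧
      HasDerivAt (deriv Q) (sin (Q t) - h t * sin (Q t) - be * psi0 (t - th)) t)
    (hor : ∫ t, (Q t - q0 (t - th)) * psi0 (t - th) = 0) : Q = fun t => q0 t + wt t * v t := by
  obtain ⟨e1, e2, e3⟩ := hQE
  have hhe : ∀ t, |h t| ≤ e := fun t => (XB.le h t).trans he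
  have c1 : Continuous (fun t => Q t - q0 t) := hQc.sub q0_continuous
  set P : ℝ → ℝ := fun t => psi0 (t - th) with hPdef
  have cP : Continuous P := psi0_continuous.comp (continuous_id.sub continuous_const)
  have P0 : ∀ t, 0 ≤ P t := fun t => (psi0_pos _).le
  have P1 : ∀ t, P t ≤ 1 := fun t => (psi0_le _).trans (sch_le_one _)
  have psii : Integrable psi0 := sch_integrable.mono' psi0_continuous.aestronglyMeasurable
    (Eventually.of_forall fun t => by rw [Real.norm_eq_abs, abs_of_pos (psi0_pos t)]; exact psi0_le t)
  have iP : Integrable P := psii.comp_sub_right th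
  have PI : ∫ t, P t ≤ ∫ t, sch t := by
    rw [hPdef, integral_sub_right_eq_self psi0 th]
    exact integral_mono psii sch_integrable psi0_le
  have ha' : a ≤ ∫ t, P t * sch t := by
    refine ha.trans (le_of_eq ?_)
    rw [ell_apply]; congr 1; ext t
    rw [XB.mul_apply, ← kB_apply]
    simp only [hPdef]
    rw [← hP]; ring
  have iuP : ∀ {u : ℝ → ℝ} {K : ℝ}, Continuous u → (∀ t, |u t| ≤ K) → Integrable (fun t => u t * P t) volume := by
    intro u K hu hb
    refine (iP.const_mul K).mono' (hu.mul cP).aestronglyMeasurable (Eventually.of_forall fun t => ?_)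
    rw [norm_mul, Real.norm_eq_abs, Real.norm_eq_abs, abs_of_nonneg (P0 t)]
    exact mul_le_mul_of_nonneg_right (hb t) (P0 t)
  have hd : Dec 0 (e + 2 + d + |be|) (fun t => Nu h (fun t => Q t - q0 t) t + be * P t) := by
    refine dec_zero ((Nu_cont h.continuous c1).add (continuous_const.mul cP)) fun t => ?_
    refine (abs_add_le _ _).trans (add_le_add ((Nu_dec h.continuous c1 hhe hQd).bdd le_rfl t) ?_)
    rw [abs_mul, abs_of_nonneg (P0 t)]
    exact mul_le_of_le_one_right (abs_nonneg _) (P1 t)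
  have hr := full_rep (D := fun t => Q t - q0 t) (D1 := fun t => deriv Q t - 2 * sch t) le_rfl hd c1 hQd
    (fun t ht => (ho t).1.sub (q0_hasDerivAt t))
    (fun t ht => ((ho t).2.sub (q0_deriv2 t)).congr_deriv (by
      simp only [Nu, hPdef]; rw [show q0 t + (Q t - q0 t) = Q t by ring]; ring))
  have hMT : (fun t => wt t * MT v h al th t) = fun t => Nu h (fun t => wt t * v t) t + al * P t := by
    ext t
    have : MT v h al th t = MB v h t + al * PsiB th t := rfl
    rw [this, ← MB_Nu]
    simp only [hPdef]; rw [← hP]; ring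
  have k1 : ∫ t, (Q t - q0 t) * P t = - kap th := by
    have i1 : Integrable (fun t => (Q t - q0 t) * P t) := iuP c1 hQd
    by_cases i2 : Integrable (fun t => (q0 t - q0 (t - th)) * P t)
    · have := integral_add i1 i2
      have e : ∫ t, ((Q t - q0 t) * P t + (q0 t - q0 (t - th)) * P t) = 0 := by
        rw [← hor]; congr 1; ext t; simp only [hPdef]; ring
      rw [e] at this
      rw [hk]; linarith
    · exfalso
      apply i2
      refine iuP (K := 4 * π) (q0_continuous.sub (q0_continuous.comp (continuous_id.sub continuous_const))) fun t => ?_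
      have b1 := fun t => arctan_lt_pi_div_two (exp t)
      have b2 := fun t => Real.arctan_pos.2 (exp_pos t)
      simp only [q0]
      rw [abs_le]; constructor <;> linarith [b1 t, b2 t, b1 (t - th), b2 (t - th), pi_pos]
  have k2 : ∫ t, (wt t * v t) * P t = - kap th := by
    have : ell (v * PsiB th) = ∫ t, (wt t * v t) * P t := by
      rw [ell_apply]; congr 1; ext t
      simp only [hPdef]; rw [← hP, XB.mul_apply]; ring
    linarith
  ext t
  have := uniq_Q (u1 := fun t => Q t - q0 t) (u2 := fun t => wt t * v t) (P := P) (al1 := be) (al2 := al)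
    (b1 := Q 0 - q0 0) (b2 := c)
    h.continuous c1 (wtv_cont v) cP P0 P1 iP PI ha0 ha' hhe hQd (wtv_bound v hvd) hsm hr.1
    (fun t => by rw [rep_u e1 t, hMT]; ring)
    (hr.2 ((ho 0).2.continuousAt.sub (continuous_const.mul sch_continuous).continuousAt))
    (by
      rw [← e2, ell_apply]; congr 1; ext t
      have := congrFun hMT t
      rw [← this, XB.mul_apply, ← kB_apply]; ring)
    (k1.trans k2.symm) t
  linarith



theorem shift_bij {n : ℕ} (om : Fin n → ℝ) (g : (Fin n → ℝ) → ℝ) {K : ℝ} (hg : Differentiable ℝ g)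
    (hK : ∀ A, ‖fderiv ℝ g A‖ ≤ K) (hs : K * ‖om‖ ≤ 1 / 2) :
    Function.Bijective (fun A : Fin n → ℝ => A + g A • om) := by
  have hl : ∀ A B, ‖g A • om - g B • om‖ ≤ 1 / 2 * ‖A - B‖ := by
    intro A B
    have h1 : ‖g A - g B‖ ≤ K * ‖A - B‖ := Convex.norm_image_sub_le_of_norm_fderiv_le (𝕜 := ℝ) (s := Set.univ)
      (fun x _ => hg x) (fun x _ => hK x) convex_univ (Set.mem_univ B) (Set.mem_univ A)
    rw [← sub_smul, norm_smul]
    calc ‖g A - g B‖ * ‖om‖ ≤ K * ‖A - B‖ * ‖om‖ := mul_le_mul_of_nonneg_right h1 (norm_nonneg _)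
      _ = K * ‖om‖ * ‖A - B‖ := by ring
      _ ≤ _ := mul_le_mul_of_nonneg_right hs (norm_nonneg _)
  refine ⟨fun A B hAB => ?_, fun y => ?_⟩
  · have h1 := hl B A
    have h2 : g B • om - g A • om = A - B := by
      simp only at hAB
      rw [sub_eq_sub_iff_add_eq_add, add_comm, ← hAB, add_comm]
    rw [h2, norm_sub_rev B A] at h1
    have h3 := norm_nonneg (A - B)
    exact sub_eq_zero.1 (norm_eq_zero.1 (by linarith))
  · have hc : ContractingWith (1 / 2) (fun A => y - g A • om) := by
      refine ⟨by norm_num, LipschitzWith.of_dist_le_mul fun A B => ?_⟩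
      rw [dist_eq_norm, dist_eq_norm, sub_sub_sub_cancel_left, norm_sub_rev A B]
      simpa using hl B A
    have hf := hc.fixedPoint_isFixedPt
    refine ⟨ContractingWith.fixedPoint _ hc, ?_⟩
    have h4 : y - g (ContractingWith.fixedPoint _ hc) • om = ContractingWith.fixedPoint _ hc := hf
    simp only
    nth_rewrite 1 [← h4]
    abel

theorem actions_eq {n : ℕ} (om : Fin n → ℝ) (f : (Fin n → ℝ) → ℝ) {mu C0 : ℝ} (A : Fin n → ℝ) (h vq vQ : XB)
    {al th c d e : ℝ} (hh : ∀ t, h t = mu * f (fun i => om i * t + A i))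
    {q Q : ℝ → ℝ} {be : ℝ}
    (hq : IsPseudoHet n om f mu A 0 C0 q) (hQ : IsModPseudoHet n om f mu (A + th • om) 0 C0 Q be)
    (hvq : vq = Gw (MB vq h)) (hvQ : QE vQ h al th c)
    (hS : SB h vq (MB vq h) = SB h vQ (MT vQ h al th))
    (hP : ∀ t, wt t * PsiB th t = psi0 (t - th))
    (hk : kap th = ∫ t, (q0 t - q0 (t - th)) * psi0 (t - th))
    (hY : ∀ t, YB (-th) t = q0 (t + -th) - q0 t)
    {a : ℝ} (ha0 : 0 < a) (ha : a ≤ ell (PsiB th * kB))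
    (n1 : ‖vq‖ ≤ d) (n2 : ‖vQ‖ ≤ d) (n3 : C0 * |mu| + ‖YB (-th)‖ ≤ d) (n4 : ‖h‖ ≤ e)
    (hsm : 16 * (e + d) * (1 + (∫ t, sch t) / a) ^ 2 ≤ 1) :
    Homoclinic n om f mu A q = RedHomoclinic n om f mu (A + th • om) Q := by
  have hI0 : 0 ≤ ∫ t, sch t := integral_nonneg fun t => (sch_pos t).le
  have hed : 0 ≤ 16 * (e + d) := by
    have := (norm_nonneg _).trans n1
    have := (norm_nonneg _).trans n4
    positivity
  have hsm1 : 16 * (e + d) ≤ 1 := by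
    refine le_trans (le_mul_of_one_le_right hed ?_) hsm
    have : 0 ≤ (∫ t, sch t) / a := by positivity
    nlinarith
  obtain ⟨q1, q2, q3, q4, -, -⟩ := hq
  obtain ⟨Q1, Q2, Q3, Q4, -, -⟩ := hQ
  have eq : q = fun t => q0 t + wt t * vq t := by
    refine q_ident h vq hvq q q1 (d := d) (e := e) (fun t => ?_) n1 n4 hsm1 (fun t ht => ?_) q4
    · have := q2 t
      rw [sub_zero] at this
      linarith [norm_nonneg (YB (-th))]
    · refine ⟨(q3 t ht).1, (q3 t ht).2.congr_deriv ?_⟩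
      rw [hh]; ring
  have hsh : ∀ t, (fun i => om i * (t - th) + (A + th • om) i) = fun i => om i * t + A i := by
    intro t; ext i
    simp only [Pi.add_apply, Pi.smul_apply, smul_eq_mul]; ring
  have dQ : deriv (fun t => Q (t - th)) = fun t => deriv Q (t - th) := by
    ext t; exact deriv_comp_sub_const _ _ _
  have hs : ∀ t, HasDerivAt (fun t : ℝ => t - th) 1 t := fun t => (hasDerivAt_id t).sub_const th
  have eQ : (fun t => Q (t - th)) = fun t => q0 t + wt t * vQ t := by
    refine Q_ident h vQ hvQ _ (Q1.comp (continuous_id.sub continuous_const)) (d := d) (e := e) (a := a) (be := be)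
      (fun t => ?_) n2 n4 hP hk ha0 ha hsm (fun t => ?_) ?_
    · have := Q2 (t - th)
      rw [sub_zero] at this
      have h2 := XB.le (YB (-th)) t
      rw [hY t, ← sub_eq_add_neg] at h2
      have := abs_add_le (Q (t - th) - q0 (t - th)) (q0 (t - th) - q0 t)
      rw [sub_add_sub_cancel] at this
      linarith
    · rw [dQ]
      have k1 := (Q3 (t - th)).1.comp t (hs t)
      have k2 := (Q3 (t - th)).2.comp t (hs t)
      refine ⟨HasDerivAt.congr_deriv (f := fun t => Q (t - th)) k1 (mul_one _),
        HasDerivAt.congr_deriv (f := fun t => deriv Q (t - th)) k2 ?_⟩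
      rw [hsh, hh, sub_zero]; ring
    · rw [← Q4, ← integral_sub_right_eq_self (fun t => (Q t - q0 (t - 0)) * psi0 (t - 0)) th]
      simp only [sub_zero]
  have hvq0 : vq = Gw (MB vq h) + (0:ℝ) • kB := by rw [zero_smul, add_zero]; exact hvq
  obtain ⟨a1, a2⟩ := action_id h vq (MB vq h) 0 hvq0
  obtain ⟨b1, b2⟩ := action_id h vQ (MT vQ h al th) c hvQ.1
  rw [← eq] at a1 a2
  rw [← eQ] at b1
  have L1 : (fun t => Lag n om f mu A q t) =
      fun t => (deriv q t) ^ 2 / 2 + (1 - cos (q0 t + wt t * vq t)) * (1 - h t) := by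
    ext t
    have := congrFun eq t
    rw [← this, Lag, hh]; ring
  have L2 : (fun t => Lag n om f mu (A + th • om) Q (t - th)) =
      fun t => (deriv (fun t => Q (t - th)) t) ^ 2 / 2 + (1 - cos (q0 t + wt t * vQ t)) * (1 - h t) := by
    ext t
    have := congrFun eQ t
    rw [← this, dQ, Lag, hh, hsh]; ring
  rw [Homoclinic, RedHomoclinic, L1, ← integral_sub_right_eq_self (fun t => Lag n om f mu (A + th • om) Q t) th, L2, b1, ← hS, ← a1]
  have := intervalIntegral.integral_Iic_add_Ioi (a2.integrableOn (s := Set.Iic 0)) (a2.integrableOn (s := Set.Ioi 0))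
  rw [← this, integral_Iic_eq_integral_Iio]



theorem main_aux
    (n : ℕ) (om : Fin n → ℝ)
    (f : (Fin n → ℝ) → ℝ) (hf : ContDiff ℝ (⊤ : ℕ∞) f)
    (hper : ∀ (k : Fin n → ℤ) (x : Fin n → ℝ),
      f (x + fun i => 2 * Real.pi * (k i : ℝ)) = f x)
    (μ1 C0 : ℝ) (hμ1 : 0 < μ1) (hC0 : 0 < C0)
    (q : ℝ → (Fin n → ℝ) → ℝ → ℝ)
    (hq : ∀ μ : ℝ, |μ| < μ1 → ∀ A : Fin n → ℝ, IsPseudoHet n om f μ A 0 C0 (q μ A))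
    (Qm : ℝ → (Fin n → ℝ) → ℝ → ℝ) (αm : ℝ → (Fin n → ℝ) → ℝ)
    (hQm : ∀ μ : ℝ, |μ| < μ1 → ∀ A : Fin n → ℝ, IsModPseudoHet n om f μ A 0 C0 (Qm μ A) (αm μ A)) :
    ∃ μ0 : ℝ, 0 < μ0 ∧ μ0 ≤ μ1 ∧
    ∃ g : ℝ → (Fin n → ℝ) → ℝ,
      (∀ μ : ℝ, |μ| < μ0 →
        ContDiff ℝ (⊤ : ℕ∞) (g μ) ∧
        (∀ (k : Fin n → ℤ) (A : Fin n → ℝ),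
          g μ (A + fun i => 2 * Real.pi * (k i : ℝ)) = g μ A) ∧
        Function.Bijective (fun A : Fin n → ℝ => A + g μ A • om) ∧
        ∀ A : Fin n → ℝ,
          Homoclinic n om f μ A (q μ A)
            = RedHomoclinic n om f μ (A + g μ A • om) (Qm μ (A + g μ A • om))) ∧
      ∀ ε > (0:ℝ), ∃ μ2 > (0:ℝ), ∀ μ : ℝ, |μ| < μ2 → |μ| < μ0 →
        ∀ A : Fin n → ℝ, |g μ A| + ‖fderiv ℝ (g μ) A‖ < ε := by
  obtain ⟨fA, C, hC, fAs, fAe, fAb, fAd⟩ := forcing_exists om f hf hper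
  obtain ⟨Γ, vq, vQ, aQ, cQ, ⟨z1, z2, z3⟩, ⟨sΓ, cq, cQc⟩, hcore⟩ := core
  set r : ℝ := (1 + (∫ t, sch t) / (a0 / 2)) ^ 2 with hr
  have a0p := a0_pos
  have r1 : 1 ≤ r := by
    have hI0 : 0 ≤ ∫ t, sch t := integral_nonneg fun t => (sch_pos t).le
    have : 0 ≤ (∫ t, sch t) / (a0 / 2) := by positivity
    rw [hr]; nlinarith
  have r0 : 0 < r := by linarith
  set η : ℝ := 1 / (64 * r) with hη
  have η0 : 0 < η := by positivity
  set L : ℝ := ‖fderiv ℝ Γ 0‖ + 1 with hL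
  have L0 : 0 < L := by positivity
  have tΓ : Tendsto Γ (𝓝 0) (𝓝 0) := by have := sΓ.cont.tendsto; rwa [z1] at this
  have tΓn : Tendsto (fun h => -Γ h) (𝓝 0) (𝓝 0) := by simpa using tΓ.neg
  have YB0 : YB 0 = 0 := by
    ext t; rw [YB_apply.self_of_nhds t]; simp
  have ev1 := tΓ.eventually PsiB_apply
  have ev2 := tΓ.eventually kap_apply
  have ev3 := tΓn.eventually YB_apply
  have ev4 : ∀ᶠ h in 𝓝 (0:XB), a0 / 2 ≤ ell (PsiB (Γ h) * kB) := by
    have hc : ContinuousAt (fun s => ell (PsiB s * kB)) 0 :=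
      ell.continuous.continuousAt.comp (PsiB_smooth.cont.mul continuousAt_const)
    have : ∀ᶠ s in 𝓝 (0:ℝ), a0 / 2 < ell (PsiB s * kB) :=
      hc.tendsto.eventually (lt_mem_nhds (show a0 / 2 < ell (PsiB 0 * kB) by rw [← a0]; linarith))
    filter_upwards [tΓ.eventually this] with h hh using hh.le
  have nrm : ∀ {F : XB → XB}, Tendsto F (𝓝 0) (𝓝 0) → ∀ᶠ h in 𝓝 (0:XB), ‖F h‖ ≤ η := by
    intro F hF
    have := hF.norm
    rw [norm_zero] at this
    filter_upwards [this.eventually (gt_mem_nhds η0)] with h hh using hh.le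
  have ev5 : ∀ᶠ h in 𝓝 (0:XB), ‖vq h‖ ≤ η := nrm (by have := cq.tendsto; rwa [z2] at this)
  have ev6 : ∀ᶠ h in 𝓝 (0:XB), ‖vQ h‖ ≤ η := nrm (by have := cQc.tendsto; rwa [z3] at this)
  have ev7 : ∀ᶠ h in 𝓝 (0:XB), ‖YB (-Γ h)‖ ≤ η := nrm (F := fun h => YB (-Γ h)) (by
    have := YB_smooth.cont.tendsto
    rw [YB0] at this
    exact this.comp tΓn)
  have ev8 : ∀ᶠ h in 𝓝 (0:XB), ‖h‖ ≤ η := nrm (F := fun h => h) tendsto_id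
  have ev9 : ∀ᶠ h in 𝓝 (0:XB), ‖fderiv ℝ Γ h‖ ≤ L := by
    have := sΓ.fderiv.cont.norm.tendsto.eventually (gt_mem_nhds (show ‖fderiv ℝ Γ 0‖ < L by rw [hL]; linarith))
    filter_upwards [this] with h hh using hh.le
  have evall := (((hcore.and ev1).and (ev2.and ev3)).and ((ev4.and ev5).and (ev6.and ev7))).and
    ((ev8.and ev9).and sΓ)
  obtain ⟨ρ, ρ0, hρ⟩ := Metric.eventually_nhds_iff.1 evall
  have hb : ∀ {μ R : ℝ} (A), |μ| < R / (C + 1) → dist (μ • fA A) 0 < R := by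
    intro μ R A hm
    rw [dist_zero_right, norm_smul, Real.norm_eq_abs]
    rw [lt_div_iff₀ (by positivity)] at hm
    refine lt_of_le_of_lt (mul_le_mul_of_nonneg_left (fAb A) (abs_nonneg _)) ?_
    have := abs_nonneg μ
    linarith
  let g : ℝ → (Fin n → ℝ) → ℝ := fun μ A => Γ (μ • fA A)
  have gfd : ∀ {μ}, |μ| < ρ / (C + 1) → ∀ A, ‖fderiv ℝ (g μ) A‖ ≤ L * |μ| * C := by
    intro μ hμ A
    obtain ⟨-, ⟨-, p2⟩, p3⟩ := hρ (hb A hμ)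
    have d1 : HasFDerivAt Γ (fderiv ℝ Γ (μ • fA A)) (μ • fA A) :=
      (p3.differentiableAt (by simp)).hasFDerivAt
    have d2 : HasFDerivAt (fun A => μ • fA A) (μ • fderiv ℝ fA A) A :=
      ((fAs.differentiable (by simp)) A).hasFDerivAt.const_smul μ
    have d3 : HasFDerivAt (g μ) _ A := d1.comp A d2
    rw [d3.fderiv]
    refine (ContinuousLinearMap.opNorm_comp_le _ _).trans ?_
    rw [norm_smul, Real.norm_eq_abs, mul_assoc]
    exact mul_le_mul p2 (mul_le_mul_of_nonneg_left (fAd A) (abs_nonneg _)) (by positivity) L0.le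
  let W := L * C * ‖om‖ * 2 + 1
  have W0 : 0 < W := by positivity
  refine ⟨min (min μ1 (ρ / (C + 1))) (min (η / C0) (1 / W)), by positivity,
    (min_le_left _ _).trans (min_le_left _ _), g, fun μ hμ => ?_, fun ε hε => ?_⟩
  · obtain ⟨hμa, hμb⟩ := lt_min_iff.1 hμ
    obtain ⟨m1, m2⟩ := lt_min_iff.1 hμa
    obtain ⟨m3, m4⟩ := lt_min_iff.1 hμb
    rw [lt_div_iff₀ hC0] at m3
    rw [lt_div_iff₀ W0] at m4
    have gs : ContDiff ℝ ∞ (g μ) := by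
      rw [contDiff_iff_contDiffAt]
      intro A
      obtain ⟨-, -, p3⟩ := hρ (hb A m2)
      exact ContDiffAt.comp (g := Γ) (f := fun A => μ • fA A) A p3 (ContDiff.contDiffAt (fAs.const_smul μ))
    refine ⟨gs, fun k A => ?_, ?_, fun A => ?_⟩
    · have : fA (A + fun i => 2 * Real.pi * (k i : ℝ)) = fA A := by
        ext t
        rw [fAe, fAe, ← hper k (fun i => om i * t + A i)]
        congr 1; ext i
        simp only [Pi.add_apply]; ring
      simp only [g]; rw [this]
    · refine shift_bij om (g μ) (gs.differentiable (by simp)) (gfd m2) ?_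
      have := abs_nonneg μ
      simp only [W] at m4
      nlinarith
    · obtain ⟨⟨⟨⟨⟨k1, k2, k3⟩, p1⟩, p2, p3⟩, ⟨p4, p5⟩, p6, p7⟩, ⟨p8, -⟩, -⟩ := hρ (hb A m2)
      refine actions_eq om f A (μ • fA A) _ _ (d := 2 * η) (e := η) (fun t => ?_) (hq μ m1 A)
        (hQm μ m1 (A + g μ A • om)) k1 k2 k3 p1 p2 p3 (a := a0 / 2) (by positivity) p4
        (by linarith) (by linarith) (by linarith) p8 ?_
      · rw [XB.smul_apply, fAe]
      · rw [← hr, hη]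
        field_simp
        norm_num
  · obtain ⟨δ, δ0, hδ⟩ := Metric.tendsto_nhds_nhds.1 tΓ (ε / 2) (by positivity)
    refine ⟨min (δ / (C + 1)) (ε / (2 * (L * C + 1))), by positivity, fun μ hμ hμ0 A => ?_⟩
    obtain ⟨m1, m2⟩ := lt_min_iff.1 hμ
    have m3 := (lt_min_iff.1 (lt_min_iff.1 hμ0).1).2
    have b1 := hδ (hb A m1)
    rw [dist_zero_right, Real.norm_eq_abs] at b1
    have b2 := gfd m3 A
    rw [lt_div_iff₀ (by positivity)] at m2
    have b3 : L * |μ| * C < ε / 2 := by nlinarith [abs_nonneg μ]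
    simp only [g] at b2 ⊢
    linarith

end HomoclinicHelpers

/-- For `μ` small there is a smooth diffeomorphism of the torus
`ψ_μ(A) = A + g_μ(A) ω`, with `(g_μ, ∂_A g_μ) → 0` uniformly as `μ → 0`, such that
`G_μ = G̃_μ ∘ ψ_μ`. -/
theorem homoclinic_reduced_conjugation
    (n : ℕ) (ω : Fin n → ℝ) (γ τ : ℝ) (hγ : 0 < γ) (hτ : (n : ℝ) < τ)
    (hH1 : ∀ k : Fin n → ℤ, k ≠ 0 →
      γ / ‖(fun i => (k i : ℝ))‖ ^ τ ≤ |∑ i, (k i : ℝ) * ω i|)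
    (f : (Fin n → ℝ) → ℝ) (hf : ContDiff ℝ (⊤ : ℕ∞) f)
    (hper : ∀ (k : Fin n → ℤ) (x : Fin n → ℝ),
      f (x + fun i => 2 * Real.pi * (k i : ℝ)) = f x)
    (μ1 C0 : ℝ) (hμ1 : 0 < μ1) (hC0 : 0 < C0)
    (q : ℝ → (Fin n → ℝ) → ℝ → ℝ)
    (hq : ∀ μ : ℝ, |μ| < μ1 → ∀ A : Fin n → ℝ,
      IsPseudoHet n ω f μ A 0 C0 (q μ A) ∧
      ∀ r : ℝ → ℝ, IsPseudoHet n ω f μ A 0 C0 r → r = q μ A)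
    (Qm : ℝ → (Fin n → ℝ) → ℝ → ℝ) (αm : ℝ → (Fin n → ℝ) → ℝ)
    (hQm : ∀ μ : ℝ, |μ| < μ1 → ∀ A : Fin n → ℝ,
      IsModPseudoHet n ω f μ A 0 C0 (Qm μ A) (αm μ A) ∧
      ∀ (R : ℝ → ℝ) (β : ℝ), IsModPseudoHet n ω f μ A 0 C0 R β →
        R = Qm μ A ∧ β = αm μ A) :
    ∃ μ0 : ℝ, 0 < μ0 ∧ μ0 ≤ μ1 ∧
    ∃ g : ℝ → (Fin n → ℝ) → ℝ,
      (∀ μ : ℝ, |μ| < μ0 →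
        ContDiff ℝ (⊤ : ℕ∞) (g μ) ∧
        (∀ (k : Fin n → ℤ) (A : Fin n → ℝ),
          g μ (A + fun i => 2 * Real.pi * (k i : ℝ)) = g μ A) ∧
        Function.Bijective (fun A : Fin n → ℝ => A + g μ A • ω) ∧
        ∀ A : Fin n → ℝ,
          Homoclinic n ω f μ A (q μ A)
            = RedHomoclinic n ω f μ (A + g μ A • ω) (Qm μ (A + g μ A • ω))) ∧
      ∀ ε > (0:ℝ), ∃ μ2 > (0:ℝ), ∀ μ : ℝ, |μ| < μ2 → |μ| < μ0 →
        ∀ A : Fin n → ℝ, |g μ A| + ‖fderiv ℝ (g μ) A‖ < ε := by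
  exact main_aux n ω f hf hper μ1 C0 hμ1 hC0 q (fun μ h A => (hq μ h A).1) Qm αm (fun μ h A => (hQm μ h A).1)
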